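/- Let T be an automorphism whose every self-joining of every finite order projects as product measure on pairs of coordinates whenever the corresponding fiber systems are disjoint, in the setting: T is a μ-preserving homeomorphism of a compact metric space with ergodic decomposition μ = ∫ μ_x̄ dP(x̄), P continuous, such that (i) each fiber system T_x̄ is disjoint from all but countably many other fibers, (ii) any two non-disjoint fibers are isomorphic, and (iii) every fiber has the MSJ (hence PID) property. Then for every n ≥ 1 and every n-fold self-joining η of T, the system (T^{×n}, η) is disjoint from every ergodic system. -/

import Mathlib

open MeasureTheory

/-- Two `T`-invariant measures `ν ν'` are disjoint: the only `T × T`-invariant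
probability measure on `X × X` with marginals `ν` and `ν'` is `ν ⊗ ν'`. -/
def FibersDisjoint {X : Type} [MeasurableSpace X] (T : X → X) (ν ν' : Measure X) :
    Prop :=
  ∀ lam : Measure (X × X), IsProbabilityMeasure lam →
    MeasurePreserving (Prod.map T T) lam lam →
    lam.map Prod.fst = ν → lam.map Prod.snd = ν' → lam = ν.prod ν'

/-- The systems `(X, ν, T)` and `(X, ν', T)` are isomorphic (mod 0). -/
def FibersIsomorphic {X : Type} [MeasurableSpace X] (T : X → X) (ν ν' : Measure X) :
    Prop :=
  ∃ φ ψ : X → X, MeasurePreserving φ ν ν' ∧ Measurable ψ ∧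
    ((fun x => φ (T x)) =ᵐ[ν] (fun x => T (φ x))) ∧
    ((fun x => ψ (φ x)) =ᵐ[ν] id) ∧ ((fun x => φ (ψ x)) =ᵐ[ν'] id)

/-- The system `(X, ν, T)` (with `T` an invertible transformation, so that all powers
`T^k`, `k : ℤ`, make sense) has the minimal self-joinings (MSJ) property: every
ergodic infinite self-joining is a product of off-diagonal joinings.  Concretely,
there are an assignment `c` of coordinates to classes (with representative `c i ≤ i`)
and powers `k i : ℤ` such that every finite-dimensional marginal of the self-joining
is the image of a product measure under the corresponding off-diagonal map. -/
def HasMSJ {X : Type} [MeasurableSpace X] (T : Equiv.Perm X) (ν : Measure X) : Prop :=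
  ∀ lam : Measure (ℕ → X), IsProbabilityMeasure lam →
    MeasurePreserving (fun x n => T (x n)) lam lam →
    (∀ i, lam.map (fun x => x i) = ν) →
    Ergodic (fun x n => T (x n)) lam →
    ∃ (c : ℕ → ℕ) (k : ℕ → ℤ) (hc : ∀ i, c i ≤ i), ∀ n : ℕ,
      lam.map (fun x (i : Fin n) => x i)
        = (Measure.pi (fun _ : Fin n => ν)).map
            (fun y (i : Fin n) => (T ^ (k (i : ℕ)))
              (y ⟨c (i : ℕ), lt_of_le_of_lt (hc (i : ℕ)) i.isLt⟩))

section

open Set Filter Topology ProbabilityTheory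
open scoped ENNReal BoundedContinuousFunction

/-- Inner approximation of analytic sets by compact sets. -/
theorem MeasureTheory.AnalyticSet.exists_isCompact_le_measure {Y : Type*} [TopologicalSpace Y]
    [TopologicalSpace.MetrizableSpace Y] [MeasurableSpace Y] [BorelSpace Y] {A : Set Y}
    (hA : AnalyticSet A) (μ : Measure Y) [IsFiniteMeasure μ] {c : ℝ≥0∞} (hc : c < μ A) :
    ∃ F ⊆ A, IsCompact F ∧ c ≤ μ F := by
  let := TopologicalSpace.metrizableSpaceMetric Y
  rw [AnalyticSet] at hA
  rcases hA with rfl | ⟨f, hf, rfl⟩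
  · simp at hc
  have hstep : ∀ (k : ℕ) (D : {D : Set (ℕ → ℕ) // c < μ (f '' D)}),
      ∃ N : ℕ, c < μ (f '' (D.1 ∩ {σ | σ k ≤ N})) := by
    intro k D
    have hmono : Monotone fun N : ℕ => f '' (D.1 ∩ {σ | σ k ≤ N}) := by
      intro a b hab
      exact image_mono (inter_subset_inter_right _ fun σ (h : σ k ≤ a) => h.trans hab)
    have hU : (⋃ N : ℕ, f '' (D.1 ∩ {σ | σ k ≤ N})) = f '' D.1 := by
      rw [← image_iUnion, ← inter_iUnion]
      congr 1
      ext σ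
      simp only [mem_inter_iff, mem_iUnion, mem_ofPred_eq, and_iff_left_iff_imp]
      exact fun _ => ⟨σ k, le_rfl⟩
    have h := D.2
    rw [← hU, hmono.measure_iUnion] at h
    exact lt_iSup_iff.1 h
  choose N hN using hstep
  let D : ℕ → {D : Set (ℕ → ℕ) // c < μ (f '' D)} := fun n =>
    Nat.rec ⟨univ, by simpa using hc⟩ (fun k D => ⟨_, hN k D⟩) n
  have hDsucc : ∀ k, (D (k + 1)).1 = (D k).1 ∩ {σ | σ k ≤ N k (D k)} := fun k => rfl
  set b : ℕ → ℕ := fun k => N k (D k) with hb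
  have hD : ∀ k, ∀ σ ∈ (D k).1, ∀ i < k, σ i ≤ b i := by
    intro k
    induction k with
    | zero => intro σ _ i hi; omega
    | succ k ih =>
      intro σ hσ i hi
      rw [hDsucc] at hσ
      rcases Nat.lt_succ_iff_lt_or_eq.1 hi with h | rfl
      · exact ih σ hσ.1 i h
      · exact hσ.2
  set K : Set (ℕ → ℕ) := univ.pi fun i => Iic (b i) with hK
  have hKc : IsCompact K := isCompact_univ_pi fun i => (finite_Iic _).isCompact
  refine ⟨f '' K, image_subset_range _ _, hKc.image hf, ?_⟩
  rw [(f '' K).measure_eq_iInf_isOpen μ]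
  refine le_iInf₂ fun U hKU => le_iInf fun hU => ?_
  obtain ⟨k, hk⟩ : ∃ k, (D k).1 ⊆ f ⁻¹' U := by
    by_contra! hcon
    have hcon' : ∀ k, ∃ σ ∈ (D k).1, σ ∉ f ⁻¹' U := fun k => not_subset.1 (hcon k)
    choose τ hτD hτU using hcon'
    obtain ⟨σ, hσ, φ, hφ, hlim⟩ := hKc.tendsto_subseq (x := fun k i => min (τ k i) (b i))
      (fun k i _ => mem_Iic.2 (min_le_right (τ k i) (b i)))
    have hlim' : Tendsto (τ ∘ φ) atTop (𝓝 σ) := by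
      rw [tendsto_pi_nhds] at hlim ⊢
      intro i
      refine (hlim i).congr' ?_
      filter_upwards [eventually_gt_atTop i] with k hk
      exact min_eq_left (hD _ _ (hτD _) i (hk.trans_le hφ.le_apply))
    have : σ ∈ (f ⁻¹' U)ᶜ := (hU.preimage hf).isClosed_compl.mem_of_tendsto hlim'
      (Eventually.of_forall fun k => hτU _)
    exact this (hKU (mem_image_of_mem f hσ))
  exact (D k).2.le.trans (measure_mono (image_subset_iff.2 hk))

theorem ProbabilityMeasure.measurableSpace_le_borel {Y : Type*} [MetricSpace Y]
    [MeasurableSpace Y] [BorelSpace Y] :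
    (inferInstance : MeasurableSpace (ProbabilityMeasure Y)) ≤ borel (ProbabilityMeasure Y) := by
  have key : @Measurable _ _ (borel (ProbabilityMeasure Y)) _
      (fun ν : ProbabilityMeasure Y => (ν : Measure Y)) := by
    let : MeasurableSpace (ProbabilityMeasure Y) := borel _
    have : BorelSpace (ProbabilityMeasure Y) := ⟨rfl⟩
    refine Measurable.measure_of_isPiSystem_of_isProbabilityMeasure
      (S := {F : Set Y | IsClosed F}) ?_ isPiSystem_isClosed ?_
    · rw [BorelSpace.measurable_eq (α := Y), borel_eq_generateFrom_isClosed]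
    · intro F hF
      refine measurable_of_tendsto_metrizable
        (f := fun n (ν : ProbabilityMeasure Y) => ∫⁻ x, (hF : IsClosed F).apprSeq n x ∂ν) ?_ ?_
      · intro n
        have h := (ProbabilityMeasure.continuous_testAgainstNN_eval
          ((hF : IsClosed F).apprSeq n)).measurable
        convert h.coe_nnreal_ennreal using 2 with ν
        rw [FiniteMeasure.testAgainstNN_coe_eq]
        rfl
      · rw [tendsto_pi_nhds]
        intro ν
        exact HasOuterApproxClosed.tendsto_lintegral_apprSeq hF _
  intro s hs
  obtain ⟨t, ht, rfl⟩ := hs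
  exact @key t ht

theorem MeasurableSet.analyticSet_image_probabilityMeasure {Y : Type*} [MetricSpace Y]
    [CompactSpace Y] [MeasurableSpace Y] [BorelSpace Y] {E : Type*} [TopologicalSpace E]
    [MeasurableSpace E] [OpensMeasurableSpace E] [SecondCountableTopology E]
    {B : Set (ProbabilityMeasure Y)} (hB : MeasurableSet B) {g : ProbabilityMeasure Y → E}
    (hg : Measurable g) : AnalyticSet (g '' B) := by
  have hle := ProbabilityMeasure.measurableSpace_le_borel (Y := Y)
  let := TopologicalSpace.metrizableSpaceMetric (ProbabilityMeasure Y)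
  have hpol : PolishSpace (ProbabilityMeasure Y) := inferInstance
  exact @MeasurableSet.analyticSet_image (ProbabilityMeasure Y) E (borel _)
    (@standardBorel_of_polish _ (borel _) _ (@BorelSpace.mk _ _ (borel _) rfl) hpol) _ _ _ g _ B
    (hle _ hB) (hg.mono hle le_rfl)

theorem MeasurableSpace.exists_seq_isPiSystem (Y : Type*) [m : MeasurableSpace Y]
    [MeasurableSpace.CountablyGenerated Y] :
    ∃ A : ℕ → Set Y, (∀ j, MeasurableSet (A j)) ∧ IsPiSystem (range A) ∧
      MeasurableSpace.generateFrom (range A) = m := by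
  have hc : (generateSetAlgebra (MeasurableSpace.countableGeneratingSet Y)).Countable :=
    countable_generateSetAlgebra (MeasurableSpace.countable_countableGeneratingSet)
  have halg := isSetAlgebra_generateSetAlgebra
    (𝒜 := MeasurableSpace.countableGeneratingSet Y)
  obtain ⟨A, hA⟩ := hc.exists_eq_range ⟨∅, halg.empty_mem⟩
  have hgen : MeasurableSpace.generateFrom (range A) = m := by
    rw [← hA, generateFrom_generateSetAlgebra_eq,
      MeasurableSpace.generateFrom_countableGeneratingSet]
  refine ⟨A, fun j => ?_, ?_, hgen⟩
  · rw [← hgen]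
    exact MeasurableSpace.measurableSet_generateFrom (mem_range_self j)
  · rw [← hA]
    intro s hs t ht _
    exact halg.inter_mem hs ht

theorem MeasureTheory.Measure.ext_of_seq {Y : Type*} [m : MeasurableSpace Y] {A : ℕ → Set Y}
    (hpi : IsPiSystem (range A)) (hgen : MeasurableSpace.generateFrom (range A) = m)
    {ν ν' : Measure Y} [IsProbabilityMeasure ν] [IsProbabilityMeasure ν']
    (h : ∀ j, ν (A j) = ν' (A j)) : ν = ν' := by
  refine ext_of_generate_finite (range A) hgen.symm hpi ?_ (by simp)
  rintro _ ⟨j, rfl⟩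
  exact h j

theorem measurableSet_measure_eq {W Y : Type*} [MeasurableSpace W] [MeasurableSpace Y]
    [MeasurableSpace.CountablyGenerated Y] {f g : W → Measure Y} (hf : Measurable f)
    (hg : Measurable g) (hf1 : ∀ w, IsProbabilityMeasure (f w))
    (hg1 : ∀ w, IsProbabilityMeasure (g w)) : MeasurableSet {w | f w = g w} := by
  obtain ⟨A, hA, hpi, hgen⟩ := MeasurableSpace.exists_seq_isPiSystem Y
  have : {w | f w = g w} = ⋂ j, {w | f w (A j) = g w (A j)} := by
    ext w
    simp only [mem_ofPred_eq, mem_iInter]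
    exact ⟨fun h j => by rw [h], fun h => Measure.ext_of_seq hpi hgen h⟩
  rw [this]
  exact MeasurableSet.iInter fun j => measurableSet_eq_fun
    ((Measure.measurable_coe (hA j)).comp hf) ((Measure.measurable_coe (hA j)).comp hg)

theorem ProbabilityMeasure.exists_injective_nat (X : Type*) [MeasurableSpace X]
    [MeasurableSpace.CountablyGenerated X] :
    ∃ e : ProbabilityMeasure X → ℕ → ℝ≥0∞, Measurable e ∧ Function.Injective e := by
  obtain ⟨A, hA, hpi, hgen⟩ := MeasurableSpace.exists_seq_isPiSystem X
  refine ⟨fun ν j => (ν : Measure X) (A j), ?_, ?_⟩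
  · exact measurable_pi_lambda _ fun j => (Measure.measurable_coe (hA j)).comp
      measurable_subtype_coe
  · intro ν ν' h
    refine Subtype.ext ?_
    have h1 : IsProbabilityMeasure ν.1 := ν.2
    have h2 : IsProbabilityMeasure ν'.1 := ν'.2
    exact Measure.ext_of_seq hpi hgen fun j => congrFun h j

/-- A measurable family hitting the image of a measurable set of probability measures only along
null measurable sets avoids a measurable cover of that image almost surely. -/
theorem exists_measurable_cover_null {Y : Type*} [MetricSpace Y]
    [CompactSpace Y] [MeasurableSpace Y] [BorelSpace Y] {Ω D E : Type*} [MeasurableSpace Ω]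
    [MeasurableSpace D] [TopologicalSpace E] [TopologicalSpace.MetrizableSpace E]
    [SecondCountableTopology E] [MeasurableSpace E] [BorelSpace E] {e : D → E}
    (he : Measurable e) (hinj : Function.Injective e)
    {B : Set (ProbabilityMeasure Y)} (hB : MeasurableSet B) {g : ProbabilityMeasure Y → D}
    (hg : Measurable g) (P : Measure Ω) [IsFiniteMeasure P] {h : Ω → D} (hh : Measurable h)
    (hnull : ∀ S : Set Ω, MeasurableSet S → (∀ ω ∈ S, ∃ y ∈ B, g y = h ω) → P S = 0) :
    ∃ C : Set D, MeasurableSet C ∧ (∀ y ∈ B, g y ∈ C) ∧ P (h ⁻¹' C) = 0 := by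
  have han := MeasurableSet.analyticSet_image_probabilityMeasure hB (he.comp hg)
  set ν : Measure E := P.map (e ∘ h) with hν
  have h0 : ν ((e ∘ g) '' B) = 0 := by
    by_contra hne
    obtain ⟨c, hc0, hc⟩ := exists_between (pos_iff_ne_zero.2 hne)
    obtain ⟨F, hFA, hF, hcF⟩ := han.exists_isCompact_le_measure ν hc
    have hFm : MeasurableSet F := hF.isClosed.measurableSet
    have : ν F = 0 := by
      rw [hν, Measure.map_apply (he.comp hh) hFm]
      refine hnull _ (he.comp hh hFm) fun ω hω => ?_
      obtain ⟨y, hy, hyω⟩ := hFA hω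
      exact ⟨y, hy, hinj hyω⟩
    rw [this] at hcF
    exact absurd hcF hc0.not_ge
  refine ⟨e ⁻¹' toMeasurable ν ((e ∘ g) '' B), he (measurableSet_toMeasurable _ _), ?_, ?_⟩
  · intro y hy
    exact subset_toMeasurable _ _ (mem_image_of_mem (e ∘ g) hy)
  · rw [← preimage_comp, ← Measure.map_apply (he.comp hh) (measurableSet_toMeasurable _ _),
      measure_toMeasurable]
    exact h0

section ErgodicKernel

variable {Y : Type*} [MeasurableSpace Y] {S : Y → Y}

theorem birkhoffAverage_indicator_mem_Icc {Y : Type*} {S : Y → Y} (A : Set Y) (n : ℕ) (y : Y) :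
    birkhoffAverage ℝ S (A.indicator 1) n y ∈ Icc (0 : ℝ) 1 := by
  have h0 : ∀ z, (0 : ℝ) ≤ A.indicator 1 z := fun z => indicator_nonneg (by simp) z
  have h1 : ∀ z, A.indicator 1 z ≤ (1 : ℝ) := fun z => by
    by_cases hz : z ∈ A <;> simp [hz]
  rw [birkhoffAverage, birkhoffSum, smul_eq_mul]
  constructor
  · exact mul_nonneg (by positivity) (Finset.sum_nonneg fun i _ => h0 _)
  · rcases Nat.eq_zero_or_pos n with rfl | hn
    · simp
    · rw [inv_mul_le_iff₀ (by exact_mod_cast hn), mul_one]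
      calc _ ≤ ∑ i ∈ Finset.range n, (1 : ℝ) := Finset.sum_le_sum fun i _ => h1 _
        _ = n := by simp

theorem measurable_birkhoffAverage_indicator (hS : Measurable S) {A : Set Y}
    (hA : MeasurableSet A) (n : ℕ) :
    Measurable (birkhoffAverage ℝ S (A.indicator (1 : Y → ℝ)) n) := by
  have : birkhoffAverage ℝ S (A.indicator (1 : Y → ℝ)) n =
      fun y => (n : ℝ)⁻¹ * ∑ i ∈ Finset.range n, A.indicator 1 (S^[i] y) := rfl
  rw [this]
  refine Measurable.const_mul (Finset.measurable_sum _ fun i _ => ?_) _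
  exact (measurable_one.indicator hA).comp (hS.iterate i)

theorem setIntegral_birkhoffAverage_indicator {τ : Measure Y} [IsFiniteMeasure τ]
    (hS : MeasurePreserving S τ τ) {A B : Set Y} (hA : MeasurableSet A) (hB : MeasurableSet B)
    (hSB : S ⁻¹' B = B) {n : ℕ} (hn : 0 < n) :
    ∫ y in B, birkhoffAverage ℝ S (A.indicator 1) n y ∂τ = τ.real (A ∩ B) := by
  have hi : ∀ i, S^[i] ⁻¹' B = B := fun i => by
    induction i with
    | zero => rfl
    | succ i ih => rw [Function.iterate_succ, preimage_comp, ih, hSB]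
  have h1 : ∀ i, ∫ y in B, A.indicator (1 : Y → ℝ) (S^[i] y) ∂τ = τ.real (A ∩ B) := by
    intro i
    have hm := hS.iterate i
    have h2 : (fun y => A.indicator (1 : Y → ℝ) (S^[i] y)) = (S^[i] ⁻¹' A).indicator 1 := rfl
    rw [h2, integral_indicator_one (hm.measurable hA), measureReal_restrict_apply
      (hm.measurable hA)]
    nth_rewrite 1 [← hi i]
    rw [← preimage_inter, hm.measureReal_preimage (hA.inter hB).nullMeasurableSet]
  have hintegral : ∀ i ∈ Finset.range n,
      Integrable (fun y => A.indicator (1 : Y → ℝ) (S^[i] y)) (τ.restrict B) := fun i _ =>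
    ((integrable_const (1 : ℝ)).indicator ((hS.iterate i).measurable hA))
  simp only [birkhoffAverage, birkhoffSum, smul_eq_mul]
  rw [integral_const_mul, integral_finsetSum _ hintegral]
  simp only [h1, Finset.sum_const, Finset.card_range, nsmul_eq_mul]
  field_simp

theorem tendsto_setIntegral_of_tendsto_birkhoffAverage {τ : Measure Y} [IsFiniteMeasure τ]
    (hS : MeasurePreserving S τ τ) {A B : Set Y} (hA : MeasurableSet A) (hB : MeasurableSet B)
    (hSB : S ⁻¹' B = B) {φ : ℕ → ℕ} (hφ : StrictMono φ) {h : Y → ℝ}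
    (hh : ∀ᵐ y ∂τ, Tendsto (fun k => birkhoffAverage ℝ S (A.indicator 1) (φ k) y) atTop
      (𝓝 (h y))) :
    ∫ y in B, h y ∂τ = τ.real (A ∩ B) := by
  have h1 : Tendsto (fun k => ∫ y in B, birkhoffAverage ℝ S (A.indicator 1) (φ k) y ∂τ) atTop
      (𝓝 (∫ y in B, h y ∂τ)) := by
    refine tendsto_integral_of_dominated_convergence (fun _ => (1 : ℝ)) ?_ (integrable_const _)
      ?_ (ae_restrict_of_ae hh)
    · exact fun k => (measurable_birkhoffAverage_indicator hS.measurable hA _).aestronglyMeasurable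
    · refine fun k => Eventually.of_forall fun y => ?_
      have := birkhoffAverage_indicator_mem_Icc (S := S) A (φ k) y
      rw [Real.norm_eq_abs, abs_le]
      exact ⟨by linarith [this.1], this.2⟩
  refine tendsto_nhds_unique h1 (tendsto_const_nhds.congr' ?_)
  filter_upwards [eventually_gt_atTop 0] with k hk
  exact (setIntegral_birkhoffAverage_indicator hS hA hB hSB (hk.trans_le hφ.le_apply)).symm

theorem exists_tendsto_birkhoffAverage_indicator {ν : Measure Y} [IsProbabilityMeasure ν]
    (hS : MeasurePreserving S ν ν) {A : Set Y} (hA : MeasurableSet A) :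
    ∃ φ : ℕ → ℕ, StrictMono φ ∧ ∃ p : Y → ℝ,
      ∀ᵐ y ∂ν, Tendsto (fun k => birkhoffAverage ℝ S (A.indicator 1) (φ k) y) atTop
        (𝓝 (p y)) := by
  let U := (Lp.compMeasurePreservingₗᵢ ℝ S hS (E := ℝ) (p := 2)).toContinuousLinearMap
  have hU : ‖U‖ ≤ 1 := LinearIsometry.norm_toContinuousLinearMap_le _
  let F : Lp ℝ 2 ν := indicatorConstLp 2 hA (measure_ne_top ν A) 1
  obtain ⟨p, hlim⟩ : ∃ p : Lp ℝ 2 ν,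
      Tendsto (birkhoffAverage ℝ U _root_.id · F) atTop (𝓝 p) :=
    ⟨_, U.tendsto_birkhoffAverage_orthogonalProjection hU F⟩
  obtain ⟨φ, hφ, hae⟩ := (tendstoInMeasure_of_tendsto_Lp hlim).exists_seq_tendsto_ae
  have hit : ∀ i, ((U^[i] F : Lp ℝ 2 ν) : Y → ℝ) =ᵐ[ν] fun y => A.indicator 1 (S^[i] y) := by
    intro i
    induction i with
    | zero => exact indicatorConstLp_coeFn (hs := hA) (hμs := measure_ne_top ν A)
    | succ i ih =>
      rw [Function.iterate_succ_apply']
      refine (Lp.coeFn_compMeasurePreserving _ hS).trans ?_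
      refine (hS.quasiMeasurePreserving.ae_eq_comp ih).trans (Eventually.of_forall fun y => ?_)
      simp [Function.iterate_succ_apply]
  have hav : ∀ n, ((birkhoffAverage ℝ U _root_.id n F : Lp ℝ 2 ν) : Y → ℝ) =ᵐ[ν]
      birkhoffAverage ℝ S (A.indicator 1) n := by
    intro n
    rw [birkhoffAverage, birkhoffSum]
    refine (Lp.coeFn_smul _ _).trans ?_
    have h2 := Lp.coeFn_finsetSum (Finset.range n) fun i => (U^[i] F : Lp ℝ 2 ν)
    have h3 : ∀ᵐ y ∂ν, ∀ i ∈ Finset.range n, (U^[i] F : Lp ℝ 2 ν) y =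
        A.indicator 1 (S^[i] y) := by
      rw [eventually_finset_ball]
      exact fun i _ => hit i
    filter_upwards [h2, h3] with y hy hy3
    simp only [Pi.smul_apply, id_eq, birkhoffAverage, birkhoffSum]
    rw [hy, Finset.sum_apply, Finset.sum_congr rfl hy3]
  refine ⟨φ, hφ, p, ?_⟩
  filter_upwards [hae, ae_all_iff.2 hav] with y hy hy2
  refine hy.congr fun k => hy2 (φ k)

end ErgodicKernel

section ErgodicKernel

variable {Y : Type*} [MeasurableSpace Y] {S : Y → Y}

open MeasurableSpace in
theorem exists_measurable_invariants_tendsto_birkhoffAverage {ν : Measure Y}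
    [IsProbabilityMeasure ν] (hS : MeasurePreserving S ν ν) {A : Set Y} (hA : MeasurableSet A) :
    ∃ φ : ℕ → ℕ, StrictMono φ ∧ ∃ p : Y → ℝ, Measurable[invariants S] p ∧
      ∀ᵐ y ∂ν, Tendsto (fun k => birkhoffAverage ℝ S (A.indicator 1) (φ k) y) atTop
        (𝓝 (p y)) := by
  obtain ⟨φ, hφ, p, hp⟩ := exists_tendsto_birkhoffAverage_indicator hS hA
  let q : Y → ℝ := fun y =>
    limUnder atTop fun k => birkhoffAverage ℝ S (A.indicator (1 : Y → ℝ)) (φ k) y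
  have hq : Measurable q :=
    (StronglyMeasurable.limUnder fun k =>
      (measurable_birkhoffAverage_indicator hS.measurable hA _).stronglyMeasurable).measurable
  have hsub : ∀ y, Tendsto (fun k => birkhoffAverage ℝ S (A.indicator (1 : Y → ℝ)) (φ k) (S y) -
      birkhoffAverage ℝ S (A.indicator (1 : Y → ℝ)) (φ k) y) atTop (𝓝 0) := by
    intro y
    refine (tendsto_birkhoffAverage_apply_sub_birkhoffAverage' ℝ ?_ S y).comp hφ.tendsto_atTop
    refine (Metric.isBounded_Icc (0 : ℝ) 1).subset ?_
    rintro _ ⟨z, rfl⟩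
    by_cases hz : z ∈ A <;> simp [hz]
  have hinv : ∀ y, q (S y) = q y := by
    intro y
    have key : ∀ c, Tendsto (fun k => birkhoffAverage ℝ S (A.indicator (1 : Y → ℝ)) (φ k) (S y))
        atTop (𝓝 c) ↔
        Tendsto (fun k => birkhoffAverage ℝ S (A.indicator (1 : Y → ℝ)) (φ k) y) atTop (𝓝 c) := by
      intro c
      constructor <;> intro h
      · simpa using h.sub (hsub y)
      · simpa using h.add (hsub y)
    simp only [q, limUnder, lim]
    congr 1
    funext c
    exact propext (key c)
  refine ⟨φ, hφ, q, ?_, ?_⟩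
  · rw [measurable_invariants_dom]
    refine ⟨hq, fun s _ => ?_⟩
    ext y
    simp [hinv]
  · filter_upwards [hp] with y hy
    rwa [show q y = p y from hy.limUnder_eq]

open MeasurableSpace in
theorem condExpKernel_invariants_ae_eq [StandardBorelSpace Y] {ν : Measure Y}
    [IsProbabilityMeasure ν] {A : Set Y} (hA : MeasurableSet A) {p : Y → ℝ}
    (hp : Measurable[invariants S] p) (hpi : Integrable p ν)
    (h : ∀ B, MeasurableSet B → S ⁻¹' B = B → ∫ y in B, p y ∂ν = ν.real (A ∩ B)) :
    (fun y => (condExpKernel ν (invariants S) y).real A) =ᵐ[ν] p := by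
  refine (condExpKernel_ae_eq_condExp (invariants_le S) hA).trans ?_
  symm
  refine ae_eq_condExp_of_forall_setIntegral_eq (invariants_le S)
    ((integrable_const (1 : ℝ)).indicator hA) (fun _ _ _ => hpi.integrableOn) ?_
    hp.stronglyMeasurable.aestronglyMeasurable
  rintro B ⟨hB, hSB⟩ -
  rw [h B hB hSB, setIntegral_indicator hA, inter_comm]
  simp

/-- A kernel realizing the ergodic decomposition of an invariant measure. -/
structure IsErgodicKernel (S : Y → Y) (ν : Measure Y) (K : Kernel Y Y) : Prop where
  isMarkovKernel : IsMarkovKernel K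
  comp_map : ∀ y, K (S y) = K y
  bind_eq : ν.bind K = ν
  ae_ergodic : ∀ᵐ y ∂ν, Ergodic S (K y)
  exists_generic : ∃ G, MeasurableSet G ∧ ν Gᶜ = 0 ∧
    ∀ τ : Measure Y, IsProbabilityMeasure τ → Ergodic S τ → τ Gᶜ = 0 → ∀ᵐ y ∂τ, K y = τ

theorem Ergodic.ae_eq_const_measure {X : Type*} [MeasurableSpace X]
    [MeasurableSpace.CountablyGenerated X] {τ : Measure Y} [NeZero τ] (hτ : Ergodic S τ)
    {κ : Y → Measure X} (hκ : Measurable κ) (hκ1 : ∀ y, IsProbabilityMeasure (κ y))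
    (hinv : ∀ᵐ y ∂τ, κ (S y) = κ y) : ∃ τ', κ =ᵐ[τ] fun _ => τ' := by
  obtain ⟨A, hA, hpi, hgen⟩ := MeasurableSpace.exists_seq_isPiSystem X
  have hf : Measurable fun y j => κ y (A j) :=
    measurable_pi_lambda _ fun j => (Measure.measurable_coe (hA j)).comp hκ
  obtain ⟨c, hc⟩ := hτ.ae_eq_const_of_ae_eq_comp₀ hf.nullMeasurable (by
    filter_upwards [hinv] with y hy
    simp [hy])
  obtain ⟨y0, hy0⟩ := hc.exists
  refine ⟨κ y0, ?_⟩
  filter_upwards [hc] with y hy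
  refine Measure.ext_of_seq hpi hgen fun j => ?_
  exact (congrFun hy j).trans (congrFun hy0 j).symm

open MeasurableSpace in
theorem exists_isErgodicKernel [StandardBorelSpace Y] {ν : Measure Y}
    [IsProbabilityMeasure ν] (hS : MeasurePreserving S ν ν) :
    ∃ K : Kernel Y Y, IsErgodicKernel S ν K := by
  obtain ⟨A, hA, hpi, hgen⟩ := exists_seq_isPiSystem Y
  let κ := condExpKernel ν (invariants S)
  let K : Kernel Y Y := κ.comap id (measurable_id'' (invariants_le S))
  have hKκ : ∀ y, K y = κ y := fun y => Kernel.comap_apply _ _ _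
  have hKM : IsMarkovKernel K := by infer_instance
  have hKinv : ∀ y, K (S y) = K y := by
    intro y
    have h1 : (κ : Y → Measure Y) ∘ S = κ := by
      funext z
      refine Measure.ext fun s hs => ?_
      exact congrFun (comp_eq_of_measurable_invariants (κ.measurable_coe hs)) z
    rw [hKκ, hKκ]
    exact congrFun h1 y
  have hbind : ν.bind K = ν := by
    have := condExpKernel_comp_trim (μ := ν) (invariants_le S)
    refine Measure.ext fun s hs => ?_
    nth_rewrite 2 [← this]
    rw [Measure.bind_apply hs K.aemeasurable, Measure.bind_apply hs κ.aemeasurable,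
      lintegral_trim _ (κ.measurable_coe hs)]
    simp only [hKκ]
  choose φ hφ p hpm hp using fun j =>
    exists_measurable_invariants_tendsto_birkhoffAverage hS (hA j)
  have hp01 : ∀ j, ∀ᵐ y ∂ν, p j y ∈ Icc (0 : ℝ) 1 := by
    intro j
    filter_upwards [hp j] with y hy
    exact isClosed_Icc.mem_of_tendsto hy
      (Eventually.of_forall fun k => birkhoffAverage_indicator_mem_Icc _ _ _)
  have hpK : ∀ j, (fun y => (K y).real (A j)) =ᵐ[ν] p j := by
    intro j
    simp only [hKκ]
    refine condExpKernel_invariants_ae_eq (hA j) (hpm j) ?_ ?_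
    · exact Integrable.of_mem_Icc 0 1
        ((hpm j).mono (invariants_le S) le_rfl).aemeasurable (hp01 j)
    · exact fun B hB hSB => tendsto_setIntegral_of_tendsto_birkhoffAverage hS (hA j) hB hSB
        (hφ j) (hp j)
  let G : Set Y := {y | ∀ j, Tendsto (fun k => birkhoffAverage ℝ S ((A j).indicator 1) (φ j k) y)
    atTop (𝓝 ((K y).real (A j)))}
  have hGm : MeasurableSet G := by
    have : G = ⋂ j, {y | Tendsto (fun k => birkhoffAverage ℝ S ((A j).indicator 1) (φ j k) y)
        atTop (𝓝 ((K y).real (A j)))} := by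
      ext; simp [G]
    rw [this]
    refine MeasurableSet.iInter fun j => ?_
    have hKm : Measurable fun y => (K y).real (A j) := (K.measurable_coe (hA j)).ennreal_toReal
    have := measurableSet_tendsto_fun (l := atTop)
      (fun k => measurable_birkhoffAverage_indicator hS.measurable (hA j) (φ j k)) hKm
    exact this
  have hG0 : ν Gᶜ = 0 := by
    have : ∀ᵐ y ∂ν, y ∈ G := by
      have h2 : ∀ᵐ y ∂ν, ∀ j, (K y).real (A j) = p j y := ae_all_iff.2 fun j => hpK j
      filter_upwards [ae_all_iff.2 hp, h2] with y hy hy2 j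
      rw [hy2]
      exact hy j
    exact this
  have hKG : ∀ᵐ y ∂ν, ∀ᵐ y' ∂K y, y' ∈ G := by
    refine Measure.ae_ae_of_ae_comp ?_
    rw [hbind]
    exact hG0
  have hKK : ∀ᵐ y ∂ν, ∀ᵐ y' ∂K y, K y' = K y := by
    have hD : @MeasurableSet (Y × Y) ((invariants S).prod ‹MeasurableSpace Y›)
        {q | K q.2 = κ q.1} := by
      refine @measurableSet_measure_eq (Y × Y) Y ((invariants S).prod ‹MeasurableSpace Y›) _ _
        (fun q => K q.2) (fun q => κ q.1) ?_ ?_ (fun _ => inferInstance) (fun _ => inferInstance)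
      · exact K.measurable.comp (@measurable_snd _ _ (invariants S) _)
      · exact κ.measurable.comp (@measurable_fst _ _ (invariants S) _)
    have h1 : ∀ᵐ q ∂((ν.trim (invariants_le S)) ⊗ₘ κ), K q.2 = κ q.1 := by
      rw [compProd_trim_condExpKernel]
      refine (@ae_map_iff Y (Y × Y) _ ((invariants S).prod _) ν Function.diag
        (@Measurable.aemeasurable _ _ _ ((invariants S).prod _) _ _ ?_) _ hD).2
        (Eventually.of_forall fun y => hKκ y)
      exact @Measurable.prodMk Y _ Y Y (invariants S) _ id id
        (measurable_id'' (invariants_le S)) measurable_id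
    have h2 := Measure.ae_ae_of_ae_compProd h1
    simpa only [hKκ] using ae_of_ae_trim (invariants_le S) h2
  have hKS : ∀ᵐ y ∂ν, MeasurePreserving S (K y) (K y) := by
    have h1 : ∀ j, ∀ᵐ y ∂ν, (K y).real (S ⁻¹' A j) = p j y := by
      intro j
      simp only [hKκ]
      refine condExpKernel_invariants_ae_eq (hS.measurable (hA j)) (hpm j) ?_ ?_
      · exact Integrable.of_mem_Icc 0 1
          ((hpm j).mono (invariants_le S) le_rfl).aemeasurable (hp01 j)
      · intro B hB hSB
        rw [tendsto_setIntegral_of_tendsto_birkhoffAverage hS (hA j) hB hSB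
          (hφ j) (hp j)]
        nth_rewrite 2 [← hSB]
        rw [← preimage_inter, hS.measureReal_preimage ((hA j).inter hB).nullMeasurableSet]
    have h2 : ∀ᵐ y ∂ν, ∀ j, (K y).real (A j) = p j y := ae_all_iff.2 fun j => hpK j
    filter_upwards [ae_all_iff.2 h1, h2] with y hy hy2
    refine ⟨hS.measurable, ?_⟩
    have := Measure.isProbabilityMeasure_map (μ := K y) hS.measurable.aemeasurable
    refine ext_of_generate_finite _ hgen.symm hpi ?_ (by simp)
    rintro _ ⟨j, rfl⟩
    rw [Measure.map_apply hS.measurable (hA j), ← measureReal_eq_measureReal_iff, hy, hy2]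
  have hprod : ∀ τ : Measure Y, IsProbabilityMeasure τ → MeasurePreserving S τ τ →
      (∀ᵐ y ∂τ, y ∈ G) → ∀ j B, MeasurableSet B → S ⁻¹' B = B →
      ∫ y in B, (K y).real (A j) ∂τ = τ.real (A j ∩ B) := fun τ _ hτ hG j B hB hSB =>
    tendsto_setIntegral_of_tendsto_birkhoffAverage hτ (hA j) hB hSB (hφ j)
      (hG.mono fun y hy => hy j)
  refine ⟨K, hKM, hKinv, hbind, ?_, G, hGm, hG0, ?_⟩
  · filter_upwards [hKS, hKK, hKG] with y h1 h2 h3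
    refine ⟨h1, ⟨fun B hB hSB => ?_⟩⟩
    have h4 : (K y).restrict B = (K y B) • K y := by
      refine ext_of_generate_finite _ hgen.symm hpi ?_ (by simp)
      rintro _ ⟨j, rfl⟩
      have h5 := hprod _ inferInstance h1 h3 j B hB hSB
      rw [integral_congr_ae (g := fun _ => (K y).real (A j))] at h5
      · rw [Measure.restrict_apply (hA j), ← measureReal_eq_measureReal_iff
          (measure_ne_top _ _) (by
            simp only [Measure.smul_apply, smul_eq_mul]; finiteness),
          ← h5, integral_const]
        simp [measureReal_def]
      · filter_upwards [ae_restrict_of_ae h2] with y' hy'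
        rw [hy']
    have h5 : K y B = K y B * K y B := by
      nth_rewrite 1 [← inter_self B, ← Measure.restrict_apply hB]
      rw [h4]
      simp
    rw [eventuallyConst_set']
    rcases eq_or_ne (K y B) 0 with h0 | h0
    · exact Or.inl (ae_eq_empty.2 h0)
    · right
      have h6 : K y B = 1 := by
        have := (ENNReal.mul_eq_left h0 (measure_ne_top _ _)).1 h5.symm
        exact this
      rw [ae_eq_univ, prob_compl_eq_zero_iff hB]
      exact h6
  · intro τ hτ1 hτ hG
    have hc : ∃ τ', K =ᵐ[τ] fun _ => τ' :=
      hτ.ae_eq_const_measure K.measurable (fun _ => inferInstance)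
        (Eventually.of_forall hKinv)
    obtain ⟨τ', hτ'⟩ := hc
    obtain ⟨y0, hy0⟩ : ∃ y, K y = τ' := hτ'.exists
    have : IsProbabilityMeasure τ' := hy0 ▸ inferInstance
    have : τ' = τ := by
      refine ext_of_generate_finite _ hgen.symm hpi ?_ (by simp)
      rintro _ ⟨j, rfl⟩
      have h5 := hprod τ hτ1 hτ.toMeasurePreserving hG j univ MeasurableSet.univ rfl
      rw [← measureReal_eq_measureReal_iff]
      rw [setIntegral_univ, inter_univ] at h5
      rw [← h5, integral_congr_ae (g := fun _ => τ'.real (A j))]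
      · simp
      · filter_upwards [hτ'] with y hy
        rw [hy]
    rw [this] at hτ'
    exact hτ'

end ErgodicKernel

section ErgodicKernel

variable {Y : Type*} [MeasurableSpace Y] {S : Y → Y}

theorem IsErgodicKernel.ae_ae_eq {ν : Measure Y} {K : Kernel Y Y} (hK : IsErgodicKernel S ν K) :
    ∀ᵐ y ∂ν, ∀ᵐ y' ∂K y, K y' = K y := by
  have := hK.isMarkovKernel
  obtain ⟨G, hG, hG0, h⟩ := hK.exists_generic
  have h1 : ∀ᵐ y ∂ν, ∀ᵐ y' ∂K y, y' ∈ G := by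
    refine Measure.ae_ae_of_ae_comp ?_
    rw [hK.bind_eq]
    exact hG0
  filter_upwards [hK.ae_ergodic, h1] with y hy hy1
  exact h _ inferInstance hy hy1

theorem IsErgodicKernel.ae_map_eq {Y' : Type*} [MeasurableSpace Y'] {S' : Y' → Y'}
    [MeasurableSpace.CountablyGenerated Y]
    {ν : Measure Y} {K : Kernel Y Y} (hK : IsErgodicKernel S ν K) {ν' : Measure Y'}
    {K' : Kernel Y' Y'} (hK' : IsErgodicKernel S' ν' K') (hS : Measurable S) {π : Y' → Y}
    (hπ : Measurable π)
    (hsemi : Function.Semiconj π S' S) (hν : ν'.map π = ν) :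
    ∀ᵐ ω ∂ν', (K' ω).map π = K (π ω) := by
  have := hK.isMarkovKernel
  have := hK'.isMarkovKernel
  have hprob : ∀ ω, IsProbabilityMeasure ((K' ω).map π) := fun ω =>
    Measure.isProbabilityMeasure_map hπ.aemeasurable
  obtain ⟨G, hG, hG0, h⟩ := hK.exists_generic
  have h1 : ∀ᵐ ω ∂ν', ∀ᵐ ω' ∂K' ω, π ω' ∈ G := by
    refine Measure.ae_ae_of_ae_comp ?_
    rw [hK'.bind_eq]
    refine ae_of_ae_map hπ.aemeasurable (p := fun y => y ∈ G) ?_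
    rw [hν]
    exact hG0
  have h2 : ∀ᵐ ω ∂ν', ∀ᵐ ω' ∂K' ω, (K' ω').map π = K (π ω') := by
    filter_upwards [hK'.ae_ergodic, hK'.ae_ae_eq, h1] with ω h3 h4 h5
    have h6 : Ergodic S ((K' ω).map π) :=
      (hπ.measurePreserving _).ergodic_of_ergodic_semiconj h3 hS hsemi
    have h7 := h _ inferInstance h6 (mem_ae_map_iff hπ.aemeasurable hG |>.2 h5)
    filter_upwards [h4, ae_of_ae_map hπ.aemeasurable h7] with ω' h8 h9
    rw [h8, h9]
  have hD : MeasurableSet {ω | (K' ω).map π = K (π ω)} :=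
    measurableSet_measure_eq ((Measure.measurable_map _ hπ).comp K'.measurable)
      (K.measurable.comp hπ) hprob (fun _ => inferInstance)
  rw [← hK'.bind_eq]
  exact (Measure.ae_comp_iff hD).2 h2

theorem IsErgodicKernel.ae_ae_eq_of_bind {B : Type*} [MeasurableSpace B] {P : Measure B}
    {m : B → Measure Y} (hm : Measurable m) (hprob : ∀ b, IsProbabilityMeasure (m b))
    (herg : ∀ b, Ergodic S (m b)) {ν : Measure Y} (hν : ν = P.bind m) {K : Kernel Y Y}
    (hK : IsErgodicKernel S ν K) : ∀ᵐ b ∂P, ∀ᵐ y ∂m b, K y = m b := by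
  obtain ⟨G, hG, hG0, h⟩ := hK.exists_generic
  have h1 : ∀ᵐ b ∂P, ∀ᵐ y ∂m b, y ∈ G := by
    refine Measure.ae_ae_of_ae_comp (κ := ⟨m, hm⟩) ?_
    rw [hν] at hG0
    exact hG0
  filter_upwards [h1] with b hb
  exact h _ (hprob b) (herg b) hb

end ErgodicKernel

theorem ae_eq_of_integral_sq_le {W : Type*} [MeasurableSpace W] {ρ : Measure W}
    [IsProbabilityMeasure ρ] {g : W → ℝ} {c : ℝ} (h1 : Integrable g ρ)
    (h2 : Integrable (fun w => g w ^ 2) ρ) (e1 : ∫ w, g w ∂ρ = c)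
    (e2 : ∫ w, g w ^ 2 ∂ρ ≤ c ^ 2) : ∀ᵐ w ∂ρ, g w = c := by
  have h : (fun w => (g w - c) ^ 2) = fun w => g w ^ 2 - 2 * c * g w + c ^ 2 := by
    funext w; ring
  have hi4 : Integrable (fun w => g w ^ 2 - 2 * c * g w) ρ := h2.sub (h1.const_mul _)
  have hi3 : Integrable (fun w => (g w - c) ^ 2) ρ := by
    rw [h]
    exact hi4.add (integrable_const _)
  have h3 : ∫ w, (g w - c) ^ 2 ∂ρ = 0 := by
    refine le_antisymm ?_ (integral_nonneg fun w => sq_nonneg _)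
    rw [h, integral_add hi4 (integrable_const _),
      integral_sub h2 (h1.const_mul _), integral_const_mul, e1]
    simp
    nlinarith
  rw [integral_eq_zero_iff_of_nonneg (fun w => sq_nonneg _) hi3] at h3
  filter_upwards [h3] with w hw
  have := pow_eq_zero_iff (two_ne_zero) |>.1 hw
  linarith

section Doubling

variable {W U : Type*} [MeasurableSpace W] [MeasurableSpace U]

theorem map_prodMap_compProd {W' U' : Type*} [MeasurableSpace W'] [MeasurableSpace U']
    {ρ : Measure W} [SFinite ρ] {κ : Kernel W U} [IsSFiniteKernel κ] (R : W ≃ᵐ W')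
    {S : U → U'} (hS : Measurable S) :
    (ρ ⊗ₘ κ).map (Prod.map R S) = (ρ.map R) ⊗ₘ ((κ.comap R.symm R.symm.measurable).map S) := by
  ext s hs
  have hRS : Measurable (Prod.map R S) := R.measurable.prodMap hS
  rw [Measure.map_apply hRS hs, Measure.compProd_apply (hRS hs), Measure.compProd_apply hs,
    lintegral_map ?_ R.measurable]
  · refine lintegral_congr fun w => ?_
    rw [Kernel.map_apply' _ hS _ (measurable_prodMk_left hs), Kernel.comap_apply]
    simp only [MeasurableEquiv.symm_apply_apply]
    rfl
  · exact Kernel.measurable_kernel_prodMk_left hs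

variable {ρ : Measure W} [IsProbabilityMeasure ρ]
  {κ : Kernel W U} [IsMarkovKernel κ]

theorem measurePreserving_of_compProd (R : W ≃ᵐ W) {S : U → U} (hS : Measurable S)
    (h : MeasurePreserving (Prod.map R S) (ρ ⊗ₘ κ) (ρ ⊗ₘ κ)) : MeasurePreserving R ρ ρ := by
  refine ⟨R.measurable, ?_⟩
  have h1 := congrArg Measure.fst h.map_eq
  have h2 : ((ρ ⊗ₘ κ).map (Prod.map R S)).fst = (ρ ⊗ₘ κ).fst.map R := by
    rw [Measure.fst, Measure.fst, Measure.map_map measurable_fst (R.measurable.prodMap hS),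
      Measure.map_map R.measurable measurable_fst]
    rfl
  rw [h2, Measure.fst_compProd] at h1
  exact h1

theorem ae_kernel_comp_eq_map [MeasurableSpace.CountablyGenerated U] (R : W ≃ᵐ W)
    {S : U → U} (hS : Measurable S)
    (h : MeasurePreserving (Prod.map R S) (ρ ⊗ₘ κ) (ρ ⊗ₘ κ)) :
    ∀ᵐ w ∂ρ, κ (R w) = (κ w).map S := by
  have hR : MeasurePreserving R ρ ρ := measurePreserving_of_compProd R hS h
  have h1 := h.map_eq
  rw [map_prodMap_compProd R hS, hR.map_eq] at h1
  have hM : IsMarkovKernel ((κ.comap R.symm R.symm.measurable).map S) :=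
    Kernel.IsMarkovKernel.map _ hS
  have h2 := Kernel.ae_eq_of_compProd_eq h1
  filter_upwards [hR.quasiMeasurePreserving.ae h2] with w hw
  rw [← hw, Kernel.map_apply _ hS, Kernel.comap_apply]
  simp

/-- The relatively independent self-product of `U` over `W`. -/
noncomputable def doubling (ρ : Measure W) (κ : Kernel W U) : Measure (U × U) :=
  ρ.bind (κ ×ₖ κ)

instance : IsProbabilityMeasure (doubling ρ κ) := by
  unfold doubling; infer_instance

theorem doubling_apply {ρ : Measure W} {s : Set (U × U)} (hs : MeasurableSet s) :
    doubling ρ κ s = ∫⁻ w, ((κ w).prod (κ w)) s ∂ρ := by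
  rw [doubling, Measure.bind_apply hs (Kernel.aemeasurable _)]
  simp only [Kernel.prod_apply]

theorem measurePreserving_doubling [MeasurableSpace.CountablyGenerated U] (R : W ≃ᵐ W)
    {S : U → U} (hS : Measurable S)
    (h : MeasurePreserving (Prod.map R S) (ρ ⊗ₘ κ) (ρ ⊗ₘ κ)) :
    MeasurePreserving (Prod.map S S) (doubling ρ κ) (doubling ρ κ) := by
  have hR : MeasurePreserving R ρ ρ := measurePreserving_of_compProd R hS h
  have hSS : Measurable (Prod.map S S) := hS.prodMap hS
  refine ⟨hSS, Measure.ext fun s hs => ?_⟩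
  rw [Measure.map_apply hSS hs, doubling_apply (hSS hs), doubling_apply hs]
  nth_rewrite 2 [← hR.map_eq]
  rw [lintegral_map _ R.measurable]
  · refine lintegral_congr_ae ?_
    filter_upwards [ae_kernel_comp_eq_map R hS h] with w hw
    rw [hw, Measure.map_prod_map _ _ hS hS, Measure.map_apply hSS hs]
  · simp only [← Kernel.prod_apply]
    exact Kernel.measurable_coe _ hs

theorem doubling_map_prodMap {V V' : Type*} [MeasurableSpace V] [MeasurableSpace V']
    {p : U → V} {q : U → V'} (hp : Measurable p)
    (hq : Measurable q) {τ : Measure V} {τ' : Measure V'} (h1 : ∀ᵐ w ∂ρ, (κ w).map p = τ)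
    (h2 : ∀ᵐ w ∂ρ, (κ w).map q = τ') :
    (doubling ρ κ).map (Prod.map p q) = τ.prod τ' := by
  have hpq : Measurable (Prod.map p q) := hp.prodMap hq
  refine Measure.ext fun s hs => ?_
  rw [Measure.map_apply hpq hs, doubling_apply (hpq hs)]
  rw [lintegral_congr_ae (g := fun _ => (τ.prod τ') s)]
  · simp
  · filter_upwards [h1, h2] with w hw1 hw2
    rw [← hw1, ← hw2, Measure.map_prod_map _ _ hp hq, Measure.map_apply hpq hs]

theorem doubling_map_fst {ρ : Measure W} : (doubling ρ κ).map Prod.fst = ρ.bind κ := by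
  refine Measure.ext fun s hs => ?_
  rw [Measure.map_apply measurable_fst hs, doubling_apply (measurable_fst hs),
    Measure.bind_apply hs κ.aemeasurable]
  refine lintegral_congr fun w => ?_
  rw [← Measure.map_apply measurable_fst hs, Measure.map_fst_prod]
  simp

theorem doubling_map_snd {ρ : Measure W} : (doubling ρ κ).map Prod.snd = ρ.bind κ := by
  refine Measure.ext fun s hs => ?_
  rw [Measure.map_apply measurable_snd hs, doubling_apply (measurable_snd hs),
    Measure.bind_apply hs κ.aemeasurable]
  refine lintegral_congr fun w => ?_
  rw [← Measure.map_apply measurable_snd hs, Measure.map_snd_prod]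
  simp

theorem ae_map_eq_of_map_eq_prod {V : Type*} [MeasurableSpace V]
    [MeasurableSpace.CountablyGenerated V]
    {p : U → V} (hp : Measurable p) {τ : Measure V} [IsProbabilityMeasure τ]
    (h : (ρ ⊗ₘ κ).map (Prod.map id p) = ρ.prod τ) : ∀ᵐ w ∂ρ, (κ w).map p = τ := by
  have h1 := map_prodMap_compProd (ρ := ρ) (κ := κ) (MeasurableEquiv.refl W) hp
  have h2 : (κ.comap (MeasurableEquiv.refl W).symm (MeasurableEquiv.refl W).symm.measurable) =
      κ := by ext w; rfl
  have hM : IsMarkovKernel (κ.map p) := Kernel.IsMarkovKernel.map _ hp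
  rw [h2] at h1
  have h3 : ρ ⊗ₘ (κ.map p) = ρ ⊗ₘ Kernel.const W τ := by
    rw [Measure.compProd_const, ← h]
    refine Eq.trans ?_ h1.symm
    congr 1
    exact Measure.map_id.symm
  filter_upwards [Kernel.ae_eq_of_compProd_eq h3] with w hw
  rw [← Kernel.map_apply _ hp, hw, Kernel.const_apply]

theorem compProd_eq_prod_of_doubling_eq [MeasurableSpace.CountablyGenerated U]
    (h : doubling ρ κ = (ρ.bind κ).prod (ρ.bind κ)) :
    ρ ⊗ₘ κ = ρ.prod (ρ.bind κ) := by
  obtain ⟨A, hA, hpi, hgen⟩ := MeasurableSpace.exists_seq_isPiSystem U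
  have h1 : ∀ j, ∀ᵐ w ∂ρ, (κ w).real (A j) = (ρ.bind κ).real (A j) := by
    intro j
    set c := (ρ.bind κ).real (A j)
    have hm : Measurable fun w => (κ w).real (A j) := (κ.measurable_coe (hA j)).ennreal_toReal
    have hi1 : Integrable (fun w => (κ w).real (A j)) ρ :=
      Integrable.of_mem_Icc 0 1 hm.aemeasurable
        (Eventually.of_forall fun w => ⟨measureReal_nonneg, measureReal_le_one⟩)
    have hi2 : Integrable (fun w => (κ w).real (A j) ^ 2) ρ :=
      Integrable.of_mem_Icc 0 1 (hm.pow_const 2).aemeasurable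
        (Eventually.of_forall fun w => ⟨by positivity,
          pow_le_one₀ measureReal_nonneg measureReal_le_one⟩)
    have e1 : ∫ w, (κ w).real (A j) ∂ρ = c := by
      simp only [measureReal_def, c]
      rw [integral_toReal (κ.measurable_coe (hA j)).aemeasurable
        (Eventually.of_forall fun w => measure_lt_top _ _), Measure.bind_apply (hA j)
        κ.aemeasurable]
    have e2 : ∫ w, (κ w).real (A j) ^ 2 ∂ρ = c ^ 2 := by
      have h2 := congrArg (fun m => (m (A j ×ˢ A j)).toReal) h
      simp only [Measure.prod_prod, ENNReal.toReal_mul] at h2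
      rw [doubling_apply ((hA j).prod (hA j))] at h2
      simp only [Measure.prod_prod] at h2
      rw [← integral_toReal (f := fun w => κ w (A j) * κ w (A j))
        ((κ.measurable_coe (hA j)).mul (κ.measurable_coe (hA j))).aemeasurable
        (Eventually.of_forall fun w => ENNReal.mul_lt_top (measure_lt_top _ _)
          (measure_lt_top _ _))] at h2
      simp only [← sq, ENNReal.toReal_pow] at h2
      exact h2
    exact ae_eq_of_integral_sq_le hi1 hi2 e1 e2.le
  have h2 : κ =ᵐ[ρ] Kernel.const W (ρ.bind κ) := by
    filter_upwards [ae_all_iff.2 h1] with w hw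
    rw [Kernel.const_apply]
    refine Measure.ext_of_seq hpi hgen fun j => ?_
    rw [← measureReal_eq_measureReal_iff]
    exact hw j
  rw [Measure.compProd_congr h2, Measure.compProd_const]

end Doubling

section PairwiseIndependence

variable {X : Type*} [MeasurableSpace X]

/-- Pairwise independent self-joinings of `(X, ν, T)` of finite order are independent. -/
def HasPID (T : X → X) (ν : Measure X) : Prop :=
  ∀ (N : ℕ) (lam : Measure (Fin N → X)), IsProbabilityMeasure lam →
    MeasurePreserving (fun x i => T (x i)) lam lam →
    (∀ i, lam.map (fun x => x i) = ν) →
    (∀ i j, i ≠ j → lam.map (fun x => (x i, x j)) = ν.prod ν) →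
    lam = Measure.pi fun _ => ν

variable {T : X ≃ᵐ X}

theorem measurable_piMap {ι : Type*} {T : X → X} (hT : Measurable T) :
    Measurable fun (x : ι → X) i => T (x i) :=
  measurable_pi_lambda _ fun i => hT.comp (measurable_pi_apply i)

theorem HasPID.eq_pi {ν : Measure X} [IsProbabilityMeasure ν] (hν : HasPID T ν) {ι : Type*}
    [Fintype ι]
    {lam : Measure (ι → X)} [IsProbabilityMeasure lam]
    (hinv : MeasurePreserving (fun x i => T (x i)) lam lam)
    (h1 : ∀ i, lam.map (fun x => x i) = ν)
    (h2 : ∀ i j, i ≠ j → lam.map (fun x => (x i, x j)) = ν.prod ν) :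
    lam = Measure.pi fun _ => ν := by
  let e : (ι → X) ≃ᵐ (Fin (Fintype.card ι) → X) :=
    MeasurableEquiv.piCongrLeft (fun _ => X) (Fintype.equivFin ι)
  have he : ∀ x i, e x i = x ((Fintype.equivFin ι).symm i) := fun x i => by
    obtain ⟨j, rfl⟩ := (Fintype.equivFin ι).surjective i
    simp [e, MeasurableEquiv.piCongrLeft_apply_apply]
  have hpi : MeasurePreserving e (Measure.pi fun _ => ν) (Measure.pi fun _ => ν) :=
    measurePreserving_piCongrLeft (fun _ => ν) (Fintype.equivFin ι)
  have key : lam.map e = Measure.pi fun _ => ν := by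
    refine hν _ _ (Measure.isProbabilityMeasure_map e.measurable.aemeasurable) ?_ ?_ ?_
    · refine MeasurePreserving.of_semiconj (e.measurable.measurePreserving lam) hinv ?_
        (measurable_piMap T.measurable)
      intro x
      funext i
      simp [he]
    · intro i
      rw [Measure.map_map (measurable_pi_apply i) e.measurable]
      simp only [Function.comp_def, he]
      exact h1 _
    · intro i j hij
      rw [Measure.map_map (by fun_prop) e.measurable]
      simp only [Function.comp_def, he]
      exact h2 _ _ (by simpa using hij)
  rw [← hpi.map_eq] at key
  exact e.map_measurableEquiv_injective key

theorem eq_prod_pi_of_doubling {W : Type*} [MeasurableSpace W] [StandardBorelSpace X] (R : W ≃ᵐ W)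
    {ι : Type*} [Fintype ι] {ν : ι → Measure X} [∀ i, IsProbabilityMeasure (ν i)]
    {ξ : Measure (W × (ι → X))} [IsProbabilityMeasure ξ]
    (hinv : MeasurePreserving (Prod.map R fun x i => T (x i)) ξ ξ)
    (h1 : ∀ i, ξ.map (fun q => (q.1, q.2 i)) = ξ.fst.prod (ν i))
    (h2 : ∀ i j, i ≠ j → ξ.map (fun q => (q.2 i, q.2 j)) = (ν i).prod (ν j))
    (H : ∀ lam : Measure (ι ⊕ ι → X), IsProbabilityMeasure lam →
      MeasurePreserving (fun x i => T (x i)) lam lam →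
      (∀ i, lam.map (fun x => x i) = Sum.elim ν ν i) →
      (∀ i j, i ≠ j → lam.map (fun x => (x i, x j)) = (Sum.elim ν ν i).prod (Sum.elim ν ν j)) →
      lam = Measure.pi (Sum.elim ν ν)) :
    ξ = ξ.fst.prod (Measure.pi ν) := by
  obtain ⟨q0⟩ := ξ.nonempty_of_neZero
  have : Nonempty (ι → X) := ⟨q0.2⟩
  have hTι : Measurable fun (x : ι → X) i => T (x i) := measurable_piMap T.measurable
  have hel : ∀ i, IsProbabilityMeasure (Sum.elim ν ν i) := by
    rintro (i | i) <;> simp only [Sum.elim_inl, Sum.elim_inr] <;> infer_instance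
  set ρ := ξ.fst with hρ
  set κ := ξ.condKernel with hκ
  have hdis : ρ ⊗ₘ κ = ξ := ξ.disintegrate ξ.condKernel
  have hbind : ρ.bind κ = ξ.snd := by rw [← Measure.snd_compProd, hdis]
  have hcond : ∀ i, ∀ᵐ w ∂ρ, (κ w).map (fun x => x i) = ν i := fun i => by
    refine ae_map_eq_of_map_eq_prod (measurable_pi_apply i) ?_
    rw [hdis]
    exact h1 i
  have hdinv : MeasurePreserving (Prod.map (fun (x : ι → X) i => T (x i)) fun x i => T (x i))
      (doubling ρ κ) (doubling ρ κ) :=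
    measurePreserving_doubling R hTι (by rwa [hdis])
  let e := MeasurableEquiv.sumPiEquivProdPi (fun _ : ι ⊕ ι => X)
  have hl : ∀ q i, e.symm q (Sum.inl i) = q.1 i := fun _ _ => rfl
  have hr : ∀ q i, e.symm q (Sum.inr i) = q.2 i := fun _ _ => rfl
  have hdfst : ∀ i j, i ≠ j → (doubling ρ κ).map (fun q => (q.1 i, q.1 j)) =
      (ν i).prod (ν j) := fun i j hij => by
    have : (fun q : (ι → X) × (ι → X) => (q.1 i, q.1 j)) =
      (fun x => (x i, x j)) ∘ Prod.fst := rfl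
    rw [this, ← Measure.map_map (by fun_prop) measurable_fst, doubling_map_fst, hbind,
      Measure.snd, Measure.map_map (by fun_prop) measurable_snd]
    exact h2 i j hij
  have hdsnd : ∀ i j, i ≠ j → (doubling ρ κ).map (fun q => (q.2 i, q.2 j)) =
      (ν i).prod (ν j) := fun i j hij => by
    have : (fun q : (ι → X) × (ι → X) => (q.2 i, q.2 j)) =
      (fun x => (x i, x j)) ∘ Prod.snd := rfl
    rw [this, ← Measure.map_map (by fun_prop) measurable_snd, doubling_map_snd, hbind,
      Measure.snd, Measure.map_map (by fun_prop) measurable_snd]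
    exact h2 i j hij
  have hdcross : ∀ i j, (doubling ρ κ).map (fun q => (q.1 i, q.2 j)) = (ν i).prod (ν j) :=
    fun i j => doubling_map_prodMap (measurable_pi_apply i) (measurable_pi_apply j)
      (hcond i) (hcond j)
  have hdcross' : ∀ i j, (doubling ρ κ).map (fun q => (q.2 i, q.1 j)) = (ν i).prod (ν j) :=
    fun i j => by
      have : (fun q : (ι → X) × (ι → X) => (q.2 i, q.1 j)) =
        Prod.swap ∘ (fun q => (q.1 j, q.2 i)) := rfl
      rw [this, ← Measure.map_map measurable_swap (by fun_prop), hdcross, Measure.prod_swap]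
  have key : (doubling ρ κ).map e.symm = Measure.pi (Sum.elim ν ν) := by
    refine H _ (Measure.isProbabilityMeasure_map e.symm.measurable.aemeasurable) ?_ ?_ ?_
    · refine MeasurePreserving.of_semiconj (e.symm.measurable.measurePreserving _) hdinv ?_
        (measurable_piMap T.measurable)
      intro q
      funext i
      rcases i with i | i <;> rfl
    · intro i
      rw [Measure.map_map (measurable_pi_apply i) e.symm.measurable]
      rcases i with i | i
      · have h3 := congrArg Measure.fst (hdcross i i)
        rw [Measure.fst_map_prodMk (by fun_prop), Measure.fst_prod] at h3
        exact h3
      · have h3 := congrArg Measure.snd (hdcross i i)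
        rw [Measure.snd_map_prodMk (by fun_prop), Measure.snd_prod] at h3
        exact h3
    · intro i j hij
      rw [Measure.map_map (by fun_prop) e.symm.measurable]
      rcases i with i | i <;> rcases j with j | j
      · exact hdfst i j (by simpa using hij)
      · exact hdcross i j
      · exact hdcross' i j
      · exact hdsnd i j (by simpa using hij)
  have hpi := measurePreserving_sumPiEquivProdPi_symm (X := fun _ : ι ⊕ ι => X) (Sum.elim ν ν)
  rw [← hpi.map_eq] at key
  have hd : doubling ρ κ = (Measure.pi ν).prod (Measure.pi ν) :=
    e.symm.map_measurableEquiv_injective key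
  have hσ : ρ.bind κ = Measure.pi ν := by
    rw [← doubling_map_fst, hd, Measure.map_fst_prod]
    simp
  rw [← hσ] at hd ⊢
  rw [← compProd_eq_prod_of_doubling_eq hd, hdis]

theorem eq_pi_of_pairwise [StandardBorelSpace X] {ι : Type*} [Fintype ι] {ν : ι → Measure X}
    (hprob : ∀ i, IsProbabilityMeasure (ν i)) (hpid : ∀ i, HasPID T (ν i))
    {lam : Measure (ι → X)} [IsProbabilityMeasure lam]
    (hinv : MeasurePreserving (fun x i => T (x i)) lam lam)
    (h1 : ∀ i, lam.map (fun x => x i) = ν i)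
    (h2 : ∀ i j, i ≠ j → lam.map (fun x => (x i, x j)) = (ν i).prod (ν j)) :
    lam = Measure.pi ν := by
  classical
  induction hn : (range ν).ncard using Nat.strong_induction_on generalizing ι with
  | _ n ih =>
  rcases isEmpty_or_nonempty ι with hι | ⟨⟨i0⟩⟩
  · refine Measure.ext fun s _ => ?_
    rcases Subsingleton.eq_empty_or_singleton (s := s) (fun _ _ _ _ => Subsingleton.elim _ _)
      with rfl | ⟨x, rfl⟩
    · simp
    · have : ({x} : Set (ι → X)) = univ := by
        ext y; simp [Subsingleton.elim y x]
      rw [this]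
      simp
  let p : ι → Prop := fun i => ν i = ν i0
  let e := MeasurableEquiv.piEquivPiSubtypeProd (fun _ : ι => X) p
  have he1 : ∀ x (i : {i // p i}), (e x).1 i = x i := fun _ _ => rfl
  have he2 : ∀ x (i : {i // ¬ p i}), (e x).2 i = x i := fun _ _ => rfl
  set ξ := lam.map e with hξ
  have hξp : IsProbabilityMeasure ξ := Measure.isProbabilityMeasure_map e.measurable.aemeasurable
  have hsame : ∀ i : {i // p i}, ν i = ν i0 := fun i => i.2
  have hsame' : (fun i : {i // p i} => ν i) = fun _ => ν i0 := funext hsame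
  have hξinv : MeasurePreserving (Prod.map (fun (x : {i // p i} → X) i => T (x i))
      fun (x : {i // ¬ p i} → X) i => T (x i)) ξ ξ :=
    MeasurePreserving.of_semiconj (e.measurable.measurePreserving lam) hinv (fun _ => rfl)
      ((measurable_piMap T.measurable).prodMap (measurable_piMap T.measurable))
  have hξ1 : ∀ i, ξ.map (fun q => q.1 i) = ν i := fun i => by
    rw [hξ, Measure.map_map (by fun_prop) e.measurable]
    exact h1 i
  have hξ2 : ∀ i, ξ.map (fun q => q.2 i) = ν i := fun i => by
    rw [hξ, Measure.map_map (by fun_prop) e.measurable]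
    exact h1 i
  have hξ11 : ∀ i j, i ≠ j → ξ.map (fun q => (q.1 i, q.1 j)) = (ν i).prod (ν j) :=
    fun i j hij => by
      rw [hξ, Measure.map_map (by fun_prop) e.measurable]
      exact h2 i j (fun h => hij (Subtype.ext h))
  have hξ22 : ∀ i j, i ≠ j → ξ.map (fun q => (q.2 i, q.2 j)) = (ν i).prod (ν j) :=
    fun i j hij => by
      rw [hξ, Measure.map_map (by fun_prop) e.measurable]
      exact h2 i j (fun h => hij (Subtype.ext h))
  have hξ21 : ∀ i j, ξ.map (fun q => (q.2 i, q.1 j)) = (ν i).prod (ν j) :=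
    fun i j => by
      rw [hξ, Measure.map_map (by fun_prop) e.measurable]
      exact h2 i j (fun h => i.2 (h ▸ j.2))
  -- the block with the label of `i0`
  have hfst : ξ.fst = Measure.pi fun i : {i // p i} => ν i := by
    rw [hsame']
    have hfstinv : MeasurePreserving (fun (x : {i // p i} → X) i => T (x i)) ξ.fst ξ.fst :=
      MeasurePreserving.of_semiconj (measurable_fst.measurePreserving ξ) hξinv (fun _ => rfl)
        (measurable_piMap T.measurable)
    refine (hpid i0).eq_pi hfstinv ?_ ?_
    · intro i
      rw [Measure.fst, Measure.map_map (by fun_prop) measurable_fst, ← hsame i]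
      exact hξ1 i
    · intro i j hij
      rw [Measure.fst, Measure.map_map (by fun_prop) measurable_fst]
      refine (hξ11 i j hij).trans ?_
      rw [hsame i, hsame j]
  -- the block is independent of each remaining coordinate
  have hone : ∀ a : {i // ¬ p i}, ξ.map (fun q => (q.1, q.2 a)) = ξ.fst.prod (ν a) := by
    intro a
    have hζ : Measurable fun q : ({i // p i} → X) × ({i // ¬ p i} → X) => (q.2 a, q.1) := by
      fun_prop
    set ζ := ξ.map (fun q => (q.2 a, q.1)) with hζdef
    have hζp : IsProbabilityMeasure ζ := Measure.isProbabilityMeasure_map hζ.aemeasurable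
    have hζfst : ζ.fst = ν a := by
      rw [hζdef, Measure.fst_map_prodMk (by fun_prop)]
      exact hξ2 a
    have hel : ∀ i, Sum.elim (fun i : {i // p i} => ν i) (fun i : {i // p i} => ν i) i = ν i0 := by
      rintro (i | i) <;> exact hsame i
    have key : ζ = ζ.fst.prod (Measure.pi fun i : {i // p i} => ν i) := by
      refine eq_prod_pi_of_doubling (T := T) T ?_ ?_ ?_ ?_
      · exact MeasurePreserving.of_semiconj (hζ.measurePreserving ξ) hξinv (fun _ => rfl)
          (T.measurable.prodMap (measurable_piMap T.measurable))
      · intro i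
        rw [hζfst, hζdef, Measure.map_map (by fun_prop) hζ]
        exact hξ21 a i
      · intro i j hij
        rw [hζdef, Measure.map_map (by fun_prop) hζ]
        exact hξ11 i j hij
      · intro lam' hlam' hlinv hl1 hl2
        have hel' := funext hel
        rw [hel']
        refine (hpid i0).eq_pi hlinv (fun i => (hl1 i).trans (hel i)) fun i j hij => ?_
        rw [hl2 i j hij, hel i, hel j]
    have hsw : (fun q : ({i // p i} → X) × ({i // ¬ p i} → X) => (q.1, q.2 a)) =
      Prod.swap ∘ fun q => (q.2 a, q.1) := rfl
    rw [hsw, ← Measure.map_map measurable_swap hζ, ← hζdef, key, Measure.prod_swap, hfst, hζfst]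
  have hprod : ξ = ξ.fst.prod (Measure.pi fun i : {i // ¬ p i} => ν i) := by
    refine eq_prod_pi_of_doubling (T := T) (MeasurableEquiv.piCongrRight fun _ => T) hξinv hone
      hξ22 ?_
    intro lam' hlam' hlinv hl1 hl2
    have hsub : range (Sum.elim (fun i : {i // ¬ p i} => ν i) fun i : {i // ¬ p i} => ν i) ⊆
        range ν \ {ν i0} := by
      rintro _ ⟨i | i, rfl⟩ <;> exact ⟨⟨_, rfl⟩, i.2⟩
    have hlt : range (Sum.elim (fun i : {i // ¬ p i} => ν i) fun i : {i // ¬ p i} => ν i) ⊂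
        range ν := by
      refine ⟨hsub.trans sdiff_subset, fun h => ?_⟩
      exact (hsub (h ⟨i0, rfl⟩)).2 rfl
    refine ih _ (hn ▸ ncard_lt_ncard hlt (finite_range ν)) ?_ ?_ hlinv hl1 hl2 rfl
    · rintro (i | i) <;> exact hprob i
    · rintro (i | i) <;> exact hpid i
  have hpi := measurePreserving_piEquivPiSubtypeProd ν p
  refine e.map_measurableEquiv_injective ?_
  rw [hpi.map_eq, ← hξ, hprod, hfst]

end PairwiseIndependence

section OrbitRelation

variable {X : Type*} [MeasurableSpace X]

/-- The orbit equivalence relation of `T`. -/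
def orbitGraph (T : X → X) : Set (X × X) :=
  {q | ∃ k : ℕ, q.2 = T^[k] q.1 ∨ q.1 = T^[k] q.2}

/-- The points of the forward orbit of `q.1`, the starting point excluded. -/
def forwardGraph (T : X → X) : Set (X × X) :=
  {q | ∃ k : ℕ, q.2 = T^[k + 1] q.1}

variable {T : X ≃ᵐ X}

theorem measurableSet_orbitGraph [StandardBorelSpace X] : MeasurableSet (orbitGraph T) := by
  have : orbitGraph T = ⋃ k : ℕ, {q : X × X | q.2 = T^[k] q.1} ∪ {q | q.1 = T^[k] q.2} := by
    ext q; simp [orbitGraph]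
  rw [this]
  refine MeasurableSet.iUnion fun k => ?_
  have hk := T.measurable.iterate k
  exact (measurableSet_eq_fun measurable_snd (hk.comp measurable_fst)).union
    (measurableSet_eq_fun measurable_fst (hk.comp measurable_snd))

theorem measurableSet_forwardGraph [StandardBorelSpace X] : MeasurableSet (forwardGraph T) := by
  have : forwardGraph T = ⋃ k : ℕ, {q : X × X | q.2 = T^[k + 1] q.1} := by
    ext q; simp [forwardGraph]
  rw [this]
  refine MeasurableSet.iUnion fun k => ?_
  exact measurableSet_eq_fun measurable_snd ((T.measurable.iterate (k + 1)).comp measurable_fst)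

theorem countable_orbitGraph (x : X) : {x' | (x, x') ∈ orbitGraph T}.Countable := by
  have : {x' | (x, x') ∈ orbitGraph T} = ⋃ k : ℕ, ({T^[k] x} : Set X) ∪ {x' | x = T^[k] x'} := by
    ext q; simp [orbitGraph]
  rw [this]
  refine countable_iUnion fun k => (countable_singleton _).union ?_
  refine Set.Subsingleton.countable fun a (ha : x = T^[k] a) b (hb : x = T^[k] b) => ?_
  exact T.injective.iterate k (ha.symm.trans hb)

theorem prodMap_mem_orbitGraph {q : X × X} :
    Prod.map T T q ∈ orbitGraph T ↔ q ∈ orbitGraph T := by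
  simp only [orbitGraph, mem_ofPred_eq, Prod.map_fst, Prod.map_snd]
  simp only [← Function.iterate_succ_apply, Function.iterate_succ_apply', T.injective.eq_iff]

theorem prodMap_mem_forwardGraph {q : X × X} :
    Prod.map T T q ∈ forwardGraph T ↔ q ∈ forwardGraph T := by
  simp only [forwardGraph, mem_ofPred_eq, Prod.map_fst, Prod.map_snd]
  simp only [← Function.iterate_succ_apply, Function.iterate_succ_apply', T.injective.eq_iff]

theorem prodMap_mem_diagonal {q : X × X} :
    Prod.map T T q ∈ diagonal X ↔ q ∈ diagonal X := by
  simp [mem_diagonal_iff, T.injective.eq_iff]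

theorem prod_orbitGraph_eq_zero [StandardBorelSpace X] {ν ν' : Measure X} [SFinite ν']
    (h : ∀ x, ν' {x} = 0) : ν.prod ν' (orbitGraph T) = 0 := by
  rw [Measure.measure_prod_null measurableSet_orbitGraph]
  refine Eventually.of_forall fun x => ?_
  exact (measure_null_iff_singleton (countable_orbitGraph x)).2 fun x' _ => h x'

theorem countable_measure_singleton_ne_zero [StandardBorelSpace X] (ν : Measure X)
    [IsFiniteMeasure ν] : {x | ν {x} ≠ 0}.Countable := by
  obtain ⟨f, hf⟩ := exists_measurableEmbedding_real X
  have h := Measure.countable_meas_level_set_pos (μ := ν) hf.measurable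
  refine (h.preimage hf.injective).mono fun x hx => ?_
  have : {a | f a = f x} = {x} := by
    ext a; simp [hf.injective.eq_iff]
  simp only [mem_preimage, mem_ofPred_eq, this]
  exact pos_iff_ne_zero.2 hx

theorem Ergodic.ae_iterate_ne [StandardBorelSpace X] {ν : Measure X} (hν : Ergodic T ν)
    (h0 : ∀ x, ν {x} = 0) : ∀ᵐ x ∂ν, ∀ k : ℕ, T^[k + 1] x ≠ x := by
  rw [ae_all_iff]
  intro k
  have hA : MeasurableSet {x | T^[k + 1] x = x} :=
    measurableSet_eq_fun (T.measurable.iterate _) measurable_id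
  have hinv : T ⁻¹' {x | T^[k + 1] x = x} = {x | T^[k + 1] x = x} := by
    ext x
    simp only [mem_preimage, mem_ofPred_eq]
    rw [← Function.iterate_succ_apply, Function.iterate_succ_apply', T.injective.eq_iff]
  rcases hν.toPreErgodic.ae_empty_or_univ hA hinv with h | h
  · have := ae_eq_empty.1 h
    exact measure_eq_zero_iff_ae_notMem.1 this
  have hper : ∀ᵐ x ∂ν, T^[k + 1] x = x := by
    filter_upwards [h] with x hx
    have : (x ∈ {x | T^[k + 1] x = x}) = (x ∈ univ) := hx
    simpa using this
  obtain ⟨f, hf⟩ := exists_measurableEmbedding_real X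
  let g : X → ℝ := fun x => ⨅ i : ℕ, f (T^[i] x)
  have hg : Measurable g := Measurable.iInf fun i => hf.measurable.comp (T.measurable.iterate i)
  have hgT : g ∘ T =ᵐ[ν] g := by
    filter_upwards [hper] with x hx
    have hr : (range fun i : ℕ => f (T^[i] (T x))) = range fun i : ℕ => f (T^[i] x) := by
      ext r
      simp only [mem_range]
      constructor
      · rintro ⟨i, rfl⟩
        exact ⟨i + 1, rfl⟩
      · rintro ⟨i, rfl⟩
        refine ⟨i + k, ?_⟩
        rw [← Function.iterate_succ_apply, Nat.succ_eq_add_one, add_assoc,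
          Function.iterate_add_apply, hx]
    exact congrArg sInf hr
  obtain ⟨c, hc⟩ := hν.ae_eq_const_of_ae_eq_comp_ae hg.aestronglyMeasurable hgT
  have hmem : ∀ᵐ x ∂ν, ∃ i : ℕ, f (T^[i] x) = c := by
    filter_upwards [hper, hc] with x hx hxc
    have hfin : (range fun i : ℕ => f (T^[i] x)).Finite := by
      refine (Set.finite_range fun i : Fin (k + 1) => f (T^[i] x)).subset ?_
      rintro _ ⟨i, rfl⟩
      refine ⟨⟨i % (k + 1), Nat.mod_lt _ k.succ_pos⟩, ?_⟩
      have : Function.IsPeriodicPt T (k + 1) x := hx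
      simp only [this.iterate_mod_apply]
    obtain ⟨i, hi⟩ := (range_nonempty fun i : ℕ => f (T^[i] x)).csInf_mem hfin
    exact ⟨i, hi.trans hxc⟩
  have hcount : {x | ∃ i : ℕ, f (T^[i] x) = c}.Countable := by
    have : {x | ∃ i : ℕ, f (T^[i] x) = c} = ⋃ i : ℕ, {x | f (T^[i] x) = c} := by
      ext x; simp
    rw [this]
    refine countable_iUnion fun i => Set.Subsingleton.countable ?_
    intro a (ha : f _ = c) b (hb : f _ = c)
    exact T.injective.iterate i (hf.injective (ha.trans hb.symm))
  have hnull : ν {x | ∃ i : ℕ, f (T^[i] x) = c} = 0 :=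
    (measure_null_iff_singleton hcount).2 fun x _ => h0 x
  filter_upwards [hmem, measure_eq_zero_iff_ae_notMem.1 hnull] with x h1 h2
  exact absurd h1 h2

end OrbitRelation

section Dichotomy

variable {X : Type*} [MeasurableSpace X] {T : X ≃ᵐ X}

/-- Invariant measures whose self-joinings are well understood: pairwise independent
self-joinings are independent, and the only self-joining giving no mass to the orbit equivalence
relation is the product. -/
structure IsGood (T : X → X) (ν : Measure X) : Prop where
  isProbabilityMeasure : IsProbabilityMeasure ν
  ergodic : Ergodic T ν
  atoms : (∀ x, ν {x} = 0) ∨ ∃ x, ν = Measure.dirac x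
  hasPID : HasPID T ν
  eq_prod : ∀ lam : Measure (X × X), IsProbabilityMeasure lam →
    MeasurePreserving (Prod.map T T) lam lam → lam.map Prod.fst = ν → lam.map Prod.snd = ν →
    lam (orbitGraph T) = 0 → lam = ν.prod ν

theorem IsGood.ae_mem_orbitGraph_or_absolutelyContinuous [StandardBorelSpace X] {ν : Measure X}
    (hν : IsGood T ν) (h0 : ∀ x, ν {x} = 0) {lam : Measure (X × X)} [IsProbabilityMeasure lam]
    (hinv : MeasurePreserving (Prod.map T T) lam lam) (h1 : lam.map Prod.fst = ν)
    (h2 : lam.map Prod.snd = ν) :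
    (∀ᵐ q ∂lam, q ∈ orbitGraph T) ∨ ν.prod ν ≪ lam := by
  have := hν.isProbabilityMeasure
  have hG : MeasurableSet (orbitGraph T) := measurableSet_orbitGraph
  have hGc := hG.compl
  set a := lam (orbitGraph T) with ha
  have hsum : lam (orbitGraph T)ᶜ + a = 1 := by
    rw [add_comm, measure_add_measure_compl hG, measure_univ]
  rcases eq_or_ne (lam (orbitGraph T)ᶜ) 0 with h | h
  · exact Or.inl h
  right
  have hpre : Prod.map T T ⁻¹' (orbitGraph T)ᶜ = (orbitGraph T)ᶜ := by
    ext q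
    simp only [mem_preimage, mem_compl_iff, prodMap_mem_orbitGraph]
  have hTT : Measurable (Prod.map T T) := T.measurable.prodMap T.measurable
  have hrinv : MeasurePreserving (Prod.map T T) (lam.restrict (orbitGraph T)ᶜ)
      (lam.restrict (orbitGraph T)ᶜ) := by
    have := hinv.restrict_preimage hGc
    rwa [hpre] at this
  have hmarg : ∀ p : X × X → X, Measurable p → Function.Semiconj p (Prod.map T T) T →
      lam.map p = ν →
      (lam.restrict (orbitGraph T)ᶜ).map p = lam (orbitGraph T)ᶜ • ν := fun p hp hps hpν => by
    have hac : (lam.restrict (orbitGraph T)ᶜ).map p ≪ ν := by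
      rw [← hpν]
      exact Measure.restrict_le_self.absolutelyContinuous.map hp
    have hi : MeasurePreserving T ((lam.restrict (orbitGraph T)ᶜ).map p)
        ((lam.restrict (orbitGraph T)ᶜ).map p) :=
      MeasurePreserving.of_semiconj (hp.measurePreserving _) hrinv hps T.measurable
    obtain ⟨c, hc⟩ := hν.ergodic.eq_smul_of_absolutelyContinuous hi hac
    have hc1 := congrArg (fun τ : Measure X => τ univ) hc
    simp only [Measure.map_apply hp MeasurableSet.univ, preimage_univ,
      Measure.restrict_apply MeasurableSet.univ, univ_inter, Measure.smul_apply, measure_univ,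
      smul_eq_mul, mul_one] at hc1
    rw [hc, hc1]
  have hnull : ν.prod ν (orbitGraph T) = 0 := prod_orbitGraph_eq_zero h0
  have hνinv : MeasurePreserving (Prod.map T T) (ν.prod ν) (ν.prod ν) :=
    hν.ergodic.toMeasurePreserving.prod hν.ergodic.toMeasurePreserving
  set ζ := lam.restrict (orbitGraph T)ᶜ + a • ν.prod ν with hζ
  have hζprob : IsProbabilityMeasure ζ := ⟨by simpa [hζ] using hsum⟩
  have hζmarg : ∀ p : X × X → X, Measurable p → Function.Semiconj p (Prod.map T T) T →
      lam.map p = ν → (ν.prod ν).map p = ν → ζ.map p = ν := fun p hp hps hpν hpν' => by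
    rw [hζ, Measure.map_add _ _ hp, Measure.map_smul, hmarg p hp hps hpν, hpν', ← add_smul, hsum,
      one_smul]
  have hζinv : MeasurePreserving (Prod.map T T) ζ ζ := by
    refine ⟨hTT, ?_⟩
    rw [hζ, Measure.map_add _ _ hTT, Measure.map_smul, hrinv.map_eq, hνinv.map_eq]
  have hζeq : ζ = ν.prod ν := by
    refine hν.eq_prod ζ hζprob hζinv
      (hζmarg _ measurable_fst (fun _ => rfl) h1 (by simp [Measure.map_fst_prod]))
      (hζmarg _ measurable_snd (fun _ => rfl) h2 (by simp [Measure.map_snd_prod])) ?_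
    simp [hζ, Measure.restrict_apply hG, hnull]
  intro s hs
  have hs1 : lam.restrict (orbitGraph T)ᶜ s = 0 :=
    Measure.restrict_le_self.absolutelyContinuous hs
  have hs2 : a * ν.prod ν s = ν.prod ν s := by
    conv_rhs => rw [← hζeq, hζ]
    simp [hs1]
  by_contra hne
  have ha1 : a = 1 := by
    have := (ENNReal.mul_eq_right hne (measure_ne_top _ _)).1 hs2
    exact this
  rw [ha1] at hsum
  refine h ?_
  have h3 : lam (orbitGraph T)ᶜ + 1 = 0 + 1 := by rw [hsum, zero_add]
  exact (ENNReal.add_left_inj ENNReal.one_ne_top).1 h3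

variable {W : Type*} [MeasurableSpace W] {ρ : Measure W} [IsProbabilityMeasure ρ]
  {κ : Kernel W X} [IsMarkovKernel κ]

theorem exists_ae_kernel_section_eq [StandardBorelSpace X] {R : W ≃ᵐ W}
    (herg : Ergodic (Prod.map R T) (ρ ⊗ₘ κ)) {E : Set (X × X)} (hE : MeasurableSet E)
    (hET : ∀ q, Prod.map T T q ∈ E ↔ q ∈ E) :
    ∃ u, ∀ᵐ q ∂(ρ ⊗ₘ κ), κ q.1 {x | (q.2, x) ∈ E} = u := by
  have hmeas : Measurable fun q : W × X => κ q.1 {x | (q.2, x) ∈ E} := by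
    let κ' : Kernel (W × X) X := κ.comap Prod.fst measurable_fst
    have hE' : MeasurableSet {p : (W × X) × X | (p.1.2, p.2) ∈ E} :=
      (measurable_fst.snd.prodMk measurable_snd) hE
    exact Kernel.measurable_kernel_prodMk_left (κ := κ') hE'
  have hinv : (fun q : W × X => κ q.1 {x | (q.2, x) ∈ E}) ∘ Prod.map R T =ᵐ[ρ ⊗ₘ κ]
      fun q : W × X => κ q.1 {x | (q.2, x) ∈ E} := by
    have h1 := ae_kernel_comp_eq_map R T.measurable herg.toMeasurePreserving
    have h2 : ∀ᵐ q ∂(ρ ⊗ₘ κ), κ (R q.1) = (κ q.1).map T := by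
      have := Measure.fst_compProd ρ κ
      rw [← this] at h1
      exact ae_of_ae_map measurable_fst.aemeasurable h1
    filter_upwards [h2] with q hq
    simp only [Function.comp_apply, Prod.map_fst, Prod.map_snd, hq]
    rw [T.map_apply]
    congr 1
    ext x
    exact hET (q.2, x)
  exact herg.ae_eq_const_of_ae_eq_comp_ae hmeas.aestronglyMeasurable hinv

theorem exists_countable_of_ae_measure_singleton_ne_zero [StandardBorelSpace X]
    (h : ∀ᵐ q ∂(ρ ⊗ₘ κ), κ q.1 {q.2} ≠ 0) :
    ∀ᵐ w ∂ρ, ∃ C : Set X, C.Countable ∧ κ w Cᶜ = 0 := by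
  filter_upwards [Measure.ae_ae_of_ae_compProd h] with w hw
  exact ⟨_, countable_measure_singleton_ne_zero (κ w), hw⟩

end Dichotomy

section Dichotomy

variable {X : Type*} [MeasurableSpace X] [StandardBorelSpace X] {T : X ≃ᵐ X}
  {W : Type*} [MeasurableSpace W] {ρ : Measure W} [IsProbabilityMeasure ρ]
  {κ : Kernel W X} [IsMarkovKernel κ]

theorem IsGood.compProd_eq_prod_of_ae_measure_singleton_eq_zero {ν : Measure X} (hν : IsGood T ν)
    {R : W ≃ᵐ W} (hinv : MeasurePreserving (Prod.map R T) (ρ ⊗ₘ κ) (ρ ⊗ₘ κ))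
    (hbind : ρ.bind κ = ν) (h : ∀ᵐ q ∂(ρ ⊗ₘ κ), κ q.1 {q.2} = 0) :
    ρ ⊗ₘ κ = ρ.prod ν := by
  have h1 : doubling ρ κ (orbitGraph T) = 0 := by
    rw [doubling_apply measurableSet_orbitGraph]
    refine (lintegral_eq_zero_iff' ?_).2 ?_
    · have := (Kernel.measurable_coe (κ ×ₖ κ) (measurableSet_orbitGraph (T := T))).aemeasurable
        (μ := ρ)
      simpa only [Kernel.prod_apply] using this
    filter_upwards [Measure.ae_ae_of_ae_compProd h] with w hw
    refine prod_orbitGraph_eq_zero fun x => ?_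
    by_contra hx
    refine hx ?_
    by_contra hx'
    have hsub : {x} ⊆ {x | ¬ κ w {x} = 0} := by
      rintro _ rfl; exact hx
    exact hx (measure_mono_null hsub hw)
  rw [← hbind]
  refine compProd_eq_prod_of_doubling_eq ?_
  rw [hbind]
  refine hν.eq_prod _ inferInstance (measurePreserving_doubling R T.measurable hinv)
    (doubling_map_fst.trans hbind) (doubling_map_snd.trans hbind) h1

theorem ae_kernel_eq_dirac {ν : Measure X} (hν : Ergodic T ν) (h0 : ∀ x, ν {x} = 0)
    {R : W ≃ᵐ W} (herg : Ergodic (Prod.map R T) (ρ ⊗ₘ κ))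
    (hbind : ρ.bind κ = ν) (h : ∀ᵐ q ∂(ρ ⊗ₘ κ), κ q.1 {q.2} ≠ 0)
    (hG : ∀ᵐ q ∂(doubling ρ κ), q ∈ orbitGraph T) :
    ∀ᵐ w ∂ρ, ∀ᵐ x ∂κ w, κ w = Measure.dirac x := by
  obtain ⟨v, hv⟩ := exists_ae_kernel_section_eq herg measurableSet_forwardGraph
    fun q => prodMap_mem_forwardGraph
  have hap : ∀ᵐ w ∂ρ, ∀ᵐ x ∂κ w, ∀ k : ℕ, T^[k + 1] x ≠ x := by
    have := hν.ae_iterate_ne h0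
    rw [← hbind] at this
    exact Measure.ae_ae_of_ae_comp this
  have hG' : ∀ᵐ w ∂ρ, ∀ᵐ q ∂(κ w).prod (κ w), q ∈ orbitGraph T := by
    have := Measure.ae_ae_of_ae_comp hG
    simpa only [Kernel.prod_apply] using this
  filter_upwards [Measure.ae_ae_of_ae_compProd h, Measure.ae_ae_of_ae_compProd hv, hap, hG']
    with w hw1 hw2 hw3 hw4
  have atom : ∀ {p : X → Prop}, (∀ᵐ x ∂κ w, p x) → ∀ x, κ w {x} ≠ 0 → p x := by
    intro p hp x hx
    by_contra hpx
    have hsub : {x} ⊆ {x | ¬ p x} := by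
      rintro _ rfl; exact hpx
    exact hx (measure_mono_null hsub hp)
  have hv2 := atom hw2
  have hap2 := atom hw3
  have hG2 := atom (Measure.ae_ae_of_ae_prod hw4)
  -- no atom is a later point of the orbit of another one
  have hforw : ∀ x, κ w {x} ≠ 0 → ∀ x', κ w {x'} ≠ 0 → ∀ k : ℕ, x' ≠ T^[k + 1] x := by
    intro x hx x' hx' k hk
    have hsub : {y | (x', y) ∈ forwardGraph T} ∪ {x'} ⊆ {y | (x, y) ∈ forwardGraph T} := by
      rintro y (⟨j, hj⟩ | rfl)
      · refine ⟨j + 1 + k, ?_⟩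
        change y = _ at hj
        rw [hj, hk, ← Function.iterate_add_apply]
        rfl
      · exact ⟨k, hk⟩
    have hdisj : Disjoint {y | (x', y) ∈ forwardGraph T} {x'} := by
      rw [disjoint_singleton_right]
      rintro ⟨j, hj⟩
      exact hap2 x' hx' j hj.symm
    have := measure_mono (μ := κ w) hsub
    rw [measure_union hdisj (measurableSet_singleton _), hv2 x hx, hv2 x' hx'] at this
    have hvtop : v ≠ ⊤ := by rw [← hv2 x hx]; exact measure_ne_top _ _
    have h3 : v + κ w {x'} ≤ v + 0 := by simpa using this
    exact hx' (le_zero_iff.1 ((ENNReal.add_le_add_iff_left hvtop).1 h3))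
  have hsing : ∀ x, κ w {x} ≠ 0 → ∀ x', κ w {x'} ≠ 0 → x' = x := by
    intro x hx x' hx'
    obtain ⟨k, hk⟩ := atom (hG2 x hx) x' hx'
    rcases k with _ | k
    · rcases hk with hk | hk
      · exact hk
      · exact hk.symm
    · rcases hk with hk | hk
      · exact absurd hk (hforw x hx x' hx' k)
      · exact absurd hk (hforw x' hx' x hx k)
  filter_upwards [hw1] with x hx
  have hae : ∀ᵐ x' ∂κ w, x' = x := by
    filter_upwards [hw1] with x' hx'
    exact hsing x hx x' hx'
  refine Measure.ext fun s hs => ?_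
  rw [Measure.dirac_apply' _ hs]
  by_cases hxs : x ∈ s
  · rw [indicator_of_mem hxs, Pi.one_apply, ← prob_compl_eq_zero_iff hs]
    exact hae.mono fun x' hx' => hx' ▸ hxs
  · rw [indicator_of_notMem hxs, measure_eq_zero_iff_ae_notMem]
    exact hae.mono fun x' hx' => hx' ▸ hxs

theorem exists_measurable_ae_eq_of_kernel_eq_dirac
    (h : ∀ᵐ w ∂ρ, ∀ᵐ x ∂κ w, κ w = Measure.dirac x) :
    ∃ φ : W → X, Measurable φ ∧ ∀ᵐ q ∂(ρ ⊗ₘ κ), q.2 = φ q.1 := by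
  obtain ⟨f, hf⟩ := exists_measurableEmbedding_real X
  obtain ⟨q0⟩ := (ρ ⊗ₘ κ).nonempty_of_neZero
  obtain ⟨g, hg, hgf⟩ := hf.exists_measurable_extend measurable_id fun _ => ⟨q0.2⟩
  refine ⟨fun w => g (∫ x, f x ∂κ w), ?_, ?_⟩
  · exact hg.comp (hf.measurable.stronglyMeasurable.integral_kernel).measurable
  · refine (Measure.ae_compProd_iff ?_).2 ?_
    · exact measurableSet_eq_fun measurable_snd
        ((hg.comp (hf.measurable.stronglyMeasurable.integral_kernel).measurable).comp
          measurable_fst)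
    filter_upwards [h] with w hw
    filter_upwards [hw] with x hx
    rw [hx, integral_dirac]
    exact (congrFun hgf x).symm

end Dichotomy

section Dichotomy

theorem doubling_eq_compProd_comp {X W : Type*} [MeasurableSpace X] [MeasurableSpace W]
    {ρ : Measure W} [IsProbabilityMeasure ρ] {κ : Kernel W X} [IsMarkovKernel κ]
    {ν : Measure X} [IsProbabilityMeasure ν] {κ' : Kernel X W} [IsMarkovKernel κ']
    (h : ν ⊗ₘ κ' = (ρ ⊗ₘ κ).map Prod.swap) :
    doubling ρ κ = ν ⊗ₘ (κ ∘ₖ κ') := by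
  refine Measure.ext_prod fun {s t} hs ht => ?_
  rw [doubling_apply (hs.prod ht), Measure.compProd_apply_prod hs ht]
  simp only [Measure.prod_prod]
  have hm : Measurable fun q : X × W => κ q.2 t := (κ.measurable_coe ht).comp measurable_snd
  have h1 : ∫⁻ x in s, (κ ∘ₖ κ') x t ∂ν = ∫⁻ q in s ×ˢ univ, κ q.2 t ∂(ν ⊗ₘ κ') := by
    rw [Measure.setLIntegral_compProd hm hs
      MeasurableSet.univ]
    refine setLIntegral_congr_fun hs fun x _ => ?_
    rw [Kernel.comp_apply' _ _ _ ht, setLIntegral_univ]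
  rw [h1, h, setLIntegral_map (hs.prod MeasurableSet.univ)
    hm measurable_swap]
  have h2 : Prod.swap ⁻¹' (s ×ˢ (univ : Set W)) = (univ : Set W) ×ˢ s := by
    ext; simp
  rw [h2]
  simp only [Prod.snd_swap]
  rw [Measure.setLIntegral_compProd (f := fun q => κ q.1 t)
    ((κ.measurable_coe ht).comp measurable_fst) MeasurableSet.univ
    hs, setLIntegral_univ]
  refine lintegral_congr fun w => ?_
  simp only [setLIntegral_const, mul_comm]

variable {X : Type*} [MeasurableSpace X] [StandardBorelSpace X] {T : X ≃ᵐ X}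

theorem exists_countable_bind {W : Type*} [MeasurableSpace W] {τ : Measure W} {κ : Kernel W X}
    (hκ : ∀ᵐ y ∂τ, ∃ C : Set X, C.Countable ∧ κ y Cᶜ = 0)
    (hτ : ∃ E : Set W, E.Countable ∧ τ Eᶜ = 0) :
    ∃ C : Set X, C.Countable ∧ τ.bind κ Cᶜ = 0 := by
  classical
  obtain ⟨E, hE, hE0⟩ := hτ
  have hex : ∀ y, ∃ C : Set X, C.Countable ∧
      ((∃ C : Set X, C.Countable ∧ κ y Cᶜ = 0) → κ y Cᶜ = 0) := fun y => by
    by_cases h : ∃ C : Set X, C.Countable ∧ κ y Cᶜ = 0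
    · obtain ⟨C, hC, hC0⟩ := h
      exact ⟨C, hC, fun _ => hC0⟩
    · exact ⟨∅, countable_empty, fun h' => absurd h' h⟩
  choose C hC hC0 using hex
  have hcc : (⋃ y ∈ E, C y).Countable := hE.biUnion fun y _ => hC y
  refine ⟨⋃ y ∈ E, C y, hcc, ?_⟩
  rw [Measure.bind_apply hcc.measurableSet.compl κ.aemeasurable,
    lintegral_eq_zero_iff (κ.measurable_coe hcc.measurableSet.compl)]
  filter_upwards [hκ, measure_eq_zero_iff_ae_notMem.1 hE0] with y hy hyE
  exact measure_mono_null (compl_subset_compl.2 (subset_biUnion_of_mem (not_not.1 hyE)))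
    (hC0 y hy)

theorem ae_compProd_measure_singleton_ne_zero {W : Type*} [MeasurableSpace W] {ρ : Measure W}
    [SFinite ρ] {κ : Kernel W X} [IsSFiniteKernel κ]
    (h : ∀ᵐ w ∂ρ, ∃ C : Set X, C.Countable ∧ κ w Cᶜ = 0) :
    ∀ᵐ q ∂(ρ ⊗ₘ κ), κ q.1 {q.2} ≠ 0 := by
  have hmeas : Measurable fun q : W × X => κ q.1 {q.2} := by
    let π : Kernel (W × X) X := κ.comap Prod.fst measurable_fst
    have hE' : MeasurableSet {p : (W × X) × X | p.2 = p.1.2} :=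
      measurableSet_eq_fun measurable_snd measurable_fst.snd
    exact Kernel.measurable_kernel_prodMk_left (κ := π) hE'
  refine (Measure.ae_compProd_iff (hmeas (measurableSet_singleton 0).compl)).2 ?_
  filter_upwards [h] with x ⟨C, hCc, hC0⟩
  have hN : κ x (C ∩ {x' | κ x {x'} = 0}) = 0 :=
    (measure_null_iff_singleton (hCc.mono inter_subset_left)).2 fun x' hx' => hx'.2
  filter_upwards [measure_eq_zero_iff_ae_notMem.1 hN, measure_eq_zero_iff_ae_notMem.1 hC0]
    with x' hx1 hx2 hx3
  exact hx1 ⟨not_not.1 hx2, hx3⟩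

theorem IsGood.eq_prod_or_exists_measurable {ν ν' : Measure X} (hν : IsGood T ν)
    (hν' : IsGood T ν') {ξ : Measure (X × X)} [IsProbabilityMeasure ξ]
    (herg : Ergodic (Prod.map T T) ξ) (h1 : ξ.map Prod.fst = ν) (h2 : ξ.map Prod.snd = ν') :
    ξ = ν.prod ν' ∨ ∃ φ : X → X, Measurable φ ∧ ∀ᵐ q ∂ξ, q.1 = φ q.2 := by
  have := hν.isProbabilityMeasure
  have := hν'.isProbabilityMeasure
  obtain ⟨q0⟩ := ξ.nonempty_of_neZero
  have : Nonempty X := ⟨q0.1⟩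
  rcases hν.atoms with h0 | ⟨x0, hx0⟩
  swap
  · right
    refine ⟨fun _ => x0, measurable_const, ?_⟩
    have : ∀ᵐ x ∂ξ.map Prod.fst, x = x0 := by
      rw [h1, hx0, ae_dirac_eq]
      rfl
    exact ae_of_ae_map measurable_fst.aemeasurable this
  set ξs := ξ.map Prod.swap with hξs
  have hξsp : IsProbabilityMeasure ξs :=
    Measure.isProbabilityMeasure_map measurable_swap.aemeasurable
  have hξsfst : ξs.fst = ν' := by rw [hξs, Measure.fst_map_swap]; exact h2
  have hξfst : ξ.fst = ν := h1
  set κ := ξs.condKernel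
  set κ' := ξ.condKernel
  have hd : ν' ⊗ₘ κ = ξs := by rw [← hξsfst]; exact ξs.disintegrate _
  have hd' : ν ⊗ₘ κ' = ξ := by rw [← hξfst]; exact ξ.disintegrate _
  have hξsξ : ξs.map Prod.swap = ξ := by
    rw [hξs, Measure.map_map measurable_swap measurable_swap, Prod.swap_swap_eq, Measure.map_id]
  have hergs : Ergodic (Prod.map T T) (ν' ⊗ₘ κ) := by
    rw [hd]
    have hmp : MeasurePreserving Prod.swap ξ ξs := measurable_swap.measurePreserving _
    refine hmp.ergodic_of_ergodic_semiconj herg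
      (T.measurable.prodMap T.measurable) fun _ => rfl
  have herg' : Ergodic (Prod.map T T) (ν ⊗ₘ κ') := by rwa [hd']
  have hdiag : ∀ x : X, {x' | (x, x') ∈ diagonal X} = {x} := fun x => by
    ext; simp [eq_comm]
  obtain ⟨u, hu⟩ := exists_ae_kernel_section_eq hergs measurableSet_diagonal
    fun q => prodMap_mem_diagonal
  obtain ⟨u', hu'⟩ := exists_ae_kernel_section_eq herg' measurableSet_diagonal
    fun q => prodMap_mem_diagonal
  simp only [hdiag] at hu hu'
  have hb : ν'.bind κ = ν := by
    rw [← Measure.snd_compProd, hd, hξs, Measure.snd_map_swap]; exact h1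
  have hb' : ν.bind κ' = ν' := by
    rw [← Measure.snd_compProd, hd']; exact h2
  rcases eq_or_ne u 0 with rfl | hu0
  · left
    have := hν.compProd_eq_prod_of_ae_measure_singleton_eq_zero hergs.toMeasurePreserving hb hu
    rw [← hξsξ, ← hd, this, Measure.prod_swap]
  rcases eq_or_ne u' 0 with rfl | hu0'
  · left
    have := hν'.compProd_eq_prod_of_ae_measure_singleton_eq_zero herg'.toMeasurePreserving hb' hu'
    rw [← hd', this]
  right
  have hune : ∀ᵐ q ∂(ν' ⊗ₘ κ), κ q.1 {q.2} ≠ 0 := hu.mono fun q hq => hq ▸ hu0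
  have hune' : ∀ᵐ q ∂(ν ⊗ₘ κ'), κ' q.1 {q.2} ≠ 0 := hu'.mono fun q hq => hq ▸ hu0'
  rcases hν.ae_mem_orbitGraph_or_absolutelyContinuous h0
    (measurePreserving_doubling T T.measurable hergs.toMeasurePreserving)
    (doubling_map_fst.trans hb) (doubling_map_snd.trans hb) with hG | hac
  · obtain ⟨φ, hφ, h⟩ := exists_measurable_ae_eq_of_kernel_eq_dirac
      (ae_kernel_eq_dirac hν.ergodic h0 hergs hb hune hG)
    rw [hd, hξs] at h
    exact ⟨φ, hφ, ae_of_ae_map measurable_swap.aemeasurable h⟩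
  exfalso
  rw [doubling_eq_compProd_comp (κ' := κ') (ν := ν) (by rw [hd, hd', hξsξ])] at hac
  have e1 : ∀ᵐ x ∂ν, ∀ᵐ y ∂κ' x, ∃ C : Set X, C.Countable ∧ κ y Cᶜ = 0 := by
    refine Measure.ae_ae_of_ae_comp ?_
    rw [hb']
    exact exists_countable_of_ae_measure_singleton_ne_zero hune
  have hC : ∀ᵐ x ∂ν, ∃ C : Set X, C.Countable ∧ (κ ∘ₖ κ') x Cᶜ = 0 := by
    filter_upwards [e1, exists_countable_of_ae_measure_singleton_ne_zero hune'] with x hx hx'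
    rw [Kernel.comp_apply]
    exact exists_countable_bind hx hx'
  have hD := ae_compProd_measure_singleton_ne_zero hC
  have hfin := Measure.ae_ae_of_ae_prod (hac.ae_le hD)
  obtain ⟨x, hx⟩ := hfin.exists
  have hx2 : ν {x' | (κ ∘ₖ κ') x {x'} ≠ 0} = 0 :=
    (measure_null_iff_singleton (countable_measure_singleton_ne_zero _)).2 fun x' _ => h0 x'
  obtain ⟨x', h3, h4⟩ := (hx.and (measure_eq_zero_iff_ae_notMem.1 hx2)).exists
  exact h4 h3

end Dichotomy

section Blocks

variable {X : Type*} [MeasurableSpace X] [StandardBorelSpace X] {T : X ≃ᵐ X}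

theorem exists_pairwise_independent_block {ι : Type*} [Finite ι] {ν : ι → Measure X}
    (hν : ∀ i, IsGood T (ν i)) {ζ : Measure (ι → X)} [IsProbabilityMeasure ζ]
    (herg : Ergodic (fun x i => T (x i)) ζ) (h1 : ∀ i, ζ.map (fun x => x i) = ν i) :
    ∃ S : Set ι, (∀ i ∈ S, ∀ j ∈ S, i ≠ j → ζ.map (fun x => (x i, x j)) = (ν i).prod (ν j)) ∧
      ∃ Φ : (S → X) → ι → X, Measurable Φ ∧ ∀ᵐ x ∂ζ, x = Φ fun i => x i := by
  classical
  obtain ⟨S, hS⟩ := (Set.toFinite {S : Set ι | ∀ i ∈ S, ∀ j ∈ S, i ≠ j →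
    ζ.map (fun x => (x i, x j)) = (ν i).prod (ν j)}).exists_maximal
      ⟨∅, fun i hi => absurd hi (notMem_empty i)⟩
  refine ⟨S, hS.prop, ?_⟩
  have hfun : ∀ j, ∃ i ∈ S, ∃ φ : X → X, Measurable φ ∧
      ∀ᵐ x ∂ζ, x j = φ (x i) := by
    intro j
    by_cases hj : j ∈ S
    · exact ⟨j, hj, id, measurable_id, Eventually.of_forall fun _ => rfl⟩
    by_contra hcon
    refine hj (hS.le_of_ge (y := insert j S) ?_ (subset_insert _ _) (mem_insert _ _))
    have hpair : ∀ i ∈ S, ζ.map (fun x => (x j, x i)) = (ν j).prod (ν i) := by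
      intro i hi
      have hmeas : Measurable fun x : ι → X => (x j, x i) := by fun_prop
      have hmp := hmeas.measurePreserving ζ
      have := Measure.isProbabilityMeasure_map (μ := ζ) hmeas.aemeasurable
      rcases (hν j).eq_prod_or_exists_measurable (hν i)
        (hmp.ergodic_of_ergodic_semiconj herg (T.measurable.prodMap T.measurable) fun _ => rfl)
        (by rw [Measure.map_map measurable_fst hmeas]; exact h1 j)
        (by rw [Measure.map_map measurable_snd hmeas]; exact h1 i) with h | ⟨φ, hφ, h⟩
      · exact h
      · exact absurd ⟨i, hi, φ, hφ, ae_of_ae_map hmeas.aemeasurable h⟩ hcon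
    intro i hi k hk hik
    rcases hi with rfl | hi <;> rcases hk with rfl | hk
    · exact absurd rfl hik
    · exact hpair k hk
    · have hsw : (fun x : ι → X => (x i, x k)) = Prod.swap ∘ fun x => (x k, x i) := rfl
      have := (hν i).isProbabilityMeasure
      have := (hν k).isProbabilityMeasure
      rw [hsw, ← Measure.map_map measurable_swap (by fun_prop), hpair i hi, Measure.prod_swap]
    · exact hS.prop i hi k hk hik
  choose p hp φ hφ h using hfun
  refine ⟨fun y j => φ j (y ⟨p j, hp j⟩), ?_, ?_⟩
  · exact measurable_pi_lambda _ fun j => (hφ j).comp (measurable_pi_apply _)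
  · filter_upwards [ae_all_iff.2 h] with x hx
    funext j
    exact hx j

theorem eq_fst_prod_snd_of_isGood {ι : Type*} [Fintype ι] {ν ν' : ι → Measure X}
    (hν : ∀ i, IsGood T (ν i)) (hν' : ∀ i, IsGood T (ν' i))
    {ξ : Measure ((ι → X) × (ι → X))} [IsProbabilityMeasure ξ]
    (herg : Ergodic (Prod.map (fun (x : ι → X) i => T (x i)) fun x i => T (x i)) ξ)
    (h1 : ∀ i, ξ.map (fun q => q.1 i) = ν i) (h2 : ∀ i, ξ.map (fun q => q.2 i) = ν' i)
    (h12 : ∀ i j, ξ.map (fun q => (q.1 i, q.2 j)) = (ν i).prod (ν' j)) :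
    ξ = ξ.fst.prod ξ.snd := by
  classical
  have hTι : Measurable fun (x : ι → X) i => T (x i) := measurable_piMap T.measurable
  have hpν := fun i => (hν i).isProbabilityMeasure
  have hpν' := fun i => (hν' i).isProbabilityMeasure
  have := Measure.isProbabilityMeasure_map (μ := ξ) measurable_fst.aemeasurable
  have := Measure.isProbabilityMeasure_map (μ := ξ) measurable_snd.aemeasurable
  obtain ⟨S, hS, Φ, hΦ, hΦx⟩ := exists_pairwise_independent_block hν
    ((measurable_fst.measurePreserving ξ).ergodic_of_ergodic_semiconj herg hTι fun _ => rfl)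
    (fun i => by rw [Measure.map_map (by fun_prop) measurable_fst]; exact h1 i)
  obtain ⟨S', hS', Φ', hΦ', hΦx'⟩ := exists_pairwise_independent_block hν'
    ((measurable_snd.measurePreserving ξ).ergodic_of_ergodic_semiconj herg hTι fun _ => rfl)
    (fun i => by rw [Measure.map_map (by fun_prop) measurable_snd]; exact h2 i)
  let r : (ι → X) × (ι → X) → (S → X) × (S' → X) := fun q => (fun i => q.1 i, fun i => q.2 i)
  have hr : Measurable r := by fun_prop
  let e := MeasurableEquiv.sumPiEquivProdPi (fun _ : S ⊕ S' => X)
  let lab : S ⊕ S' → Measure X := Sum.elim (fun i => ν i) fun i => ν' i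
  have hlab : ∀ i, IsGood T (lab i) := by
    rintro (i | i)
    · exact hν i
    · exact hν' i
  have hplab := fun i => (hlab i).isProbabilityMeasure
  have her : Measurable (e.symm ∘ r) := e.symm.measurable.comp hr
  have := Measure.isProbabilityMeasure_map (μ := ξ) her.aemeasurable
  have hpi : ξ.map (e.symm ∘ r) = Measure.pi lab := by
    refine eq_pi_of_pairwise hplab (fun i => (hlab i).hasPID) ?_ ?_ ?_
    · refine MeasurePreserving.of_semiconj (her.measurePreserving ξ) herg.toMeasurePreserving ?_
        (measurable_piMap T.measurable)
      intro q
      funext i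
      rcases i with i | i <;> rfl
    · rintro (i | i)
      · rw [Measure.map_map (measurable_pi_apply _) her]
        exact h1 i
      · rw [Measure.map_map (measurable_pi_apply _) her]
        exact h2 i
    · intro i j hij
      rw [Measure.map_map (by fun_prop) her]
      rcases i with i | i <;> rcases j with j | j
      · have := hS i i.2 j j.2 fun h => hij (by rw [Subtype.ext h])
        rw [Measure.map_map (by fun_prop) measurable_fst] at this
        exact this
      · exact h12 i j
      · have hsw : (fun q : (ι → X) × (ι → X) => (q.2 i, q.1 j)) =
          Prod.swap ∘ fun q => (q.1 j, q.2 i) := rfl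
        change ξ.map (fun q : (ι → X) × (ι → X) => (q.2 i, q.1 j)) = (ν' i).prod (ν j)
        rw [hsw, ← Measure.map_map measurable_swap (by fun_prop), h12, Measure.prod_swap]
      · have := hS' i i.2 j j.2 fun h => hij (by rw [Subtype.ext h])
        rw [Measure.map_map (by fun_prop) measurable_snd] at this
        exact this
  have hmp := measurePreserving_sumPiEquivProdPi_symm (X := fun _ : S ⊕ S' => X) lab
  rw [← Measure.map_map e.symm.measurable hr, ← hmp.map_eq] at hpi
  have hrprod := e.symm.map_measurableEquiv_injective hpi
  have hξ : ξ.map (Prod.map Φ Φ' ∘ r) = ξ := by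
    have : Prod.map Φ Φ' ∘ r =ᵐ[ξ] id := by
      filter_upwards [ae_of_ae_map measurable_fst.aemeasurable hΦx,
        ae_of_ae_map measurable_snd.aemeasurable hΦx'] with q hq hq'
      exact Prod.ext hq.symm hq'.symm
    rw [Measure.map_congr this, Measure.map_id]
  rw [← Measure.map_map (hΦ.prodMap hΦ') hr, hrprod, ← Measure.map_prod_map _ _ hΦ hΦ'] at hξ
  have := Measure.isProbabilityMeasure_map (μ := Measure.pi fun i : S => lab (Sum.inl i))
    hΦ.aemeasurable
  have := Measure.isProbabilityMeasure_map (μ := Measure.pi fun i : S' => lab (Sum.inr i))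
    hΦ'.aemeasurable
  rw [← hξ, Measure.fst_prod, Measure.snd_prod]

end Blocks

theorem eq_of_isEmpty_index {ι X : Type*} [IsEmpty ι] [MeasurableSpace X]
    (lam lam' : Measure (ι → X)) [IsProbabilityMeasure lam] [IsProbabilityMeasure lam'] :
    lam = lam' := by
  refine Measure.ext fun s _ => ?_
  rcases Subsingleton.eq_empty_or_singleton (s := s) (fun _ _ _ _ => Subsingleton.elim _ _)
    with rfl | ⟨x, rfl⟩
  · simp
  · have : ({x} : Set (ι → X)) = univ := by
      ext y; simp [Subsingleton.elim y x]
    rw [this]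
    simp

section MinimalSelfJoinings

variable {X : Type} [MeasurableSpace X] {T : X ≃ᵐ X}

theorem MeasurableEquiv.measurePreserving_zpow {ν : Measure X} (h : MeasurePreserving T ν ν)
    (k : ℤ) : MeasurePreserving (T.toEquiv ^ k : Equiv.Perm X) ν ν := by
  rcases k with k | k
  · have : ⇑(T.toEquiv ^ (Int.ofNat k) : Equiv.Perm X) = T^[k] := by
      rw [Int.ofNat_eq_natCast, zpow_natCast, Equiv.Perm.coe_pow]; rfl
    rw [this]
    exact h.iterate k
  · have : ⇑(T.toEquiv ^ (Int.negSucc k) : Equiv.Perm X) = T.symm^[k + 1] := by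
      rw [zpow_negSucc, ← inv_pow, Equiv.Perm.coe_pow]; rfl
    rw [this]
    exact (h.symm T).iterate (k + 1)

theorem zpow_mem_orbitGraph (k : ℤ) (x : X) :
    ((T.toEquiv ^ k : Equiv.Perm X) x, x) ∈ orbitGraph T := by
  rcases k with k | k
  · refine ⟨k, Or.inr ?_⟩
    rw [Int.ofNat_eq_natCast, zpow_natCast, Equiv.Perm.coe_pow]; rfl
  · refine ⟨k + 1, Or.inl ?_⟩
    rw [zpow_negSucc, ← inv_pow, Equiv.Perm.coe_pow]
    exact ((T.right_inv : Function.RightInverse T.symm T).iterate (k + 1) x).symm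

theorem HasMSJ.eq_pi_of_ergodic {ν : Measure X} [IsProbabilityMeasure ν]
    (hinv : MeasurePreserving T ν ν) (hν : HasMSJ T.toEquiv ν)
    {N : ℕ} {lam : Measure (Fin (N + 1) → X)} [IsProbabilityMeasure lam]
    (herg : Ergodic (fun x i => T (x i)) lam) (h1 : ∀ i, lam.map (fun x => x i) = ν)
    (h2 : ∀ i j, i ≠ j → ∀ᵐ x ∂lam, (x i, x j) ∉ orbitGraph T) :
    lam = Measure.pi fun _ => ν := by
  let f : (Fin (N + 1) → X) → ℕ → X := fun x i => x ⟨min i N, by omega⟩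
  have hf : Measurable f := measurable_pi_lambda _ fun i => measurable_pi_apply _
  have hfr : (fun (x : ℕ → X) (i : Fin (N + 1)) => x i) ∘ f = id := by
    funext x i
    simp only [f, Function.comp_apply, id]
    congr 1
    exact Fin.ext (min_eq_left (Nat.lt_succ_iff.1 i.2))
  have hferg := (hf.measurePreserving lam).ergodic_of_ergodic_semiconj herg
    (measurable_piMap T.measurable) fun _ => rfl
  obtain ⟨c, k, hc, h⟩ := hν (lam.map f) (Measure.isProbabilityMeasure_map hf.aemeasurable)
    hferg.toMeasurePreserving
    (fun i => by rw [Measure.map_map (measurable_pi_apply i) hf]; exact h1 _) hferg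
  have hk : ∀ j : ℤ, Measurable (T.toEquiv ^ j : Equiv.Perm X) := fun j =>
    (MeasurableEquiv.measurePreserving_zpow hinv j).measurable
  have hN := h (N + 1)
  rw [Measure.map_map (measurable_pi_lambda _ fun i => measurable_pi_apply _) hf, hfr,
    Measure.map_id] at hN
  have hmeas : Measurable fun (y : Fin (N + 1) → X) (i : Fin (N + 1)) =>
      (T.toEquiv ^ (k i) : Equiv.Perm X) (y ⟨c i, lt_of_le_of_lt (hc i) i.isLt⟩) :=
    measurable_pi_lambda _ fun i => (hk _).comp (measurable_pi_apply _)
  have hci : ∀ i : ℕ, i < N + 1 → c i = i := by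
    intro i
    induction i using Nat.strong_induction_on with
    | _ i ih =>
    intro hi
    by_contra hne
    have hlt : c i < i := lt_of_le_of_ne (hc i) hne
    have hcc := ih (c i) hlt (hlt.trans hi)
    have hae := h2 ⟨i, hi⟩ ⟨c i, hlt.trans hi⟩ fun heq => hne (congrArg Fin.val heq).symm
    rw [hN] at hae
    obtain ⟨y, hy⟩ := (ae_of_ae_map hmeas.aemeasurable hae).exists
    refine hy ?_
    have hy2 : (⟨c (c i), lt_of_le_of_lt (hc _) (hlt.trans hi)⟩ : Fin (N + 1)) =
      ⟨c i, hlt.trans hi⟩ := Fin.ext hcc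
    have := zpow_mem_orbitGraph (T := T) (k i - k (c i))
      ((T.toEquiv ^ (k (c i)) : Equiv.Perm X) (y ⟨c i, hlt.trans hi⟩))
    rw [← Equiv.Perm.mul_apply, ← zpow_add, sub_add_cancel] at this
    simpa only [hy2] using this
  have hfun : (fun (y : Fin (N + 1) → X) (i : Fin (N + 1)) =>
      (T.toEquiv ^ (k i) : Equiv.Perm X) (y ⟨c i, lt_of_le_of_lt (hc i) i.isLt⟩)) =
      fun (y : Fin (N + 1) → X) (i : Fin (N + 1)) => (T.toEquiv ^ (k i) : Equiv.Perm X) (y i) := by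
    funext y i
    congr 2
    exact Fin.ext (hci i i.2)
  rw [hN, hfun]
  exact (measurePreserving_pi (fun _ : Fin (N + 1) => ν) (fun _ => ν) fun i =>
    MeasurableEquiv.measurePreserving_zpow hinv (k i)).map_eq

theorem Ergodic.ae_kernel_eq [StandardBorelSpace X] {ν : Measure X} [IsProbabilityMeasure ν]
    (hν : Ergodic T ν) {K : Kernel X X} (hK : IsErgodicKernel T ν K) : ∀ᵐ x ∂ν, K x = ν := by
  have := hK.ae_ae_eq_of_bind (B := Unit) (P := Measure.dirac ()) (m := fun _ => ν)
    measurable_const (fun _ => inferInstance) (fun _ => hν) (by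
      rw [Measure.dirac_bind measurable_const])
  simpa using this

theorem HasMSJ.eq_pi [StandardBorelSpace X] {ν : Measure X} [IsProbabilityMeasure ν]
    (hνerg : Ergodic T ν) (hν : HasMSJ T.toEquiv ν)
    {N : ℕ} {lam : Measure (Fin N → X)} [IsProbabilityMeasure lam]
    (hinv : MeasurePreserving (fun x i => T (x i)) lam lam)
    (h1 : ∀ i, lam.map (fun x => x i) = ν)
    (h2 : ∀ i j, i ≠ j → ∀ᵐ x ∂lam, (x i, x j) ∉ orbitGraph T) :
    lam = Measure.pi fun _ => ν := by
  rcases N with _ | N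
  · exact eq_of_isEmpty_index lam _
  obtain ⟨K, hK⟩ := exists_isErgodicKernel hinv
  obtain ⟨Kν, hKν⟩ := exists_isErgodicKernel hνerg.toMeasurePreserving
  have := hK.isMarkovKernel
  have e1 : ∀ i, ∀ᵐ x ∂lam, (K x).map (fun y => y i) = ν := by
    intro i
    have h3 := hKν.ae_map_eq hK T.measurable (measurable_pi_apply i) (fun _ => rfl) (h1 i)
    have h4 := hνerg.ae_kernel_eq hKν
    rw [← h1 i] at h4
    filter_upwards [h3, ae_of_ae_map (measurable_pi_apply i).aemeasurable h4] with x hx hx'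
    rw [hx, hx']
    exact h1 i
  have e2 : ∀ i j, i ≠ j → ∀ᵐ x ∂lam, ∀ᵐ y ∂K x, (y i, y j) ∉ orbitGraph T := by
    intro i j hij
    have := h2 i j hij
    rw [← hK.bind_eq] at this
    exact Measure.ae_ae_of_ae_comp this
  have key : ∀ᵐ x ∂lam, K x = Measure.pi fun _ => ν := by
    filter_upwards [ae_all_iff.2 e1, ae_all_iff.2 fun i => ae_all_iff.2 fun j =>
      eventually_imp_distrib_left.2 (e2 i j), hK.ae_ergodic] with x hx1 hx2 hx3
    exact hν.eq_pi_of_ergodic hνerg.toMeasurePreserving hx3 hx1 hx2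
  rw [← hK.bind_eq, Measure.bind_congr_right key, Measure.bind_const]
  simp

end MinimalSelfJoinings

section PeriodicMeasure

variable {W : Type*} [MeasurableSpace W]

/-- The uniform measure on the first `q` points of the orbit of `w`. -/
noncomputable def orbitMeasure (S : W → W) (q : ℕ) (w : W) : Measure W :=
  (q : ℝ≥0∞)⁻¹ • ∑ i ∈ Finset.range q, Measure.dirac (S^[i] w)

theorem isProbabilityMeasure_orbitMeasure {S : W → W} {q : ℕ} (hq : q ≠ 0) (w : W) :
    IsProbabilityMeasure (orbitMeasure S q w) := by
  refine ⟨?_⟩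
  simp only [orbitMeasure, Measure.smul_apply, Measure.coe_finsetSum, Finset.sum_apply,
    measure_univ, Finset.sum_const, Finset.card_range, smul_eq_mul, nsmul_eq_mul, mul_one]
  exact ENNReal.inv_mul_cancel (Nat.cast_ne_zero.2 hq) (ENNReal.natCast_ne_top q)

theorem orbitMeasure_map {S : W → W} {V : Type*} [MeasurableSpace V] {T : V → V} {π : W → V}
    (hπ : Measurable π) (h : Function.Semiconj π S T) (q : ℕ) (w : W) :
    (orbitMeasure S q w).map π = orbitMeasure T q (π w) := by
  simp only [orbitMeasure, Measure.map_smul]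
  congr 1
  rw [← Measure.mapₗ_apply_of_measurable hπ, map_sum]
  refine Finset.sum_congr rfl fun i _ => ?_
  rw [Measure.mapₗ_apply_of_measurable hπ, Measure.map_dirac' hπ]
  exact congrArg _ (h.iterate_right i w)

theorem measurePreserving_orbitMeasure {S : W → W} (hS : Measurable S) {q : ℕ} {w : W}
    (hq : S^[q] w = w) : MeasurePreserving S (orbitMeasure S q w) (orbitMeasure S q w) := by
  refine ⟨hS, ?_⟩
  rw [orbitMeasure_map hS (fun _ => rfl)]
  simp only [orbitMeasure, ← Function.iterate_succ_apply]
  congr 1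
  rcases q with _ | q
  · simp
  rw [Finset.sum_range_succ, Finset.sum_range_succ', hq, Function.iterate_zero, id]

variable {T : W ≃ᵐ W} {ν : Measure W}

theorem MeasureTheory.MeasurePreserving.measure_singleton_iterate
    [MeasurableSingletonClass W] (h : MeasurePreserving T ν ν) (x : W) (i : ℕ) :
    ν {T^[i] x} = ν {x} := by
  rw [← (h.iterate i).measure_preimage (measurableSet_singleton _).nullMeasurableSet]
  congr 1
  ext y
  exact (T.injective.iterate i).eq_iff

variable [IsProbabilityMeasure ν]

theorem MeasureTheory.MeasurePreserving.minimalPeriod_ne_zero [MeasurableSingletonClass W]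
    (h : MeasurePreserving T ν ν) {x : W} (hx : ν {x} ≠ 0) : Function.minimalPeriod T x ≠ 0 := by
  obtain ⟨y, hy, k, hk, hyk⟩ := h.exists_mem_iterate_mem
    (measurableSet_singleton x).nullMeasurableSet hx
  rw [mem_singleton_iff] at hy hyk
  subst hy
  exact (Function.IsPeriodicPt.minimalPeriod_pos (Nat.pos_of_ne_zero hk) hyk).ne'

theorem Ergodic.eq_orbitMeasure [MeasurableSingletonClass W] (h : Ergodic T ν) {x : W}
    (hx : ν {x} ≠ 0) : ν = orbitMeasure T (Function.minimalPeriod T x) x := by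
  have := isProbabilityMeasure_orbitMeasure (S := T)
    (h.toMeasurePreserving.minimalPeriod_ne_zero hx) x
  refine (h.eq_of_absolutelyContinuous
    (measurePreserving_orbitMeasure T.measurable (Function.iterate_minimalPeriod)) ?_).symm
  intro s hs
  simp only [orbitMeasure, Measure.smul_apply, Measure.coe_finsetSum, Finset.sum_apply,
    smul_eq_mul]
  refine mul_eq_zero_of_right _ (Finset.sum_eq_zero fun i _ => ?_)
  have hi : T^[i] x ∉ s := fun hi => hx <| by
    rw [← h.toMeasurePreserving.measure_singleton_iterate x i]
    exact measure_mono_null (singleton_subset_iff.2 hi) hs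
  rw [Measure.dirac_apply, indicator_of_notMem hi]

theorem Ergodic.not_fibersDisjoint {X : Type} [MeasurableSpace X] [MeasurableSingletonClass X]
    {T : X ≃ᵐ X} {ν ν' : Measure X} [IsProbabilityMeasure ν] [IsProbabilityMeasure ν']
    (h : Ergodic T ν) (h' : Ergodic T ν') {x x' : X} (hx : ν {x} ≠ 0) (hx' : ν' {x'} ≠ 0)
    (hp : Function.minimalPeriod T x = Function.minimalPeriod T x')
    (hp1 : Function.minimalPeriod T x ≠ 1) : ¬ FibersDisjoint T ν ν' := by
  intro hd
  set q := Function.minimalPeriod T x with hq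
  have hq0 : q ≠ 0 := h.toMeasurePreserving.minimalPeriod_ne_zero hx
  have hit : ∀ i, (Prod.map T T)^[i] (x, x') = (T^[i] x, T^[i] x') := fun i => by
    rw [Prod.map_iterate]; rfl
  have hper : (Prod.map T T)^[q] (x, x') = (x, x') := by
    rw [hit, hp, Function.iterate_minimalPeriod, ← hp, hq, Function.iterate_minimalPeriod]
  have hlam := hd (orbitMeasure (Prod.map T T) q (x, x'))
    (isProbabilityMeasure_orbitMeasure hq0 _)
    (measurePreserving_orbitMeasure (T.measurable.prodMap T.measurable) hper)
    (by rw [orbitMeasure_map measurable_fst fun _ => rfl]; exact (h.eq_orbitMeasure hx).symm)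
    (by rw [orbitMeasure_map measurable_snd fun _ => rfl, hp]; exact (h'.eq_orbitMeasure hx').symm)
  have h0 : orbitMeasure (Prod.map T T) q (x, x') ({x} ×ˢ {T x'}) = 0 := by
    simp only [orbitMeasure, Measure.smul_apply, Measure.coe_finsetSum, Finset.sum_apply,
      smul_eq_mul]
    refine mul_eq_zero_of_right _ (Finset.sum_eq_zero fun i hi => ?_)
    rw [hit, Measure.dirac_apply, indicator_of_notMem]
    rintro ⟨h1, h2⟩
    have hdvd : q ∣ i := Function.IsPeriodicPt.minimalPeriod_dvd h1
    have hi0 : i = 0 := Nat.eq_zero_of_dvd_of_lt hdvd (Finset.mem_range.1 hi)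
    subst hi0
    have hfix : Function.IsFixedPt T x' := (mem_singleton_iff.1 h2).symm
    exact hp1 (hp.trans (Function.minimalPeriod_eq_one_iff_isFixedPt.2 hfix))
  rw [hlam, Measure.prod_prod, mul_eq_zero] at h0
  refine h0.elim hx ?_
  have := h'.toMeasurePreserving.measure_singleton_iterate x' 1
  rw [Function.iterate_one] at this
  rwa [this]

theorem countable_setOf_atomic_fiber {X : Type} [MeasurableSpace X] [MeasurableSingletonClass X]
    {T : X ≃ᵐ X} {B : Type} {m : B → Measure X} (hprob : ∀ b, IsProbabilityMeasure (m b))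
    (herg : ∀ b, Ergodic T (m b))
    (hcount : ∀ b : B, Set.Countable {b' : B | ¬ FibersDisjoint T (m b) (m b')}) :
    {b | ¬ ((∀ x, m b {x} = 0) ∨ ∃ x, m b = Measure.dirac x)}.Countable := by
  have hsub : {b | ¬ ((∀ x, m b {x} = 0) ∨ ∃ x, m b = Measure.dirac x)} ⊆
      ⋃ q : ℕ, {b | q ≠ 1 ∧ ∃ x, m b {x} ≠ 0 ∧ Function.minimalPeriod T x = q} := by
    intro b hb
    simp only [mem_ofPred_eq, not_or, not_forall] at hb
    obtain ⟨⟨x, hx⟩, hb⟩ := hb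
    refine mem_iUnion.2 ⟨_, fun h1 => hb ⟨x, ?_⟩, x, hx, rfl⟩
    rw [(herg b).eq_orbitMeasure hx, h1]
    simp [orbitMeasure]
  refine (countable_iUnion fun q => ?_).mono hsub
  rcases eq_empty_or_nonempty
    {b | q ≠ 1 ∧ ∃ x, m b {x} ≠ 0 ∧ Function.minimalPeriod T x = q} with h | ⟨b, hq, x, hx, hxq⟩
  · rw [h]; exact countable_empty
  · refine (hcount b).mono ?_
    rintro b' ⟨-, x', hx', hxq'⟩
    exact (herg b).not_fibersDisjoint (herg b') hx hx' (hxq.trans hxq'.symm) (hxq ▸ hq)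

end PeriodicMeasure

section Dirac

variable {X : Type} [MeasurableSpace X] {T : X ≃ᵐ X}

theorem MeasureTheory.Measure.eq_dirac_of_ae {W : Type*} [MeasurableSpace W] {lam : Measure W}
    [IsProbabilityMeasure lam] {w : W} (h : ∀ᵐ v ∂lam, v = w) : lam = Measure.dirac w := by
  have : lam.map id = lam.map fun _ => w := Measure.map_congr h
  rwa [Measure.map_id, Measure.map_const, measure_univ, one_smul] at this

theorem ae_eq_of_map_eq_dirac [MeasurableSingletonClass X] {W : Type*} [MeasurableSpace W]
    {lam : Measure W} {f : W → X} (hf : Measurable f) {x : X}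
    (h : lam.map f = Measure.dirac x) : ∀ᵐ w ∂lam, f w = x := by
  refine ae_of_ae_map hf.aemeasurable (p := fun y => y = x) ?_
  rw [h, ae_dirac_eq]
  rfl

theorem eq_of_map_eq_dirac [MeasurableSingletonClass X] {ι : Type*} [Countable ι]
    {lam lam' : Measure (ι → X)} [IsProbabilityMeasure lam] [IsProbabilityMeasure lam'] {x : X}
    (h : ∀ i, lam.map (fun y => y i) = Measure.dirac x)
    (h' : ∀ i, lam'.map (fun y => y i) = Measure.dirac x) : lam = lam' := by
  have key : ∀ (τ : Measure (ι → X)) [IsProbabilityMeasure τ],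
      (∀ i, τ.map (fun y => y i) = Measure.dirac x) → τ = Measure.dirac fun _ => x := by
    intro τ _ hτ
    refine Measure.eq_dirac_of_ae ?_
    filter_upwards [ae_all_iff.2 fun i => ae_eq_of_map_eq_dirac (measurable_pi_apply i) (hτ i)]
      with y hy
    exact funext hy
  rw [key lam h, key lam' h']

theorem hasPID_dirac [MeasurableSingletonClass X] (x : X) : HasPID T (Measure.dirac x) := by
  intro N lam _ _ h1 _
  refine eq_of_map_eq_dirac h1 fun i => ?_
  rw [(measurePreserving_eval (fun _ : Fin N => Measure.dirac x) i).map_eq]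

theorem eq_prod_of_map_eq_dirac [MeasurableSingletonClass X] {lam : Measure (X × X)}
    [IsProbabilityMeasure lam] {x : X} (h1 : lam.map Prod.fst = Measure.dirac x)
    (h2 : lam.map Prod.snd = Measure.dirac x) :
    lam = (Measure.dirac x).prod (Measure.dirac x) := by
  rw [Measure.dirac_prod_dirac]
  refine Measure.eq_dirac_of_ae ?_
  filter_upwards [ae_eq_of_map_eq_dirac measurable_fst h1,
    ae_eq_of_map_eq_dirac measurable_snd h2] with q hq1 hq2
  exact Prod.ext hq1 hq2

theorem HasMSJ.isGood [StandardBorelSpace X] {ν : Measure X} [IsProbabilityMeasure ν]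
    (herg : Ergodic T ν) (hν : HasMSJ T.toEquiv ν)
    (hat : (∀ x, ν {x} = 0) ∨ ∃ x, ν = Measure.dirac x) : IsGood T ν where
  isProbabilityMeasure := inferInstance
  ergodic := herg
  atoms := hat
  hasPID := by
    rcases hat with h | ⟨x, rfl⟩
    · intro N lam _ hinv h1 h2
      refine hν.eq_pi herg hinv h1 fun i j hij => ?_
      have : ∀ᵐ q ∂lam.map (fun x => (x i, x j)), q ∉ orbitGraph T := by
        rw [h2 i j hij]
        exact measure_eq_zero_iff_ae_notMem.1 (prod_orbitGraph_eq_zero h)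
      have hpair : Measurable fun y : Fin N → X => (y i, y j) := by fun_prop
      exact ae_of_ae_map hpair.aemeasurable this
    · exact hasPID_dirac x
  eq_prod := by
    rcases hat with h | ⟨x, rfl⟩
    · intro lam _ hinv h1 h2 h0
      let f : X × X → Fin 2 → X := MeasurableEquiv.finTwoArrow.symm
      have hf : Measurable f := MeasurableEquiv.finTwoArrow.symm.measurable
      have := Measure.isProbabilityMeasure_map (μ := lam) hf.aemeasurable
      have hpi : lam.map f = Measure.pi fun _ => ν := by
        refine hν.eq_pi herg (lam := lam.map f) ?_ ?_ ?_
        · refine MeasurePreserving.of_semiconj (hf.measurePreserving lam) hinv ?_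
            (measurable_piMap T.measurable)
          intro q
          funext i
          fin_cases i <;> rfl
        · intro i
          rw [Measure.map_map (measurable_pi_apply i) hf]
          fin_cases i
          · exact h1
          · exact h2
        · have h01 : ∀ᵐ q ∂lam, q ∉ orbitGraph T := measure_eq_zero_iff_ae_notMem.1 h0
          have hsymm : ∀ q : X × X, (q.2, q.1) ∈ orbitGraph T → q ∈ orbitGraph T := by
            rintro q ⟨k, hk⟩
            exact ⟨k, hk.symm⟩
          have hmeas := (measurableSet_orbitGraph (T := T)).compl
          intro i j hij
          have hpair : Measurable fun y : Fin 2 → X => (y i, y j) := by fun_prop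
          refine (ae_map_iff hf.aemeasurable (hpair hmeas)).2 ?_
          filter_upwards [h01] with q hq
          fin_cases i <;> fin_cases j
          · exact absurd rfl hij
          · exact hq
          · exact fun h => hq (hsymm q h)
          · exact absurd rfl hij
      have h3 := (measurePreserving_finTwoArrow ν).map_eq
      rw [← hpi, Measure.map_map MeasurableEquiv.finTwoArrow.measurable hf] at h3
      have h4 : (MeasurableEquiv.finTwoArrow ∘ f : X × X → X × X) = id :=
        funext MeasurableEquiv.finTwoArrow.apply_symm_apply
      rwa [h4, Measure.map_id] at h3
    · intro lam _ _ h1 h2 _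
      exact eq_prod_of_map_eq_dirac h1 h2

end Dirac

section MeasurableMeasures

variable {W X Y : Type*} [MeasurableSpace W] [MeasurableSpace X] [MeasurableSpace Y]

theorem measurable_measure_prod {f : W → Measure X} {g : W → Measure Y} (hf : Measurable f)
    (hg : Measurable g) (hf1 : ∀ w, IsProbabilityMeasure (f w))
    (hg1 : ∀ w, IsProbabilityMeasure (g w)) : Measurable fun w => (f w).prod (g w) := by
  let κ : Kernel W X := ⟨f, hf⟩
  let κ' : Kernel W Y := ⟨g, hg⟩
  have : IsMarkovKernel κ := ⟨hf1⟩
  have : IsMarkovKernel κ' := ⟨hg1⟩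
  have h : (fun w => (f w).prod (g w)) = fun w => (κ ×ₖ κ') w := by
    funext w
    rw [Kernel.prod_apply]
    rfl
  rw [h]
  exact (κ ×ₖ κ').measurable

theorem measurable_measure_pi {ι : Type*} [Fintype ι] {f : W → Measure X} (hf : Measurable f)
    (hf1 : ∀ w, IsProbabilityMeasure (f w)) :
    Measurable fun w => Measure.pi fun _ : ι => f w := by
  refine Measurable.measure_of_isPiSystem_of_isProbabilityMeasure generateFrom_pi.symm
    isPiSystem_pi ?_
  rintro _ ⟨s, hs, rfl⟩
  simp only [Measure.pi_pi]
  exact Finset.measurable_fun_prod _ fun i _ =>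
    (Measure.measurable_coe (hs i (mem_univ i))).comp hf

/-- The push-forward of a probability measure under a measurable map. -/
noncomputable def ProbabilityMeasure.mapOf {p : X → Y} (hp : Measurable p)
    (ν : ProbabilityMeasure X) : ProbabilityMeasure Y :=
  ⟨(ν : Measure X).map p, Measure.isProbabilityMeasure_map hp.aemeasurable⟩

theorem ProbabilityMeasure.measurable_coe_map {p : X → Y} (hp : Measurable p) :
    Measurable fun ν : ProbabilityMeasure X => (ν : Measure X).map p :=
  (Measure.measurable_map p hp).comp measurable_subtype_coe

theorem ProbabilityMeasure.measurable_mapOf {p : X → Y} (hp : Measurable p) :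
    Measurable (ProbabilityMeasure.mapOf hp) :=
  (ProbabilityMeasure.measurable_coe_map hp).subtype_mk

theorem ProbabilityMeasure.isProbabilityMeasure_coe_map {p : X → Y} (hp : Measurable p)
    (ν : ProbabilityMeasure X) : IsProbabilityMeasure ((ν : Measure X).map p) :=
  Measure.isProbabilityMeasure_map hp.aemeasurable

end MeasurableMeasures

section Goodness

variable {X : Type} [MetricSpace X] [CompactSpace X] [MeasurableSpace X] [BorelSpace X]
  {B : Type} [MeasurableSpace B] {P : Measure B} [IsProbabilityMeasure P]
  {mm : B → ProbabilityMeasure X} {T : X ≃ᵐ X}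

theorem exists_measurable_cover_null_of_forall_ne {Y : Type*} [MetricSpace Y] [CompactSpace Y]
    [MeasurableSpace Y] [BorelSpace Y] (hmm : Measurable mm) {N : Set B} (hN : P N = 0)
    {A : Set (ProbabilityMeasure Y)} (hA : MeasurableSet A)
    {G : ProbabilityMeasure Y → ProbabilityMeasure X} (hG : Measurable G)
    (h : ∀ b ∉ N, ∀ y ∈ A, G y ≠ mm b) :
    ∃ C, MeasurableSet C ∧ (∀ y ∈ A, G y ∈ C) ∧ P (mm ⁻¹' C) = 0 := by
  obtain ⟨e, he, hinj⟩ := ProbabilityMeasure.exists_injective_nat X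
  refine exists_measurable_cover_null he hinj hA hG P hmm fun S _ hS => ?_
  refine measure_mono_null (fun ω hω => ?_) hN
  by_contra hωN
  obtain ⟨y, hy, hyω⟩ := hS ω hω
  exact h ω hωN y hy hyω

theorem exists_measurable_cover_atoms (X : Type) [MeasurableSpace X] [StandardBorelSpace X] :
    ∃ C : Set (ProbabilityMeasure X), MeasurableSet C ∧ ∀ ν : ProbabilityMeasure X,
      ν ∉ C ↔ (∀ x, (ν : Measure X) {x} = 0) ∨ ∃ x, (ν : Measure X) = Measure.dirac x := by
  let f : ProbabilityMeasure X → ℝ≥0∞ := fun ν =>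
    ((ν : Measure X).prod (ν : Measure X)) (diagonal X)
  have hf : Measurable f := (Measure.measurable_coe measurableSet_diagonal).comp
    (measurable_measure_prod measurable_subtype_coe measurable_subtype_coe
      (fun ν => ν.2) fun ν => ν.2)
  have hpre : ∀ x : X, Prod.mk x ⁻¹' diagonal X = {x} := fun x => by
    ext y
    simp [eq_comm]
  have hfeq : ∀ ν : ProbabilityMeasure X, f ν = ∫⁻ x, (ν : Measure X) {x} ∂(ν : Measure X) := by
    intro ν
    simp only [f]
    rw [Measure.prod_apply measurableSet_diagonal]
    simp only [hpre]
  have hmeas : ∀ ν : ProbabilityMeasure X, Measurable fun x => (ν : Measure X) {x} := by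
    intro ν
    have := measurable_measure_prodMk_left (ν := (ν : Measure X))
      (measurableSet_diagonal (α := X))
    simpa only [hpre] using this
  refine ⟨{ν | f ν ≠ 0 ∧ f ν ≠ 1}, ?_, fun ν => ?_⟩
  · exact (hf (measurableSet_singleton 0).compl).inter (hf (measurableSet_singleton 1).compl)
  simp only [mem_ofPred_eq, not_and_or, not_not]
  refine or_congr ⟨fun h x => ?_, fun h => ?_⟩ ⟨fun h => ?_, ?_⟩
  · rw [hfeq, lintegral_eq_zero_iff (hmeas ν)] at h
    by_contra hx
    have h0 : (ν : Measure X) {x} = 0 := by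
      refine measure_mono_null (fun y hy => ?_) h
      rw [mem_singleton_iff.1 hy]
      exact hx
    exact hx h0
  · rw [hfeq]
    simp [h]
  · rw [hfeq] at h
    have h1 : ∫⁻ x, (1 - (ν : Measure X) {x}) ∂(ν : Measure X) = 0 := by
      rw [lintegral_sub (hmeas ν) (by rw [h]; exact ENNReal.one_ne_top)
        (ae_of_all _ fun x => prob_le_one), h]
      simp
    have hm : Measurable fun x => 1 - (ν : Measure X) {x} := measurable_const.sub (hmeas ν)
    rw [lintegral_eq_zero_iff hm] at h1
    obtain ⟨x, hx⟩ := h1.exists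
    refine ⟨x, Measure.eq_dirac_of_ae ?_⟩
    have hx1 : (ν : Measure X) {x} = 1 := le_antisymm prob_le_one (tsub_eq_zero_iff_le.1 hx)
    rw [← prob_compl_eq_zero_iff (measurableSet_singleton x)] at hx1
    exact hx1
  · rintro ⟨x, hx⟩
    simp [f, hx, Measure.dirac_prod_dirac]

theorem exists_measurable_cover_isGood (hmm : Measurable mm) {N : Set B} (hN : P N = 0)
    (hgood : ∀ b ∉ N, IsGood T (mm b : Measure X)) :
    ∃ C : Set (ProbabilityMeasure X), MeasurableSet C ∧ P (mm ⁻¹' C) = 0 ∧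
      ∀ ν ∉ C, Ergodic T (ν : Measure X) → IsGood T (ν : Measure X) := by
  obtain ⟨C₁, hC₁, hC₁'⟩ := exists_measurable_cover_atoms X
  have hcoe : ∀ {Y : Type} [MeasurableSpace Y],
      Measurable fun ν : ProbabilityMeasure Y => (ν : Measure Y) := by
    intro Y _
    exact measurable_subtype_coe
  have hpid : ∀ n : ℕ, ∃ C : Set (ProbabilityMeasure X), MeasurableSet C ∧
      (∀ y ∈ {lam : ProbabilityMeasure (Fin (n + 1) → X) |
        (lam : Measure (Fin (n + 1) → X)).map (fun x i => T (x i)) = lam ∧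
        (∀ i, (lam : Measure (Fin (n + 1) → X)).map (fun x => x i) =
          (lam : Measure (Fin (n + 1) → X)).map (fun x => x 0)) ∧
        (∀ i j, i ≠ j → (lam : Measure (Fin (n + 1) → X)).map (fun x => (x i, x j)) =
          ((lam : Measure (Fin (n + 1) → X)).map (fun x => x 0)).prod
            ((lam : Measure (Fin (n + 1) → X)).map (fun x => x 0))) ∧
        ¬ (lam : Measure (Fin (n + 1) → X)) =
          Measure.pi fun _ => (lam : Measure (Fin (n + 1) → X)).map (fun x => x 0)},
        ProbabilityMeasure.mapOf (measurable_pi_apply 0) y ∈ C) ∧ P (mm ⁻¹' C) = 0 := by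
    intro n
    have hev : ∀ i : Fin (n + 1), Measurable fun x : Fin (n + 1) → X => x i :=
      fun i => measurable_pi_apply i
    have hpr : ∀ i j : Fin (n + 1), Measurable fun x : Fin (n + 1) → X => (x i, x j) :=
      fun i j => (hev i).prodMk (hev j)
    refine exists_measurable_cover_null_of_forall_ne hmm hN ?_
      (ProbabilityMeasure.measurable_mapOf _) ?_
    · refine (measurableSet_measure_eq
        (ProbabilityMeasure.measurable_coe_map (measurable_piMap T.measurable)) hcoe
        (ProbabilityMeasure.isProbabilityMeasure_coe_map (measurable_piMap T.measurable))
        fun ν => ν.2).inter (MeasurableSet.inter ?_ (MeasurableSet.inter ?_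
          (MeasurableSet.compl ?_)))
      · have : {lam : ProbabilityMeasure (Fin (n + 1) → X) |
            ∀ i, (lam : Measure (Fin (n + 1) → X)).map (fun x => x i) =
            (lam : Measure (Fin (n + 1) → X)).map (fun x => x 0)} =
            ⋂ i, {lam : ProbabilityMeasure (Fin (n + 1) → X) |
              (lam : Measure (Fin (n + 1) → X)).map (fun x => x i) =
            (lam : Measure (Fin (n + 1) → X)).map (fun x => x 0)} := by
          ext; simp
        refine (congrArg MeasurableSet this).mpr ?_
        exact MeasurableSet.iInter fun i => measurableSet_measure_eq
          (ProbabilityMeasure.measurable_coe_map (hev i))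
          (ProbabilityMeasure.measurable_coe_map (hev 0))
          (ProbabilityMeasure.isProbabilityMeasure_coe_map (hev i))
          (ProbabilityMeasure.isProbabilityMeasure_coe_map (hev 0))
      · have : {lam : ProbabilityMeasure (Fin (n + 1) → X) | ∀ i j, i ≠ j →
            (lam : Measure (Fin (n + 1) → X)).map (fun x => (x i, x j)) =
            ((lam : Measure (Fin (n + 1) → X)).map (fun x => x 0)).prod
              ((lam : Measure (Fin (n + 1) → X)).map (fun x => x 0))} =
            ⋂ i, ⋂ j, ⋂ (_ : i ≠ j),
              {lam : ProbabilityMeasure (Fin (n + 1) → X) |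
                (lam : Measure (Fin (n + 1) → X)).map (fun x => (x i, x j)) =
            ((lam : Measure (Fin (n + 1) → X)).map (fun x => x 0)).prod
              ((lam : Measure (Fin (n + 1) → X)).map (fun x => x 0))} := by
          ext; simp
        refine (congrArg MeasurableSet this).mpr ?_
        exact MeasurableSet.iInter fun i => MeasurableSet.iInter fun j =>
          MeasurableSet.iInter fun _ => measurableSet_measure_eq
          (ProbabilityMeasure.measurable_coe_map (hpr i j))
          (measurable_measure_prod (ProbabilityMeasure.measurable_coe_map (hev 0))
            (ProbabilityMeasure.measurable_coe_map (hev 0))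
            (ProbabilityMeasure.isProbabilityMeasure_coe_map (hev 0))
            (ProbabilityMeasure.isProbabilityMeasure_coe_map (hev 0)))
          (ProbabilityMeasure.isProbabilityMeasure_coe_map (hpr i j))
          fun ν => by
            have := ProbabilityMeasure.isProbabilityMeasure_coe_map (hev 0) ν
            infer_instance
      · exact measurableSet_measure_eq hcoe
          (measurable_measure_pi (ProbabilityMeasure.measurable_coe_map (hev 0))
            (ProbabilityMeasure.isProbabilityMeasure_coe_map (hev 0)))
          (fun ν => ν.2) fun ν => by
            have := ProbabilityMeasure.isProbabilityMeasure_coe_map (hev 0) ν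
            infer_instance
    · rintro b hb lam ⟨h1, h2, h3, h4⟩ heq
      have h0 : (lam : Measure (Fin (n + 1) → X)).map (fun x => x 0) = mm b :=
        congrArg Subtype.val heq
      rw [h0] at h2 h3 h4
      exact h4 ((hgood b hb).hasPID _ (lam : Measure (Fin (n + 1) → X)) lam.2
          ⟨measurable_piMap T.measurable, h1⟩ h2 h3)
  have hoff : ∃ C : Set (ProbabilityMeasure X), MeasurableSet C ∧
      (∀ y ∈ {lam : ProbabilityMeasure (X × X) |
        (lam : Measure (X × X)).map (Prod.map T T) = lam ∧
        (lam : Measure (X × X)).map Prod.snd = (lam : Measure (X × X)).map Prod.fst ∧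
        (lam : Measure (X × X)) (orbitGraph T) = 0 ∧
        ¬ (lam : Measure (X × X)) = ((lam : Measure (X × X)).map Prod.fst).prod
          ((lam : Measure (X × X)).map Prod.fst)},
        ProbabilityMeasure.mapOf measurable_fst y ∈ C) ∧ P (mm ⁻¹' C) = 0 := by
    have hTT : Measurable (Prod.map T T) := T.measurable.prodMap T.measurable
    refine exists_measurable_cover_null_of_forall_ne hmm hN ?_
      (ProbabilityMeasure.measurable_mapOf _) ?_
    · refine (measurableSet_measure_eq
        (ProbabilityMeasure.measurable_coe_map hTT) hcoe
        (ProbabilityMeasure.isProbabilityMeasure_coe_map hTT)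
        fun ν => ν.2).inter (MeasurableSet.inter ?_ (MeasurableSet.inter ?_
          (MeasurableSet.compl ?_)))
      · exact measurableSet_measure_eq
          (ProbabilityMeasure.measurable_coe_map measurable_snd)
          (ProbabilityMeasure.measurable_coe_map measurable_fst)
          (ProbabilityMeasure.isProbabilityMeasure_coe_map measurable_snd)
          (ProbabilityMeasure.isProbabilityMeasure_coe_map measurable_fst)
      · exact (Measure.measurable_coe measurableSet_orbitGraph).comp hcoe
          (measurableSet_singleton 0)
      · exact measurableSet_measure_eq hcoe
          (measurable_measure_prod (ProbabilityMeasure.measurable_coe_map measurable_fst)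
            (ProbabilityMeasure.measurable_coe_map measurable_fst)
            (ProbabilityMeasure.isProbabilityMeasure_coe_map measurable_fst)
            (ProbabilityMeasure.isProbabilityMeasure_coe_map measurable_fst))
          (fun ν => ν.2) fun ν => by
            have := ProbabilityMeasure.isProbabilityMeasure_coe_map measurable_fst ν
            infer_instance
    · rintro b hb lam ⟨h1, h2, h3, h4⟩ heq
      have h0 : (lam : Measure (X × X)).map Prod.fst = mm b := congrArg Subtype.val heq
      rw [h0] at h2 h4
      exact h4 ((hgood b hb).eq_prod lam lam.2 ⟨hTT, h1⟩ h0 h2 h3)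
  choose C₂ hC₂ hC₂' hC₂0 using hpid
  obtain ⟨C₃, hC₃, hC₃', hC₃0⟩ := hoff
  refine ⟨C₁ ∪ (⋃ n, C₂ n) ∪ C₃, (hC₁.union (MeasurableSet.iUnion hC₂)).union hC₃, ?_, ?_⟩
  · rw [preimage_union, preimage_union, preimage_iUnion]
    refine measure_union_null (measure_union_null ?_ (measure_iUnion_null hC₂0)) hC₃0
    refine measure_mono_null (fun b hb => ?_) hN
    by_contra hbN
    exact (hC₁' (mm b)).2 (hgood b hbN).atoms hb
  · intro ν hν herg
    simp only [mem_union, mem_iUnion, not_or, not_exists] at hν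
    refine ⟨ν.2, herg, (hC₁' ν).1 hν.1.1, ?_, ?_⟩
    · intro n lam hlam hinv h1 h2
      rcases n with _ | n
      · exact eq_of_isEmpty_index lam _
      by_contra hne
      refine hν.1.2 n ?_
      have hν' : ν = ProbabilityMeasure.mapOf (measurable_pi_apply 0)
          (⟨lam, hlam⟩ : ProbabilityMeasure (Fin (n + 1) → X)) := Subtype.ext (h1 0).symm
      rw [hν']
      refine hC₂' n _ ⟨hinv.map_eq, fun i => (h1 i).trans (h1 0).symm, fun i j hij => ?_, ?_⟩
      · exact (h2 i j hij).trans (by rw [← h1 0]; rfl)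
      · intro h
        refine hne (h.trans ?_)
        rw [← h1 0]; rfl
    · intro lam hlam hinv h1 h2 h0
      by_contra hne
      refine hν.2 ?_
      have hν' : ν = ProbabilityMeasure.mapOf measurable_fst
          (⟨lam, hlam⟩ : ProbabilityMeasure (X × X)) := Subtype.ext h1.symm
      rw [hν']
      refine hC₃' _ ⟨hinv.map_eq, h2.trans h1.symm, h0, fun h => hne (h.trans ?_)⟩
      rw [← h1]; rfl

end Goodness

section Components

variable {X : Type} [MetricSpace X] [CompactSpace X] [MeasurableSpace X] [BorelSpace X]
  {B : Type} [MeasurableSpace B] {P : Measure B} [IsProbabilityMeasure P]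
  {mm : B → ProbabilityMeasure X} {T : X ≃ᵐ X}

theorem exists_measurable_cover_fibersDisjoint (hmm : Measurable mm) (hP : ∀ b, P {b} = 0)
    (hcount : ∀ b : B, Set.Countable
      {b' : B | ¬ FibersDisjoint T (mm b : Measure X) (mm b' : Measure X)}) :
    ∃ C : Set (ProbabilityMeasure X × ProbabilityMeasure X), MeasurableSet C ∧
      (P.prod P) (Prod.map mm mm ⁻¹' C) = 0 ∧
      ∀ q ∉ C, FibersDisjoint T (q.1 : Measure X) (q.2 : Measure X) := by
  have hTT : Measurable (Prod.map T T) := T.measurable.prodMap T.measurable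
  have hcoe : Measurable fun ν : ProbabilityMeasure (X × X) => (ν : Measure (X × X)) :=
    measurable_subtype_coe
  have : NullSingletonClass P := ⟨hP⟩
  obtain ⟨e, he, hinj⟩ := ProbabilityMeasure.exists_injective_nat X
  let A : Set (ProbabilityMeasure (X × X)) := {lam |
    (lam : Measure (X × X)).map (Prod.map T T) = lam ∧
    ¬ (lam : Measure (X × X)) = ((lam : Measure (X × X)).map Prod.fst).prod
      ((lam : Measure (X × X)).map Prod.snd)}
  have hA : MeasurableSet A := by
    refine (measurableSet_measure_eq
      (ProbabilityMeasure.measurable_coe_map hTT) hcoe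
      (ProbabilityMeasure.isProbabilityMeasure_coe_map hTT)
      fun ν => ν.2).inter (MeasurableSet.compl ?_)
    exact measurableSet_measure_eq hcoe
      (measurable_measure_prod (ProbabilityMeasure.measurable_coe_map measurable_fst)
        (ProbabilityMeasure.measurable_coe_map measurable_snd)
        (ProbabilityMeasure.isProbabilityMeasure_coe_map measurable_fst)
        (ProbabilityMeasure.isProbabilityMeasure_coe_map measurable_snd))
      (fun ν => ν.2) fun ν => by
        have := ProbabilityMeasure.isProbabilityMeasure_coe_map measurable_fst ν
        have := ProbabilityMeasure.isProbabilityMeasure_coe_map measurable_snd ν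
        infer_instance
  let g : ProbabilityMeasure (X × X) → ProbabilityMeasure X × ProbabilityMeasure X := fun lam =>
    (ProbabilityMeasure.mapOf measurable_fst lam, ProbabilityMeasure.mapOf measurable_snd lam)
  have hg : Measurable g := (ProbabilityMeasure.measurable_mapOf _).prodMk
    (ProbabilityMeasure.measurable_mapOf _)
  obtain ⟨C, hC, hC1, hC2⟩ := exists_measurable_cover_null (he.prodMap he)
    (hinj.prodMap hinj) hA hg (P.prod P) (hmm.prodMap hmm) (by
      intro S hS h
      rw [Measure.measure_prod_null hS]
      refine Eventually.of_forall fun b => ?_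
      refine ((hcount b).mono fun b' hb' => ?_).measure_zero P
      obtain ⟨lam, ⟨h1, h2⟩, h3⟩ := h (b, b') hb'
      have h4 : (lam : Measure (X × X)).map Prod.fst = mm b :=
        congrArg (fun q => (q.1 : Measure X)) h3
      have h5 : (lam : Measure (X × X)).map Prod.snd = mm b' :=
        congrArg (fun q => (q.2 : Measure X)) h3
      intro hd
      rw [h4, h5] at h2
      exact h2 (hd lam lam.2 ⟨hTT, h1⟩ h4 h5))
  refine ⟨C, hC, hC2, fun q hq lam hlam hinv h1 h2 => ?_⟩
  by_contra hne
  refine hq ?_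
  have hq' : q = g ⟨lam, hlam⟩ := Prod.ext (Subtype.ext h1.symm) (Subtype.ext h2.symm)
  rw [hq']
  refine hC1 _ ⟨hinv.map_eq, fun h => hne (h.trans ?_)⟩
  rw [← h1, ← h2]
  rfl

/-- The ergodic component of a point, as a probability measure. -/
noncomputable def ergodicLabel {Y : Type*} [MeasurableSpace Y] (K : Kernel Y Y)
    [IsMarkovKernel K] (y : Y) : ProbabilityMeasure Y :=
  ⟨K y, inferInstance⟩

theorem measurable_ergodicLabel {Y : Type*} [MeasurableSpace Y] (K : Kernel Y Y)
    [IsMarkovKernel K] : Measurable (ergodicLabel K) :=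
  K.measurable.subtype_mk

theorem IsErgodicKernel.map_ergodicLabel {Y : Type*} [MeasurableSpace Y] {S : Y → Y}
    {ν : Measure Y} {K : Kernel Y Y} [IsMarkovKernel K] (hK : IsErgodicKernel S ν K)
    {B : Type*} [MeasurableSpace B] {P : Measure B} {m : B → ProbabilityMeasure Y}
    (hm : Measurable m) (herg : ∀ b, Ergodic S (m b : Measure Y))
    (hν : ν = P.bind fun b => (m b : Measure Y)) :
    ν.map (ergodicLabel K) = P.map m := by
  have hm' : Measurable fun b => (m b : Measure Y) := measurable_subtype_coe.comp hm
  refine Measure.ext fun C hC => ?_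
  rw [Measure.map_apply (measurable_ergodicLabel K) hC, Measure.map_apply hm hC, hν,
    Measure.bind_apply (measurable_ergodicLabel K hC) hm'.aemeasurable,
    ← lintegral_indicator_one (hm hC)]
  refine lintegral_congr_ae ?_
  filter_upwards [hK.ae_ae_eq_of_bind hm' (fun b => (m b).2) herg hν] with b hb
  have hb' : ∀ᵐ y ∂(m b : Measure Y), ergodicLabel K y = m b := by
    filter_upwards [hb] with y hy
    exact Subtype.ext hy
  have hset : ergodicLabel K ⁻¹' C =ᵐ[(m b : Measure Y)] {_y : Y | m b ∈ C} := by
    refine eventuallyEq_set.2 ?_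
    filter_upwards [hb'] with y hy
    simp only [mem_preimage, hy]
  rw [measure_congr hset]
  by_cases h : m b ∈ C
  · have : {_y : Y | m b ∈ C} = univ := by ext; simp [h]
    rw [this, indicator_of_mem (show b ∈ m ⁻¹' C from h)]
    simp
  · have : {_y : Y | m b ∈ C} = ∅ := by ext; simp [h]
    rw [this, indicator_of_notMem (show b ∉ m ⁻¹' C from h)]
    simp

end Components

section RelativeIndependence

theorem map_prodMap_eq_prod_of_invariant {Y Y' U V : Type*} [MeasurableSpace Y]
    [MeasurableSpace Y'] [MeasurableSpace U] [MeasurableSpace V] {S : Y → Y} {S' : Y' → Y'}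
    {η : Measure Y} {η' : Measure Y'} [IsProbabilityMeasure η] [IsProbabilityMeasure η']
    {θ : Measure (Y × Y')}
    (h : ∀ C C', MeasurableSet C → MeasurableSet C' → S ⁻¹' C = C → S' ⁻¹' C' = C' →
      θ (C ×ˢ C') = η C * η' C')
    {u : Y → U} {v : Y' → V} (hu : Measurable u) (hv : Measurable v) (hu' : ∀ y, u (S y) = u y)
    (hv' : ∀ y, v (S' y) = v y) : θ.map (Prod.map u v) = (η.map u).prod (η'.map v) := by
  have := Measure.isProbabilityMeasure_map (μ := η) hu.aemeasurable
  have := Measure.isProbabilityMeasure_map (μ := η') hv.aemeasurable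
  refine (Measure.prod_eq fun s t hs ht => ?_).symm
  rw [Measure.map_apply (hu.prodMap hv) (hs.prod ht), Measure.map_apply hu hs,
    Measure.map_apply hv ht]
  refine h _ _ (hu hs) (hv ht) ?_ ?_
  · ext y; simp [hu']
  · ext y; simp [hv']

variable {X : Type} [MeasurableSpace X] [StandardBorelSpace X] {T : X ≃ᵐ X} {μ : Measure X}

theorem eq_prod_of_independent_invariant {K : Kernel X X} [IsMarkovKernel K]
    (hK : IsErgodicKernel T μ K) (hgood : ∀ᵐ x ∂μ, IsGood T (K x))
    {C : Set (ProbabilityMeasure X × ProbabilityMeasure X)}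
    (hC0 : ((μ.map (ergodicLabel K)).prod (μ.map (ergodicLabel K))) C = 0)
    (hdisj : ∀ q ∉ C, FibersDisjoint T (q.1 : Measure X) (q.2 : Measure X)) {n : ℕ}
    {η : Measure (Fin n → X)} [IsProbabilityMeasure η]
    (hη : MeasurePreserving (fun x i => T (x i)) η η) (hη1 : ∀ i, η.map (fun x => x i) = μ)
    {θ : Measure ((Fin n → X) × (Fin n → X))} [IsProbabilityMeasure θ]
    (hθ : MeasurePreserving (Prod.map (fun (x : Fin n → X) i => T (x i)) fun x i => T (x i)) θ θ)
    (hθ1 : θ.map Prod.fst = η) (hθ2 : θ.map Prod.snd = η)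
    (h : ∀ C C' : Set (Fin n → X), MeasurableSet C → MeasurableSet C' →
      (fun x i => T (x i)) ⁻¹' C = C → (fun x i => T (x i)) ⁻¹' C' = C' →
      θ (C ×ˢ C') = η C * η C') : θ = η.prod η := by
  have hTn : Measurable fun (x : Fin n → X) i => T (x i) := measurable_piMap T.measurable
  have hev : ∀ i : Fin n, Measurable fun x : Fin n → X => x i := fun i => measurable_pi_apply i
  obtain ⟨Ξ, hΞ⟩ := exists_isErgodicKernel hθ
  obtain ⟨L, hL⟩ := exists_isErgodicKernel hη
  have hLm := hL.isMarkovKernel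
  have hΞm := hΞ.isMarkovKernel
  have hfst : ∀ i, θ.map (fun q => q.1 i) = μ := fun i => by
    rw [← hη1 i, ← hθ1, Measure.map_map (hev i) measurable_fst]; rfl
  have hsnd : ∀ i, θ.map (fun q => q.2 i) = μ := fun i => by
    rw [← hη1 i, ← hθ2, Measure.map_map (hev i) measurable_snd]; rfl
  have hfm : ∀ i, Measurable fun q : (Fin n → X) × (Fin n → X) => q.1 i := fun i =>
    (hev i).comp measurable_fst
  have hsm : ∀ i, Measurable fun q : (Fin n → X) × (Fin n → X) => q.2 i := fun i =>
    (hev i).comp measurable_snd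
  have e1 : ∀ i, ∀ᵐ ω ∂θ, (Ξ ω).map (fun q => q.1 i) = K (ω.1 i) := fun i =>
    hK.ae_map_eq hΞ T.measurable (hfm i) (fun _ => rfl) (hfst i)
  have e2 : ∀ i, ∀ᵐ ω ∂θ, (Ξ ω).map (fun q => q.2 i) = K (ω.2 i) := fun i =>
    hK.ae_map_eq hΞ T.measurable (hsm i) (fun _ => rfl) (hsnd i)
  have g1 : ∀ i, ∀ᵐ ω ∂θ, IsGood T (K (ω.1 i)) := fun i => by
    rw [← hfst i] at hgood
    exact ae_of_ae_map (hfm i).aemeasurable hgood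
  have g2 : ∀ i, ∀ᵐ ω ∂θ, IsGood T (K (ω.2 i)) := fun i => by
    rw [← hsnd i] at hgood
    exact ae_of_ae_map (hsm i).aemeasurable hgood
  have d : ∀ i j, ∀ᵐ ω ∂θ, FibersDisjoint T (K (ω.1 i)) (K (ω.2 j)) := by
    intro i j
    have hl := measurable_ergodicLabel K
    have hmap := map_prodMap_eq_prod_of_invariant h (hl.comp (hev i)) (hl.comp (hev j))
      (fun y => Subtype.ext (hK.comp_map (y i))) (fun y => Subtype.ext (hK.comp_map (y j)))
    rw [← Measure.map_map hl (hev i), ← Measure.map_map hl (hev j), hη1, hη1] at hmap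
    have h0 : ∀ᵐ q ∂θ.map (Prod.map (ergodicLabel K ∘ fun x : Fin n → X => x i)
        (ergodicLabel K ∘ fun x : Fin n → X => x j)), q ∉ C := by
      rw [hmap]
      exact measure_eq_zero_iff_ae_notMem.1 hC0
    filter_upwards [ae_of_ae_map
      ((hl.comp (hev i)).prodMap (hl.comp (hev j))).aemeasurable h0] with ω hω
    exact hdisj _ hω
  have l1 : ∀ᵐ ω ∂θ, (Ξ ω).map Prod.fst = L ω.1 :=
    hL.ae_map_eq hΞ hTn measurable_fst (fun _ => rfl) hθ1
  have l2 : ∀ᵐ ω ∂θ, (Ξ ω).map Prod.snd = L ω.2 :=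
    hL.ae_map_eq hΞ hTn measurable_snd (fun _ => rfl) hθ2
  have key : ∀ᵐ ω ∂θ, Ξ ω = (L ω.1).prod (L ω.2) := by
    filter_upwards [ae_all_iff.2 e1, ae_all_iff.2 e2, ae_all_iff.2 g1, ae_all_iff.2 g2,
      ae_all_iff.2 fun i => ae_all_iff.2 (d i), l1, l2, hΞ.ae_ergodic] with
      ω h1 h2 h3 h4 h5 h6 h7 h8
    rw [← h6, ← h7]
    refine eq_fst_prod_snd_of_isGood h3 h4 h8 h1 h2 fun i j => ?_
    have hij : Measurable fun q : (Fin n → X) × (Fin n → X) => (q.1 i, q.2 j) :=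
      (hfm i).prodMk (hsm j)
    refine h5 i j _ (Measure.isProbabilityMeasure_map hij.aemeasurable) ?_ ?_ ?_
    · exact MeasurePreserving.of_semiconj (hij.measurePreserving _) h8.toMeasurePreserving
        (fun _ => rfl) (T.measurable.prodMap T.measurable)
    · rw [Measure.map_map measurable_fst hij]
      exact h1 i
    · rw [Measure.map_map measurable_snd hij]
      exact h2 j
  refine (Measure.prod_eq fun s t hs ht => ?_).symm
  have hu : Measurable fun x => L x s := L.measurable_coe hs
  have hv : Measurable fun x => L x t := L.measurable_coe ht
  have hmap := map_prodMap_eq_prod_of_invariant h hu hv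
    (fun y => by rw [hL.comp_map y]) (fun y => by rw [hL.comp_map y])
  have hintegral : ∀ s, MeasurableSet s → ∫⁻ x, L x s ∂η = η s := fun s hs => by
    conv_rhs => rw [← hL.bind_eq]
    rw [Measure.bind_apply hs L.aemeasurable]
  have := Measure.isProbabilityMeasure_map (μ := η) hu.aemeasurable
  have := Measure.isProbabilityMeasure_map (μ := η) hv.aemeasurable
  calc θ (s ×ˢ t) = ∫⁻ ω, Ξ ω (s ×ˢ t) ∂θ := by
        conv_lhs => rw [← hΞ.bind_eq]
        rw [Measure.bind_apply (hs.prod ht) Ξ.aemeasurable]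
    _ = ∫⁻ ω, L ω.1 s * L ω.2 t ∂θ := by
        refine lintegral_congr_ae ?_
        filter_upwards [key] with ω hω
        rw [hω, Measure.prod_prod]
    _ = ∫⁻ p, p.1 * p.2 ∂θ.map (Prod.map (fun x => L x s) fun x => L x t) := by
        have hm : Measurable fun p : ℝ≥0∞ × ℝ≥0∞ => p.1 * p.2 := measurable_fst.mul measurable_snd
        rw [lintegral_map hm (hu.prodMap hv)]
        rfl
    _ = (∫⁻ a, a ∂η.map fun x => L x s) * ∫⁻ a, a ∂η.map fun x => L x t := by
        rw [hmap]
        exact lintegral_prod_mul measurable_id.aemeasurable measurable_id.aemeasurable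
    _ = η s * η t := by
        have hm : Measurable fun a : ℝ≥0∞ => a := measurable_id
        rw [lintegral_map hm hu, lintegral_map hm hv, hintegral s hs, hintegral t ht]

end RelativeIndependence

section Fibers

variable {Y Z : Type} [MeasurableSpace Y] [MeasurableSpace Z]
  {ρ : Measure Z} {κ : Kernel Z Y}

theorem measurable_integral_kernel {f : Y → ℝ} (hf : Measurable f) :
    Measurable fun z => ∫ y, f y ∂(κ z) :=
  (StronglyMeasurable.integral_kernel hf.stronglyMeasurable).measurable

theorem integral_comp_measure [IsFiniteMeasure ρ] [IsFiniteKernel κ] {g : Y → ℝ}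
    (hg : Integrable g (κ ∘ₘ ρ)) :
    ∫ y, g y ∂(κ ∘ₘ ρ) = ∫ z, ∫ y, g y ∂(κ z) ∂ρ := by
  have hs : κ ∘ₘ ρ = (ρ ⊗ₘ κ).map Prod.snd := (Measure.snd_compProd ρ κ).symm
  rw [hs] at hg ⊢
  rw [integral_map measurable_snd.aemeasurable hg.1]
  exact Measure.integral_compProd (hg.comp_measurable measurable_snd)

variable [IsProbabilityMeasure ρ] [IsMarkovKernel κ]

theorem integrable_of_abs_le {μ : Measure Y} [IsFiniteMeasure μ] {f : Y → ℝ} {M : ℝ}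
    (hf : Measurable f) (hM : ∀ y, |f y| ≤ M) : Integrable f μ :=
  Integrable.of_bound hf.aestronglyMeasurable M (ae_of_all _ hM)

theorem abs_integral_kernel_le {f : Y → ℝ} {M : ℝ} (hM : ∀ y, |f y| ≤ M) (z : Z) :
    |∫ y, f y ∂(κ z)| ≤ M := by
  have := norm_integral_le_of_norm_le_const (μ := κ z) (f := f) (C := M) (ae_of_all _ hM)
  simpa using this

theorem abs_mul_le_mul_of_abs_le {a b M N : ℝ} (ha : |a| ≤ M) (hb : |b| ≤ N) :
    |a * b| ≤ M * N := by
  rw [abs_mul]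
  exact mul_le_mul ha hb (abs_nonneg _) ((abs_nonneg _).trans ha)

/-- Fibrewise means lose `L²` mass only backwards in time. -/
theorem integral_sq_integral_kernel_le {R : Z → Z} {S : Y → Y} (hR : MeasurePreserving R ρ ρ)
    (hinv : MeasurePreserving (Prod.map R S) (ρ ⊗ₘ κ) (ρ ⊗ₘ κ)) (hS : Measurable S)
    {f : Y → ℝ} {M : ℝ} (hf : Measurable f) (hM : ∀ y, |f y| ≤ M) :
    ∫ z, (∫ y, f y ∂(κ z)) ^ 2 ∂ρ ≤ ∫ z, (∫ y, f (S y) ∂(κ z)) ^ 2 ∂ρ := by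
  set J : Z → ℝ := fun z => ∫ y, f y ∂(κ z) with hJ
  set a : Z → ℝ := fun z => ∫ y, f (S y) ∂(κ z) with ha
  have hJm : Measurable J := measurable_integral_kernel hf
  have ham : Measurable a := measurable_integral_kernel (hf.comp hS)
  have hJb : ∀ z, |J z| ≤ M := abs_integral_kernel_le hM
  have hab : ∀ z, |a z| ≤ M := abs_integral_kernel_le fun y => hM (S y)
  have hbm : Measurable fun z => J (R z) := hJm.comp hR.measurable
  have hprod : ∀ {u v : Z → ℝ}, Measurable u → Measurable v → (∀ z, |u z| ≤ M) →
      (∀ z, |v z| ≤ M) → Integrable (fun z => u z * v z) ρ := fun hu hv hu' hv' =>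
    integrable_of_abs_le (hu.mul hv) fun z => abs_mul_le_mul_of_abs_le (hu' z) (hv' z)
  have hFm : Measurable fun w : Z × Y => J w.1 * f w.2 :=
    (hJm.comp measurable_fst).mul (hf.comp measurable_snd)
  have hFi : Integrable (fun w : Z × Y => J w.1 * f w.2) (ρ ⊗ₘ κ) :=
    integrable_of_abs_le hFm fun w => abs_mul_le_mul_of_abs_le (hJb w.1) (hM w.2)
  have e1 : ∫ w, J w.1 * f w.2 ∂(ρ ⊗ₘ κ) = ∫ z, J z * J z ∂ρ := by
    rw [Measure.integral_compProd hFi]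
    exact integral_congr_ae (ae_of_all _ fun z => integral_const_mul (J z) f)
  have e2 : ∫ w, J w.1 * f w.2 ∂(ρ ⊗ₘ κ) = ∫ z, J (R z) * a z ∂ρ := by
    conv_lhs => rw [← hinv.map_eq]
    rw [integral_map hinv.measurable.aemeasurable hFm.aestronglyMeasurable]
    refine (Measure.integral_compProd (hinv.integrable_comp_of_integrable hFi)).trans ?_
    exact integral_congr_ae (ae_of_all _ fun z =>
      integral_const_mul (J (R z)) fun y => f (S y))
  have e3 : ∫ z, J (R z) * J (R z) ∂ρ = ∫ z, J z * J z ∂ρ := by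
    have hJJ : Measurable fun z => J z * J z := hJm.mul hJm
    conv_rhs => rw [← hR.map_eq]
    rw [integral_map hR.measurable.aemeasurable hJJ.aestronglyMeasurable]
  have hpos : 0 ≤ ∫ z, (a z - J (R z)) ^ 2 ∂ρ := integral_nonneg fun z => sq_nonneg _
  have hexp : ∫ z, (a z - J (R z)) ^ 2 ∂ρ
      = ∫ z, a z * a z ∂ρ - 2 * ∫ z, J (R z) * a z ∂ρ + ∫ z, J (R z) * J (R z) ∂ρ := by
    have i1 := hprod ham ham hab hab
    have i2 := hprod hbm ham (fun z => hJb (R z)) hab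
    have i3 := hprod hbm hbm (fun z => hJb (R z)) (fun z => hJb (R z))
    have i4 : Integrable (fun z => a z * a z - 2 * (J (R z) * a z)) ρ := i1.sub (i2.const_mul 2)
    rw [← integral_const_mul, ← integral_sub i1 (i2.const_mul 2), ← integral_add i4 i3]
    exact integral_congr_ae (ae_of_all _ fun z => by ring)
  simp only [sq]
  rw [hexp] at hpos
  linarith

/-- In a joining with an ergodic system, invariant sets have constant fibre measure. -/
theorem ae_kernel_eq_of_preimage_eq {R : Z → Z} {S : Y → Y} (hR : Ergodic R ρ)
    (hinv : MeasurePreserving (Prod.map R S) (ρ ⊗ₘ κ) (ρ ⊗ₘ κ)) {C : Set Y}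
    (hC : MeasurableSet C) (hSC : S ⁻¹' C = C) :
    ∀ᵐ z ∂ρ, κ z C = (κ ∘ₘ ρ) C := by
  set σ : Measure Z := ((ρ ⊗ₘ κ).restrict (Prod.snd ⁻¹' C)).map Prod.fst with hσ
  have hCm : MeasurableSet (Prod.snd ⁻¹' C : Set (Z × Y)) := measurable_snd hC
  have hσD : ∀ D, MeasurableSet D → σ D = ∫⁻ z in D, κ z C ∂ρ := fun D hD => by
    rw [hσ, Measure.map_apply measurable_fst hD,
      Measure.restrict_apply (measurable_fst hD)]
    have : (Prod.fst ⁻¹' D ∩ Prod.snd ⁻¹' C : Set (Z × Y)) = D ×ˢ C := rfl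
    rw [this, Measure.compProd_apply_prod hD hC]
  have hσinv : MeasurePreserving R σ σ := by
    refine ⟨hR.measurable, ?_⟩
    have hr : MeasurePreserving (Prod.map R S) ((ρ ⊗ₘ κ).restrict (Prod.snd ⁻¹' C))
        ((ρ ⊗ₘ κ).restrict (Prod.snd ⁻¹' C)) := by
      have h := hinv.restrict_preimage hCm
      have hset : Prod.map R S ⁻¹' (Prod.snd ⁻¹' C) = Prod.snd ⁻¹' C := by
        ext w
        exact Set.ext_iff.1 hSC w.2
      rwa [hset] at h
    calc σ.map R = ((ρ ⊗ₘ κ).restrict (Prod.snd ⁻¹' C)).map (R ∘ Prod.fst) :=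
          Measure.map_map hR.measurable measurable_fst
      _ = (((ρ ⊗ₘ κ).restrict (Prod.snd ⁻¹' C)).map (Prod.map R S)).map Prod.fst :=
          (Measure.map_map measurable_fst hr.measurable).symm
      _ = σ := by rw [hr.map_eq]
  have hac : σ ≪ ρ := Measure.AbsolutelyContinuous.mk fun D hD h0 => by
    rw [hσD D hD, Measure.restrict_eq_zero.2 h0, lintegral_zero_measure]
  obtain ⟨c, hc⟩ := hR.eq_smul_of_absolutelyContinuous hσinv hac
  have hcC : c = (κ ∘ₘ ρ) C := by
    have h := hσD univ .univ
    rw [hc, Measure.restrict_univ] at h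
    rw [Measure.bind_apply hC κ.aemeasurable, ← h]
    simp
  refine ae_eq_of_forall_setLIntegral_eq_of_sigmaFinite (κ.measurable_coe hC)
    measurable_const fun D hD _ => ?_
  rw [← hσD D hD, hc, ← hcC]
  simp

end Fibers

theorem iterate_preimage_of_preimage_eq {Y : Type*} {S : Y → Y} {C : Set Y} (hC : S ⁻¹' C = C)
    (k : ℕ) :
    S^[k] ⁻¹' C = C :=
  (congrFun preimage_iterate_eq C).trans (Function.iterate_fixed hC k)

section FiberSquares

variable {Y Z : Type} [MeasurableSpace Y] [MeasurableSpace Z]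
  {ρ : Measure Z} {κ : Kernel Z Y} [IsMarkovKernel κ] {S : Y → Y}

/-- The relatively independent self-joining over `ρ` of the `k`-th push-forward of `κ`. -/
noncomputable def fiberSquare (ρ : Measure Z) (κ : Kernel Z Y) (S : Y → Y) (k : ℕ) :
    Measure (Y × Y) :=
  (κ.map S^[k] ×ₖ κ.map S^[k]) ∘ₘ ρ

theorem fiberSquare_prod (hS : Measurable S) (k : ℕ) {C C' : Set Y} (hC : MeasurableSet C)
    (hC' : MeasurableSet C') :
    fiberSquare ρ κ S k (C ×ˢ C') = ∫⁻ z, κ z (S^[k] ⁻¹' C) * κ z (S^[k] ⁻¹' C') ∂ρ := by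
  have := Kernel.IsMarkovKernel.map κ (hS.iterate k)
  rw [fiberSquare, Measure.bind_apply (hC.prod hC') (Kernel.aemeasurable _)]
  refine lintegral_congr fun z => ?_
  rw [Kernel.prod_apply, Measure.prod_prod, Kernel.map_apply' _ (hS.iterate k) _ hC,
    Kernel.map_apply' _ (hS.iterate k) _ hC']

variable [IsProbabilityMeasure ρ]

theorem isProbabilityMeasure_fiberSquare (hS : Measurable S) (k : ℕ) :
    IsProbabilityMeasure (fiberSquare ρ κ S k) := by
  have := Kernel.IsMarkovKernel.map κ (hS.iterate k)
  unfold fiberSquare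
  infer_instance

theorem integral_fiberSquare (hS : Measurable S) (k : ℕ) {f g : Y → ℝ} {M N : ℝ}
    (hf : Measurable f) (hg : Measurable g) (hM : ∀ y, |f y| ≤ M) (hN : ∀ y, |g y| ≤ N) :
    ∫ p, f p.1 * g p.2 ∂(fiberSquare ρ κ S k)
      = ∫ z, (∫ y, f (S^[k] y) ∂(κ z)) * ∫ y, g (S^[k] y) ∂(κ z) ∂ρ := by
  have := Kernel.IsMarkovKernel.map κ (hS.iterate k)
  have hm : Measurable fun p : Y × Y => f p.1 * g p.2 :=
    (hf.comp measurable_fst).mul (hg.comp measurable_snd)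
  rw [fiberSquare, integral_comp_measure
    (integrable_of_abs_le hm fun p => abs_mul_le_mul_of_abs_le (hM p.1) (hN p.2))]
  refine integral_congr_ae (ae_of_all _ fun z => ?_)
  simp only
  rw [Kernel.prod_apply, integral_prod_mul, Kernel.map_apply _ (hS.iterate k),
    integral_map (hS.iterate k).aemeasurable hf.aestronglyMeasurable,
    integral_map (hS.iterate k).aemeasurable hg.aestronglyMeasurable]

theorem integral_fst_fiberSquare (hS : MeasurePreserving S (κ ∘ₘ ρ) (κ ∘ₘ ρ)) (k : ℕ) {f : Y → ℝ}
    {M : ℝ} (hf : Measurable f) (hM : ∀ y, |f y| ≤ M) :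
    ∫ p, f p.1 ∂(fiberSquare ρ κ S k) = ∫ y, f y ∂(κ ∘ₘ ρ) := by
  have h := integral_fiberSquare (ρ := ρ) (κ := κ) hS.measurable k hf
    (measurable_const (a := (1 : ℝ))) hM (N := 1) (by simp)
  simp only [mul_one, integral_const, probReal_univ, smul_eq_mul] at h
  have hk := hS.iterate k
  rw [h, ← integral_comp_measure (g := fun y => f (S^[k] y))
    (integrable_of_abs_le (hf.comp hk.measurable) fun y => hM (S^[k] y)),
    ← integral_map hk.measurable.aemeasurable hf.aestronglyMeasurable,
    hk.map_eq]

theorem integral_snd_fiberSquare (hS : MeasurePreserving S (κ ∘ₘ ρ) (κ ∘ₘ ρ)) (k : ℕ) {f : Y → ℝ}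
    {M : ℝ} (hf : Measurable f) (hM : ∀ y, |f y| ≤ M) :
    ∫ p, f p.2 ∂(fiberSquare ρ κ S k) = ∫ y, f y ∂(κ ∘ₘ ρ) := by
  have h := integral_fiberSquare (ρ := ρ) (κ := κ) hS.measurable k
    (measurable_const (a := (1 : ℝ))) hf (M := 1) (by simp) hM
  simp only [one_mul, integral_const, probReal_univ, smul_eq_mul] at h
  have hk := hS.iterate k
  rw [h, ← integral_comp_measure (g := fun y => f (S^[k] y))
    (integrable_of_abs_le (hf.comp hk.measurable) fun y => hM (S^[k] y)),
    ← integral_map hk.measurable.aemeasurable hf.aestronglyMeasurable,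
    hk.map_eq]

theorem fiberSquare_prod_of_preimage_eq {R : Z → Z} (hR : Ergodic R ρ)
    (hinv : MeasurePreserving (Prod.map R S) (ρ ⊗ₘ κ) (ρ ⊗ₘ κ)) (hS : Measurable S) (k : ℕ)
    {C C' : Set Y} (hC : MeasurableSet C) (hC' : MeasurableSet C') (hSC : S ⁻¹' C = C)
    (hSC' : S ⁻¹' C' = C') :
    fiberSquare ρ κ S k (C ×ˢ C') = (κ ∘ₘ ρ) C * (κ ∘ₘ ρ) C' := by
  rw [fiberSquare_prod hS k hC hC', iterate_preimage_of_preimage_eq hSC,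
    iterate_preimage_of_preimage_eq hSC']
  have h : ∀ᵐ z ∂ρ, κ z C * κ z C' = (κ ∘ₘ ρ) C * (κ ∘ₘ ρ) C' := by
    filter_upwards [ae_kernel_eq_of_preimage_eq hR hinv hC hSC,
      ae_kernel_eq_of_preimage_eq hR hinv hC' hSC'] with z h1 h2
    rw [h1, h2]
  rw [lintegral_congr_ae h, lintegral_const, measure_univ, mul_one]

theorem monotone_integral_fiberSquare {R : Z → Z} (hR : MeasurePreserving R ρ ρ)
    (hinv : MeasurePreserving (Prod.map R S) (ρ ⊗ₘ κ) (ρ ⊗ₘ κ)) (hS : Measurable S)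
    {f : Y → ℝ} {M : ℝ} (hf : Measurable f) (hM : ∀ y, |f y| ≤ M) :
    Monotone fun k => ∫ p, f p.1 * f p.2 ∂(fiberSquare ρ κ S k) := by
  refine monotone_nat_of_le_succ fun k => ?_
  rw [integral_fiberSquare hS k hf hf hM hM, integral_fiberSquare hS (k + 1) hf hf hM hM]
  have h := integral_sq_integral_kernel_le hR hinv hS (f := fun y => f (S^[k] y))
    (hf.comp (hS.iterate k)) fun y => hM _
  simpa only [sq, Function.iterate_succ_apply] using h

theorem exists_tendsto_integral_sq_fiberSquare {R : Z → Z} (hR : MeasurePreserving R ρ ρ)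
    (hinv : MeasurePreserving (Prod.map R S) (ρ ⊗ₘ κ) (ρ ⊗ₘ κ)) (hS : Measurable S)
    {f : Y → ℝ} {M : ℝ} (hf : Measurable f) (hM : ∀ y, |f y| ≤ M) :
    ∃ L, Tendsto (fun k => ∫ p, f p.1 * f p.2 ∂(fiberSquare ρ κ S k)) atTop (𝓝 L) := by
  refine ⟨_, tendsto_atTop_ciSup (monotone_integral_fiberSquare hR hinv hS hf hM) ⟨M * M, ?_⟩⟩
  rintro _ ⟨k, rfl⟩
  have := isProbabilityMeasure_fiberSquare (ρ := ρ) (κ := κ) hS k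
  have h := norm_integral_le_of_norm_le_const (μ := fiberSquare ρ κ S k)
    (f := fun p => f p.1 * f p.2) (C := M * M)
    (ae_of_all _ fun p => abs_mul_le_mul_of_abs_le (hM p.1) (hM p.2))
  simp only [probReal_univ, mul_one] at h
  exact (le_abs_self _).trans h

theorem exists_tendsto_integral_fiberSquare {R : Z → Z} (hR : MeasurePreserving R ρ ρ)
    (hinv : MeasurePreserving (Prod.map R S) (ρ ⊗ₘ κ) (ρ ⊗ₘ κ)) (hS : Measurable S)
    {f g : Y → ℝ} {M N : ℝ} (hf : Measurable f) (hg : Measurable g) (hM : ∀ y, |f y| ≤ M)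
    (hN : ∀ y, |g y| ≤ N) :
    ∃ L, Tendsto (fun k => ∫ p, f p.1 * g p.2 ∂(fiberSquare ρ κ S k)) atTop (𝓝 L) := by
  have hpb : ∀ y, |f y + g y| ≤ M + N := fun y =>
    (abs_add_le _ _).trans (add_le_add (hM y) (hN y))
  have hsb : ∀ y, |f y - g y| ≤ M + N := fun y =>
    (abs_sub _ _).trans (add_le_add (hM y) (hN y))
  obtain ⟨L₁, h₁⟩ := exists_tendsto_integral_sq_fiberSquare hR hinv hS (hf.add hg) hpb
  obtain ⟨L₂, h₂⟩ := exists_tendsto_integral_sq_fiberSquare hR hinv hS (hf.sub hg) hsb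
  refine ⟨4⁻¹ * (L₁ - L₂), ((h₁.sub h₂).const_mul 4⁻¹).congr fun k => ?_⟩
  have hk := hS.iterate k
  rw [integral_fiberSquare hS k hf hg hM hN,
    integral_fiberSquare hS k (hf.add hg) (hf.add hg) hpb hpb,
    integral_fiberSquare hS k (hf.sub hg) (hf.sub hg) hsb hsb]
  have hfm : Measurable fun y => f (S^[k] y) := hf.comp hk
  have hgm : Measurable fun y => g (S^[k] y) := hg.comp hk
  have hfi : ∀ z, Integrable (fun y => f (S^[k] y)) (κ z) := fun z =>
    integrable_of_abs_le hfm fun y => hM _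
  have hgi : ∀ z, Integrable (fun y => g (S^[k] y)) (κ z) := fun z =>
    integrable_of_abs_le hgm fun y => hN _
  simp only [Pi.add_apply, Pi.sub_apply, integral_add (hfi _) (hgi _),
    integral_sub (hfi _) (hgi _)]
  set u : Z → ℝ := fun z => ∫ y, f (S^[k] y) ∂(κ z)
  set v : Z → ℝ := fun z => ∫ y, g (S^[k] y) ∂(κ z)
  have hum : Measurable u := measurable_integral_kernel hfm
  have hvm : Measurable v := measurable_integral_kernel hgm
  have hub : ∀ z, |u z| ≤ M := abs_integral_kernel_le fun y => hM _
  have hvb : ∀ z, |v z| ≤ N := abs_integral_kernel_le fun y => hN _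
  have hp : ∀ z, |u z + v z| ≤ M + N := fun z =>
    (abs_add_le _ _).trans (add_le_add (hub z) (hvb z))
  have hs : ∀ z, |u z - v z| ≤ M + N := fun z =>
    (abs_sub _ _).trans (add_le_add (hub z) (hvb z))
  have i1 : Integrable (fun z => (u z + v z) * (u z + v z)) ρ :=
    integrable_of_abs_le ((hum.add hvm).mul (hum.add hvm))
      fun z => abs_mul_le_mul_of_abs_le (hp z) (hp z)
  have i2 : Integrable (fun z => (u z - v z) * (u z - v z)) ρ :=
    integrable_of_abs_le ((hum.sub hvm).mul (hum.sub hvm))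
      fun z => abs_mul_le_mul_of_abs_le (hs z) (hs z)
  rw [← integral_sub i1 i2, ← integral_const_mul]
  exact integral_congr_ae (ae_of_all _ fun z => by ring)

end FiberSquares

section LimitJoining

/-- A limit of couplings of `η` with itself for which `C` and `C'` are independent gives `C ×ˢ C'`
at least the product mass. -/
theorem mul_le_measure_prod_of_tendsto {Y : Type} [MetricSpace Y] [CompactSpace Y]
    [MeasurableSpace Y] [BorelSpace Y] {η : Measure Y} [IsProbabilityMeasure η]
    {θs : ℕ → ProbabilityMeasure (Y × Y)} {θ : ProbabilityMeasure (Y × Y)}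
    (hlim : Tendsto θs atTop (𝓝 θ)) {C C' : Set Y} (hC : MeasurableSet C) (hC' : MeasurableSet C')
    (h1 : ∀ k, (θs k : Measure (Y × Y)).map Prod.fst = η)
    (h2 : ∀ k, (θs k : Measure (Y × Y)).map Prod.snd = η)
    (hind : ∀ k, (θs k : Measure (Y × Y)) (C ×ˢ C') = η C * η C') :
    η C * η C' ≤ (θ : Measure (Y × Y)) (C ×ˢ C') := by
  refine ENNReal.le_of_forall_pos_le_add fun ε hε _ => ?_
  have hε2 : (ε : ℝ≥0∞) / 2 ≠ 0 := by simpa using hε.ne'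
  obtain ⟨F, hFC, hF, hFε⟩ := hC.exists_isClosed_sdiff_lt (measure_ne_top η C) hε2
  obtain ⟨F', hFC', hF', hFε'⟩ := hC'.exists_isClosed_sdiff_lt (measure_ne_top η C') hε2
  have hk : ∀ k, η C * η C' - ε ≤ (θs k : Measure (Y × Y)) (F ×ˢ F') := fun k => by
    have hsub : C ×ˢ C' ⊆ F ×ˢ F' ∪ (Prod.fst ⁻¹' (C \ F) ∪ Prod.snd ⁻¹' (C' \ F')) := by
      rintro ⟨x, y⟩ ⟨hx, hy⟩
      by_cases hxF : x ∈ F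
      · by_cases hyF : y ∈ F'
        · exact Or.inl ⟨hxF, hyF⟩
        · exact Or.inr (Or.inr ⟨hy, hyF⟩)
      · exact Or.inr (Or.inl ⟨hx, hxF⟩)
    have e1 : (θs k : Measure (Y × Y)) (Prod.fst ⁻¹' (C \ F)) = η (C \ F) := by
      rw [← h1 k, Measure.map_apply measurable_fst (hC.diff hF.measurableSet)]
    have e2 : (θs k : Measure (Y × Y)) (Prod.snd ⁻¹' (C' \ F')) = η (C' \ F') := by
      rw [← h2 k, Measure.map_apply measurable_snd (hC'.diff hF'.measurableSet)]
    rw [tsub_le_iff_right, ← hind k]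
    refine (measure_mono hsub).trans ((measure_union_le _ _).trans ?_)
    refine add_le_add le_rfl ((measure_union_le _ _).trans ?_)
    rw [e1, e2, ← ENNReal.add_halves (ε : ℝ≥0∞)]
    exact add_le_add hFε.le hFε'.le
  have hls := ProbabilityMeasure.limsup_measure_closed_le_of_tendsto hlim (hF.prod hF')
  have hle : η C * η C' - ε ≤ limsup (fun k => (θs k : Measure (Y × Y)) (F ×ˢ F')) atTop :=
    le_limsup_of_frequently_le (Frequently.of_forall hk)
  rw [← tsub_le_iff_right]
  exact hle.trans (hls.trans (measure_mono (prod_mono hFC hFC')))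

theorem measure_prod_eq_mul_of_le {Y : Type} [MeasurableSpace Y] {η : Measure Y}
    [IsProbabilityMeasure η] {θ : Measure (Y × Y)} (hθ : θ.map Prod.fst = η) {C C' : Set Y}
    (hC : MeasurableSet C) (hC' : MeasurableSet C') (h : η C * η C' ≤ θ (C ×ˢ C'))
    (h' : η C * η C'ᶜ ≤ θ (C ×ˢ C'ᶜ)) : θ (C ×ˢ C') = η C * η C' := by
  have hsum : θ (C ×ˢ C') + θ (C ×ˢ C'ᶜ) = η C := by
    rw [← measure_union _ (hC.prod hC'.compl), ← prod_union, union_compl_self, ← hθ,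
      Measure.map_apply measurable_fst hC]
    · congr 1
      ext w
      simp
    · exact Disjoint.set_prod_right disjoint_compl_right _ _
  have hsum' : η C * η C' + η C * η C'ᶜ = η C := by
    rw [← mul_add, measure_add_measure_compl hC', measure_univ, mul_one]
  refine le_antisymm ?_ h
  have hfin : η C * η C'ᶜ ≠ ∞ := ENNReal.mul_ne_top (measure_ne_top _ _) (measure_ne_top _ _)
  refine ENNReal.le_of_add_le_add_right hfin ?_
  calc θ (C ×ˢ C') + η C * η C'ᶜ ≤ θ (C ×ˢ C') + θ (C ×ˢ C'ᶜ) := add_le_add le_rfl h'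
    _ = η C * η C' + η C * η C'ᶜ := hsum.trans hsum'.symm

variable {Y Z : Type} [MetricSpace Y] [MeasurableSpace Y] [BorelSpace Y]
  [MeasurableSpace Z] {ρ : Measure Z} [IsProbabilityMeasure ρ] {κ : Kernel Z Y} [IsMarkovKernel κ]
  {S : Y → Y} {R : Z → Z}

theorem map_fst_fiberSquare (hS : MeasurePreserving S (κ ∘ₘ ρ) (κ ∘ₘ ρ)) (k : ℕ) :
    (fiberSquare ρ κ S k).map Prod.fst = κ ∘ₘ ρ := by
  have := isProbabilityMeasure_fiberSquare (ρ := ρ) (κ := κ) hS.measurable k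
  have := Measure.isProbabilityMeasure_map (μ := fiberSquare ρ κ S k)
    (measurable_fst (α := Y) (β := Y)).aemeasurable
  refine ext_of_forall_integral_eq_of_IsFiniteMeasure fun f => ?_
  rw [integral_map measurable_fst.aemeasurable f.continuous.measurable.aestronglyMeasurable]
  exact integral_fst_fiberSquare hS k f.continuous.measurable f.norm_coe_le_norm

theorem map_snd_fiberSquare (hS : MeasurePreserving S (κ ∘ₘ ρ) (κ ∘ₘ ρ)) (k : ℕ) :
    (fiberSquare ρ κ S k).map Prod.snd = κ ∘ₘ ρ := by
  have := isProbabilityMeasure_fiberSquare (ρ := ρ) (κ := κ) hS.measurable k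
  have := Measure.isProbabilityMeasure_map (μ := fiberSquare ρ κ S k)
    (measurable_snd (α := Y) (β := Y)).aemeasurable
  refine ext_of_forall_integral_eq_of_IsFiniteMeasure fun f => ?_
  rw [integral_map measurable_snd.aemeasurable f.continuous.measurable.aestronglyMeasurable]
  exact integral_snd_fiberSquare hS k f.continuous.measurable f.norm_coe_le_norm

variable [CompactSpace Y]

/-- A joining with an ergodic system that is not a product produces a self-joining that is not a
product although invariant sets of the two coordinates are independent. -/
theorem compProd_eq_prod_of_forall_selfJoining (hS : Continuous S) (hR : Ergodic R ρ)
    (hinv : MeasurePreserving (Prod.map R S) (ρ ⊗ₘ κ) (ρ ⊗ₘ κ))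
    (hSη : MeasurePreserving S (κ ∘ₘ ρ) (κ ∘ₘ ρ))
    (H : ∀ θ : Measure (Y × Y), IsProbabilityMeasure θ →
      MeasurePreserving (Prod.map S S) θ θ → θ.map Prod.fst = κ ∘ₘ ρ →
      θ.map Prod.snd = κ ∘ₘ ρ →
      (∀ C C' : Set Y, MeasurableSet C → MeasurableSet C' → S ⁻¹' C = C → S ⁻¹' C' = C' →
        θ (C ×ˢ C') = (κ ∘ₘ ρ) C * (κ ∘ₘ ρ) C') → θ = (κ ∘ₘ ρ).prod (κ ∘ₘ ρ)) :
    ρ ⊗ₘ κ = ρ.prod (κ ∘ₘ ρ) := by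
  have hSm : Measurable S := hS.measurable
  let θs : ℕ → ProbabilityMeasure (Y × Y) := fun k =>
    ⟨fiberSquare ρ κ S k, isProbabilityMeasure_fiberSquare hSm k⟩
  obtain ⟨θ, φ, hφ, hθ⟩ := CompactSpace.tendsto_subseq θs
  have hintegral : ∀ F : Y × Y →ᵇ ℝ, Tendsto (fun k => ∫ p, F p ∂(fiberSquare ρ κ S (φ k))) atTop
      (𝓝 (∫ p, F p ∂(θ : Measure (Y × Y)))) :=
    ProbabilityMeasure.tendsto_iff_forall_integral_tendsto.1 hθ
  have hmul : ∀ f g : Y →ᵇ ℝ, Tendsto (fun k => ∫ p, f p.1 * g p.2 ∂(fiberSquare ρ κ S (φ k)))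
      atTop (𝓝 (∫ p, f p.1 * g p.2 ∂(θ : Measure (Y × Y)))) := fun f g =>
    hintegral (f.compContinuous ⟨Prod.fst, continuous_fst⟩ *
      g.compContinuous ⟨Prod.snd, continuous_snd⟩)
  have hmul' : ∀ f g : Y →ᵇ ℝ, Tendsto (fun k => ∫ p, f p.1 * g p.2 ∂(fiberSquare ρ κ S k))
      atTop (𝓝 (∫ p, f p.1 * g p.2 ∂(θ : Measure (Y × Y)))) := fun f g => by
    obtain ⟨L, hL⟩ := exists_tendsto_integral_fiberSquare (κ := κ) hR.toMeasurePreserving hinv hSm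
      f.continuous.measurable g.continuous.measurable f.norm_coe_le_norm g.norm_coe_le_norm
    rwa [tendsto_nhds_unique (hmul f g) (hL.comp hφ.tendsto_atTop)]
  have hθinv : MeasurePreserving (Prod.map S S) (θ : Measure (Y × Y)) θ := by
    have hSS : Measurable (Prod.map S S) := hSm.prodMap hSm
    refine ⟨hSS, ?_⟩
    have := Measure.isProbabilityMeasure_map (μ := (θ : Measure (Y × Y))) hSS.aemeasurable
    refine Measure.ext_of_integral_mul_boundedContinuousFunction fun f g => ?_
    have hfg : Measurable fun p : Y × Y => f p.1 * g p.2 :=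
      (f.continuous.measurable.comp measurable_fst).mul
        (g.continuous.measurable.comp measurable_snd)
    rw [integral_map hSS.aemeasurable hfg.aestronglyMeasurable]
    refine tendsto_nhds_unique
      (hmul' (f.compContinuous ⟨S, hS⟩) (g.compContinuous ⟨S, hS⟩)) ?_
    refine ((hmul' f g).comp (tendsto_add_atTop_nat 1)).congr fun k => ?_
    have hf' := (f.compContinuous ⟨S, hS⟩).norm_coe_le_norm
    have hg' := (g.compContinuous ⟨S, hS⟩).norm_coe_le_norm
    rw [Function.comp_apply, integral_fiberSquare hSm (k + 1) f.continuous.measurable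
      g.continuous.measurable f.norm_coe_le_norm g.norm_coe_le_norm,
      integral_fiberSquare hSm k (BoundedContinuousFunction.continuous _).measurable
      (BoundedContinuousFunction.continuous _).measurable hf' hg']
    simp only [Function.iterate_succ_apply', BoundedContinuousFunction.compContinuous_apply,
      ContinuousMap.coe_mk]
  have hθ1 : (θ : Measure (Y × Y)).map Prod.fst = κ ∘ₘ ρ := by
    have := Measure.isProbabilityMeasure_map (μ := (θ : Measure (Y × Y)))
      (measurable_fst (α := Y) (β := Y)).aemeasurable
    refine ext_of_forall_integral_eq_of_IsFiniteMeasure fun f => ?_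
    rw [integral_map measurable_fst.aemeasurable f.continuous.measurable.aestronglyMeasurable]
    refine tendsto_nhds_unique (hintegral (f.compContinuous ⟨Prod.fst, continuous_fst⟩))
      (tendsto_const_nhds.congr fun k => ?_)
    exact (integral_fst_fiberSquare hSη (φ k) f.continuous.measurable f.norm_coe_le_norm).symm
  have hθ2 : (θ : Measure (Y × Y)).map Prod.snd = κ ∘ₘ ρ := by
    have := Measure.isProbabilityMeasure_map (μ := (θ : Measure (Y × Y)))
      (measurable_snd (α := Y) (β := Y)).aemeasurable
    refine ext_of_forall_integral_eq_of_IsFiniteMeasure fun f => ?_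
    rw [integral_map measurable_snd.aemeasurable f.continuous.measurable.aestronglyMeasurable]
    refine tendsto_nhds_unique (hintegral (f.compContinuous ⟨Prod.snd, continuous_snd⟩))
      (tendsto_const_nhds.congr fun k => ?_)
    exact (integral_snd_fiberSquare hSη (φ k) f.continuous.measurable f.norm_coe_le_norm).symm
  have hge : ∀ C C' : Set Y, MeasurableSet C → MeasurableSet C' → S ⁻¹' C = C → S ⁻¹' C' = C' →
      (κ ∘ₘ ρ) C * (κ ∘ₘ ρ) C' ≤ (θ : Measure (Y × Y)) (C ×ˢ C') := fun C C' hC hC' hSC hSC' =>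
    mul_le_measure_prod_of_tendsto hθ hC hC' (fun k => map_fst_fiberSquare hSη (φ k))
      (fun k => map_snd_fiberSquare hSη (φ k))
      fun k => fiberSquare_prod_of_preimage_eq hR hinv hSm (φ k) hC hC' hSC hSC'
  have hprod : (θ : Measure (Y × Y)) = (κ ∘ₘ ρ).prod (κ ∘ₘ ρ) :=
    H θ inferInstance hθinv hθ1 hθ2 fun C C' hC hC' hSC hSC' =>
      measure_prod_eq_mul_of_le hθ1 hC hC' (hge C C' hC hC' hSC hSC')
        (hge C C'ᶜ hC hC'.compl hSC (by rw [preimage_compl, hSC']))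
  have hconst : ∀ f : Y →ᵇ ℝ, ∀ᵐ z ∂ρ, ∫ y, f y ∂(κ z) = ∫ y, f y ∂(κ ∘ₘ ρ) := fun f => by
    have hfm := f.continuous.measurable
    have hfb : ∀ y, |f y| ≤ ‖f‖ := f.norm_coe_le_norm
    have hum : Measurable fun z => ∫ y, f y ∂(κ z) := measurable_integral_kernel hfm
    have hub : ∀ z, |∫ y, f y ∂(κ z)| ≤ ‖f‖ := abs_integral_kernel_le hfb
    refine ae_eq_of_integral_sq_le (integrable_of_abs_le hum hub) ?_
      (integral_comp_measure (integrable_of_abs_le hfm hfb)).symm ?_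
    · simp only [sq]
      exact integrable_of_abs_le (hum.mul hum) fun z => abs_mul_le_mul_of_abs_le (hub z) (hub z)
    · have hlim := hmul' f f
      rw [hprod, integral_prod_mul] at hlim
      have h0 := (monotone_integral_fiberSquare (κ := κ) hR.toMeasurePreserving hinv hSm hfm
        hfb).ge_of_tendsto hlim 0
      simp only [integral_fiberSquare hSm 0 hfm hfm hfb hfb, Function.iterate_zero, id] at h0
      simpa only [sq] using h0
  refine (Measure.prod_eq fun D E hD hE => ?_).symm
  have hρD : (κ ∘ₘ ρ.restrict D) = ρ D • (κ ∘ₘ ρ) := by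
    have : IsFiniteMeasure (ρ D • (κ ∘ₘ ρ)) := Measure.smul_finite _ (measure_ne_top _ _)
    refine ext_of_forall_integral_eq_of_IsFiniteMeasure fun f => ?_
    have hfi : Integrable f (κ ∘ₘ ρ.restrict D) :=
      integrable_of_abs_le f.continuous.measurable f.norm_coe_le_norm
    rw [integral_comp_measure hfi, integral_smul_measure,
      integral_congr_ae (ae_restrict_of_ae (hconst f)), setIntegral_const]
    rfl
  rw [Measure.compProd_apply_prod hD hE, ← Measure.bind_apply hE κ.aemeasurable, hρD]
  rfl

end LimitJoining

section Disjointness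

theorem eq_prod_of_joining_of_forall_selfJoining {Y Z : Type} [MetricSpace Y] [CompactSpace Y]
    [MeasurableSpace Y] [BorelSpace Y] [MeasurableSpace Z] {ρ : Measure Z} {η : Measure Y}
    [IsProbabilityMeasure η] {S : Y → Y} {R : Z → Z} (hS : Continuous S)
    [IsProbabilityMeasure ρ] (hR : Ergodic R ρ) (hSη : MeasurePreserving S η η)
    (H : ∀ θ : Measure (Y × Y), IsProbabilityMeasure θ →
      MeasurePreserving (Prod.map S S) θ θ → θ.map Prod.fst = η → θ.map Prod.snd = η →
      (∀ C C' : Set Y, MeasurableSet C → MeasurableSet C' → S ⁻¹' C = C → S ⁻¹' C' = C' →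
        θ (C ×ˢ C') = η C * η C') → θ = η.prod η)
    {ψ : Measure (Y × Z)} [IsProbabilityMeasure ψ]
    (hψ : MeasurePreserving (Prod.map S R) ψ ψ) (hψ1 : ψ.map Prod.fst = η)
    (hψ2 : ψ.map Prod.snd = ρ) : ψ = η.prod ρ := by
  have hY : Nonempty Y := nonempty_of_isProbabilityMeasure η
  have hswap := Measure.isProbabilityMeasure_map (μ := ψ)
    (measurable_swap (α := Y) (β := Z)).aemeasurable
  set ψ' : Measure (Z × Y) := ψ.map Prod.swap with hψ'
  have hfst : ψ'.fst = ρ := by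
    rw [Measure.fst, hψ', Measure.map_map measurable_fst measurable_swap, ← hψ2]
    rfl
  have hdis : ρ ⊗ₘ ψ'.condKernel = ψ' := by
    rw [← hfst]
    exact ψ'.disintegrate ψ'.condKernel
  have hsnd : ψ'.condKernel ∘ₘ ρ = η := by
    rw [← Measure.snd_compProd, hdis, Measure.snd, hψ',
      Measure.map_map measurable_snd measurable_swap, ← hψ1]
    rfl
  have hinv : MeasurePreserving (Prod.map R S) ψ' ψ' := by
    refine ⟨hR.measurable.prodMap hS.measurable, ?_⟩
    rw [hψ', Measure.map_map (hR.measurable.prodMap hS.measurable) measurable_swap]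
    conv_rhs => rw [← hψ.map_eq, Measure.map_map measurable_swap hψ.measurable]
    rfl
  have key : ρ ⊗ₘ ψ'.condKernel = ρ.prod (ψ'.condKernel ∘ₘ ρ) := by
    refine compProd_eq_prod_of_forall_selfJoining (S := S) (R := R) hS hR ?_ ?_ ?_
    · rwa [hdis]
    · rwa [hsnd]
    · rwa [hsnd]
  rw [hdis, hsnd] at key
  have h2 : ψ = ψ'.map Prod.swap := by
    rw [hψ', Measure.map_map measurable_swap measurable_swap]
    simp
  rw [h2, key, Measure.prod_swap]

end Disjointness

end

/-- Let `T` be a `μ`-preserving homeomorphism of a compact metric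
space `X`, with ergodic decomposition `μ = ∫ μ_x̄ dP(x̄)` (expressed via `μ = P.bind m`
with ergodic `T`-invariant probability fibers `m b`), where `P` is continuous
(atomless).  Assume that (i) each fiber system is disjoint from all but countably many
other fibers, (ii) any two non-disjoint fibers are isomorphic, and (iii) every fiber
has the MSJ property.  Then for every `n ≥ 1` and every `n`-fold self-joining `η` of
`(T, μ)`, the system `(T^{×n}, η)` is disjoint from every ergodic system. -/
theorem selfJoinings_disjoint_from_ergodic
    {X : Type} [MetricSpace X] [CompactSpace X] [MeasurableSpace X] [BorelSpace X]
    (T : X ≃ₜ X) (μ : Measure X) [IsProbabilityMeasure μ]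
    (hT : MeasurePreserving T μ μ)
    {Xb : Type} [MeasurableSpace Xb] (P : Measure Xb) [IsProbabilityMeasure P]
    (hPcont : ∀ b : Xb, P {b} = 0)
    (m : Xb → Measure X) (hm : Measurable m)
    (hprob : ∀ b, IsProbabilityMeasure (m b))
    (herg : ∀ b, Ergodic T (m b))
    (hdec : μ = P.bind m)
    (hcount : ∀ b : Xb, Set.Countable {b' : Xb | ¬ FibersDisjoint T (m b) (m b')})
    (hiso : ∀ b b' : Xb, ¬ FibersDisjoint T (m b) (m b') →
      FibersIsomorphic T (m b) (m b'))
    (hmsj : ∀ b : Xb, HasMSJ (T.toEquiv) (m b)) :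
    ∀ (n : ℕ), 1 ≤ n →
    ∀ η : Measure (Fin n → X), IsProbabilityMeasure η →
      MeasurePreserving (fun x i => T (x i)) η η →
      (∀ i, η.map (fun x => x i) = μ) →
    ∀ (Z : Type) [MeasurableSpace Z] (ρ : Measure Z) (R : Z → Z),
      IsProbabilityMeasure ρ → Ergodic R ρ →
    ∀ ψ : Measure ((Fin n → X) × Z), IsProbabilityMeasure ψ →
      MeasurePreserving (Prod.map (fun x i => T (x i)) R) ψ ψ →
      ψ.map Prod.fst = η → ψ.map Prod.snd = ρ →
      ψ = η.prod ρ := by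
  intro n _ η hη hηinv hη1 Z _ ρ R hρ hR ψ hψ hψinv hψ1 hψ2
  let T' : X ≃ᵐ X := T.toMeasurableEquiv
  let mm : Xb → ProbabilityMeasure X := fun b => ⟨m b, hprob b⟩
  have hmm : Measurable mm := hm.subtype_mk
  have hnull : NullSingletonClass P := ⟨hPcont⟩
  have hat := countable_setOf_atomic_fiber (T := T') hprob herg hcount
  obtain ⟨C, hC, hC0, hCgood⟩ := exists_measurable_cover_isGood (T := T') hmm
    (hat.measure_zero P) fun b hb =>
      HasMSJ.isGood (T := T') (ν := m b) (herg b) (hmsj b) (not_not.1 hb)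
  obtain ⟨D, hD, hD0, hDdisj⟩ := exists_measurable_cover_fibersDisjoint (T := T') hmm hPcont hcount
  obtain ⟨K, hK⟩ := exists_isErgodicKernel (S := T') hT
  have hKm := hK.isMarkovKernel
  have hQ : μ.map (ergodicLabel K) = P.map mm := hK.map_ergodicLabel hmm herg hdec
  have hgood : ∀ᵐ x ∂μ, IsGood T' (K x) := by
    have hx : ∀ᵐ x ∂μ, ergodicLabel K x ∉ C := by
      have h : μ.map (ergodicLabel K) C = 0 := by rw [hQ, Measure.map_apply hmm hC, hC0]
      rw [Measure.map_apply (measurable_ergodicLabel K) hC] at h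
      exact measure_eq_zero_iff_ae_notMem.1 h
    filter_upwards [hx, hK.ae_ergodic] with x hx1 hx2
    exact hCgood _ hx1 hx2
  have hQD : ((μ.map (ergodicLabel K)).prod (μ.map (ergodicLabel K))) D = 0 := by
    rw [hQ, Measure.map_prod_map P P hmm hmm, Measure.map_apply (hmm.prodMap hmm) hD, hD0]
  have hS : Continuous fun (x : Fin n → X) i => T (x i) := by fun_prop
  exact eq_prod_of_joining_of_forall_selfJoining hS hR hηinv
    (fun θ hθ hθinv hθ1 hθ2 hind =>
      eq_prod_of_independent_invariant hK hgood hQD hDdisj hηinv hη1 hθinv hθ1 hθ2 hind)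
    hψinv hψ1 hψ2
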